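/- Let F be a number field with odd class number h(F), and let k/F be a quadratic extension in which exactly two prime ideals 𝔭₁ and 𝔭₂ of odd norm ramify (and which is unramified at all primes above 2 and at all infinite places). Suppose 𝔭₁ and 𝔭₂ are primary, write 𝔭_j^{h(F)} = (π_j) with π_j primary, set k_j = F(√π_j) with unit group E_j, and suppose (𝔭₁/𝔭₂) := [π₁/𝔭₂] = +1 and (𝔭₂/𝔭₁) := [π₂/𝔭₁] = +1, so that 𝔭₂ splits in k₁ and 𝔭₁ splits in k₂. Then the reciprocity law (E₁/𝔭₂) = (E₂/𝔭₁) holds, where (E_j/𝔭_i) denotes the common value of (E_j/𝔓_i) over the primes 𝔓_i of k_j above 𝔭_i. -/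

import Mathlib

open NumberField
open scoped Classical

/-- The quadratic residue symbol `[α/𝔭] ∈ {±1}`, determined by Euler's congruence
`[α/𝔭] ≡ α^((N𝔭 - 1)/2) (mod 𝔭)`. -/
noncomputable def quadResSym (F : Type*) [Field F] [NumberField F]
    (𝔭 : Ideal (𝓞 F)) (α : 𝓞 F) : ℤ :=
  if α ^ ((Ideal.absNorm 𝔭 - 1) / 2) - 1 ∈ 𝔭 then 1 else -1

/-- An ideal `𝔭` is primary if `[ε/𝔭] = 1` for every unit `ε`, i.e. `(E_F/𝔭) = +1`. -/
def IsPrimaryIdeal (F : Type*) [Field F] [NumberField F] (𝔭 : Ideal (𝓞 F)) : Prop :=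
  ∀ ε : (𝓞 F)ˣ, quadResSym F 𝔭 (ε : 𝓞 F) = 1

/-- An element of the ring of integers is primary if it is totally positive and
congruent to a square modulo 4. -/
def IsPrimaryElem (F : Type*) [Field F] [NumberField F] (α : 𝓞 F) : Prop :=
  (∀ φ : F →+* ℝ, 0 < φ (algebraMap (𝓞 F) F α)) ∧ ∃ ξ : 𝓞 F, (4 : 𝓞 F) ∣ α - ξ ^ 2

/-- A prime ideal `𝔭` of `F` is ramified in `K` if some prime of `K` appears at least
twice in the factorization of `𝔭 O_K`. -/
def IsRamifiedIn (F K : Type*) [Field F] [NumberField F] [Field K] [NumberField K]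
    [Algebra F K] (𝔭 : Ideal (𝓞 F)) : Prop :=
  ∃ 𝔓 : Ideal (𝓞 K), 𝔓.IsPrime ∧ 𝔓 ^ 2 ∣ Ideal.map (algebraMap (𝓞 F) (𝓞 K)) 𝔭

/-- `K/F` is unramified at all infinite places: every real embedding of `F`
extends to a real embedding of `K`. -/
def UnramifiedAtInfinitePlaces (F K : Type*) [Field F] [Field K] [Algebra F K] : Prop :=
  ∀ φ : F →+* ℝ, ∃ ψ : K →+* ℝ, ψ.comp (algebraMap F K) = φ


namespace Sch

open IsDedekindDomain HeightOneSpectrum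

/-- Height one primes of the ring of integers. -/
abbrev Pl (K : Type*) [Field K] [NumberField K] := HeightOneSpectrum (𝓞 K)

section ord
variable {K : Type*} [Field K] [NumberField K]

/-- Additive valuation. -/
noncomputable def ord (v : Pl K) (x : K) : ℤ := -(WithZero.log (v.valuation K x))

lemma val_ne (v : Pl K) {x : K} (hx : x ≠ 0) : v.valuation K x ≠ 0 :=
  (Valuation.ne_zero_iff _).2 hx

lemma ord_zero (v : Pl K) : ord v 0 = 0 := by simp [ord]

lemma ord_mul (v : Pl K) {x y : K} (hx : x ≠ 0) (hy : y ≠ 0) :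
    ord v (x * y) = ord v x + ord v y := by
  simp only [ord, map_mul, WithZero.log_mul (val_ne v hx) (val_ne v hy)]; ring

lemma ord_one (v : Pl K) : ord v 1 = 0 := by simp [ord]

lemma ord_inv (v : Pl K) (x : K) : ord v x⁻¹ = - ord v x := by
  simp [ord, WithZero.log_inv]

lemma ord_pow (v : Pl K) (x : K) (n : ℕ) : ord v (x ^ n) = n * ord v x := by
  simp [ord, WithZero.log_pow]

lemma ord_zpow (v : Pl K) (x : K) (n : ℤ) : ord v (x ^ n) = n * ord v x := by
  simp [ord, WithZero.log_zpow]

lemma ord_neg (v : Pl K) (x : K) : ord v (-x) = ord v x := by simp [ord, Valuation.map_neg]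

lemma ord_div (v : Pl K) {x y : K} (hx : x ≠ 0) (hy : y ≠ 0) :
    ord v (x / y) = ord v x - ord v y := by
  rw [div_eq_mul_inv, ord_mul v hx (inv_ne_zero hy), ord_inv]; ring

lemma ord_prod {ι : Type*} (v : Pl K) (s : Finset ι) (f : ι → K) (hf : ∀ i ∈ s, f i ≠ 0) :
    ord v (∏ i ∈ s, f i) = ∑ i ∈ s, ord v (f i) := by
  classical
  induction s using Finset.induction_on with
  | empty => simp [ord_one]
  | insert a s ha ih =>
    rw [Finset.prod_insert ha, Finset.sum_insert ha, ord_mul v (hf a (by simp)), ih]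
    · intro i hi; exact hf i (by simp [hi])
    · exact Finset.prod_ne_zero_iff.2 fun i hi => hf i (by simp [hi])

lemma ord_nonneg_iff (v : Pl K) {x : K} (hx : x ≠ 0) : 0 ≤ ord v x ↔ v.valuation K x ≤ 1 := by
  rw [ord, neg_nonneg, ← WithZero.log_one, WithZero.log_le_log (val_ne v hx) one_ne_zero]

lemma ord_pos_iff (v : Pl K) {x : K} (hx : x ≠ 0) : 0 < ord v x ↔ v.valuation K x < 1 := by
  rw [ord, neg_pos, ← WithZero.log_one, WithZero.log_lt_log (val_ne v hx) one_ne_zero]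

lemma ord_le_iff (v : Pl K) {x y : K} (hx : x ≠ 0) (hy : y ≠ 0) :
    ord v x ≤ ord v y ↔ v.valuation K y ≤ v.valuation K x := by
  rw [ord, ord, neg_le_neg_iff, WithZero.log_le_log (val_ne v hy) (val_ne v hx)]

lemma ord_lt_iff (v : Pl K) {x y : K} (hx : x ≠ 0) (hy : y ≠ 0) :
    ord v x < ord v y ↔ v.valuation K y < v.valuation K x := by
  rw [ord, ord, neg_lt_neg_iff, WithZero.log_lt_log (val_ne v hy) (val_ne v hx)]

lemma ord_add_eq (v : Pl K) {x y : K} (hx : x ≠ 0) (hy : y ≠ 0) (h : ord v x < ord v y) :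
    ord v (x + y) = ord v x := by
  rw [ord_lt_iff v hx hy] at h
  rw [ord, Valuation.map_add_eq_of_lt_left _ h, ord]

lemma ord_add_ge (v : Pl K) {x y : K} (hx : x ≠ 0) (hy : y ≠ 0) (hxy : x + y ≠ 0) (h : ord v x ≤ ord v y) :
    ord v x ≤ ord v (x + y) := by
  rw [ord_le_iff v hx hy] at h
  rw [ord_le_iff v hx hxy]
  exact (Valuation.map_add _ _ _).trans (max_le le_rfl h)

lemma ord_int_nonneg (v : Pl K) (a : 𝓞 K) : 0 ≤ ord v (a : K) := by
  by_cases h : a = 0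
  · simp [h, ord_zero]
  · rw [ord_nonneg_iff v (by simpa using h)]; exact v.valuation_le_one a

lemma ord_int_pos_iff (v : Pl K) {a : 𝓞 K} (ha : a ≠ 0) : 0 < ord v (a : K) ↔ a ∈ v.asIdeal := by
  rw [ord_pos_iff v (by simpa using ha)]; exact v.valuation_lt_one_iff_mem a

lemma ord_int_eq_zero_iff (v : Pl K) {a : 𝓞 K} (ha : a ≠ 0) :
    ord v (a : K) = 0 ↔ a ∉ v.asIdeal := by
  rw [← ord_int_pos_iff v ha]; have := ord_int_nonneg v a; omega

lemma exists_int_of_ord {x : K} (hx : x ≠ 0) (h : ∀ v : Pl K, 0 ≤ ord v x) :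
    ∃ a : 𝓞 K, (a : K) = x :=
  mem_integers_of_valuation_le_one (R := 𝓞 K) K x fun v => (ord_nonneg_iff v hx).1 (h v)

lemma ord_unit (v : Pl K) (u : (𝓞 K)ˣ) : ord v ((u : 𝓞 K) : K) = 0 := by
  rw [ord_int_eq_zero_iff v u.ne_zero]
  intro h
  exact v.isPrime.ne_top (Ideal.eq_top_of_isUnit_mem _ h u.isUnit)

lemma exists_unit_of_ord {x : K} (hx : x ≠ 0) (h : ∀ v : Pl K, ord v x = 0) :
    ∃ u : (𝓞 K)ˣ, ((u : 𝓞 K) : K) = x := by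
  obtain ⟨a, ha⟩ := exists_int_of_ord hx fun v => (h v).ge
  obtain ⟨b, hb⟩ := exists_int_of_ord (inv_ne_zero hx) fun v => by rw [ord_inv, h v]; simp
  refine ⟨⟨a, b, ?_, ?_⟩, ha⟩ <;> apply RingOfIntegers.ext <;> simp [ha, hb, hx]

/-- local integrality as fraction -/
lemma exists_frac (v : Pl K) {x : K} (hx : x ≠ 0) (h : 0 ≤ ord v x) :
    ∃ a b : 𝓞 K, b ∉ v.asIdeal ∧ x * b = a := by
  obtain ⟨n, d, hn⟩ := v.exists_primeCompl_mul_eq_of_integer (K := K) x ((ord_nonneg_iff v hx).1 h)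
  exact ⟨n, d, d.2, hn⟩

lemma ord_finite {x : K} (hx : x ≠ 0) : {v : Pl K | ord v x ≠ 0}.Finite := by
  obtain ⟨a, b, hb, rfl⟩ := IsFractionRing.div_surjective (A := 𝓞 K) x
  have hb0 : b ≠ 0 := nonZeroDivisors.ne_zero hb
  have ha0 : a ≠ 0 := by rintro rfl; simp at hx
  have key : ∀ c : 𝓞 K, c ≠ 0 → {v : Pl K | c ∈ v.asIdeal}.Finite := fun c hc => by
    have := Ideal.finite_factors (I := Ideal.span {c}) (by simpa using hc)
    refine this.subset fun v hv => ?_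
    simpa [Ideal.dvd_span_singleton] using hv
  refine ((key a ha0).union (key b hb0)).subset fun v hv => ?_
  by_contra hcon
  simp only [Set.mem_union, Set.mem_ofPred_eq, not_or] at hcon
  apply hv
  rw [ord_div v (by simpa using ha0) (by simpa using hb0)]
  have h1 := (ord_int_eq_zero_iff v ha0).2 hcon.1
  have h2 := (ord_int_eq_zero_iff v hb0).2 hcon.2
  rw [h1, h2]; rfl

lemma exists_gen (v : Pl K) : ∃ ρ : 𝓞 K, v.asIdeal ^ classNumber K = Ideal.span {ρ} := by
  have hv : v.asIdeal ∈ nonZeroDivisors (Ideal (𝓞 K)) := mem_nonZeroDivisors_of_ne_zero v.ne_bot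
  have := (ClassGroup.mk0_eq_one_iff (I := v.asIdeal ^ classNumber K) (pow_mem hv _)).1 (by
    have h2 : (⟨v.asIdeal ^ classNumber K, pow_mem hv _⟩ : nonZeroDivisors (Ideal (𝓞 K))) =
      ⟨v.asIdeal, hv⟩ ^ classNumber K := by ext1; simp
    rw [h2, map_pow, classNumber, pow_card_eq_one])
  exact ⟨_, (Ideal.span_singleton_generator _).symm⟩

lemma gen_ne_zero (v : Pl K) {n : ℕ} {ρ : 𝓞 K} (h : v.asIdeal ^ n = Ideal.span {ρ}) : ρ ≠ 0 := by
  rintro rfl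
  exact pow_ne_zero n v.ne_bot (by simpa using h)

lemma ord_gen (v w : Pl K) {n : ℕ} {ρ : 𝓞 K} (h : v.asIdeal ^ n = Ideal.span {ρ}) :
    ord w (ρ : K) = if w = v then (n : ℤ) else 0 := by
  have h0 := gen_ne_zero v h
  split_ifs with hw
  · subst hw
    rw [ord, valuation_of_algebraMap, intValuation_if_neg _ h0, ← h, WithZero.log_exp, neg_neg]
    congr 1
    rw [Associates.mk_pow, Associates.count_pow (Associates.mk_ne_zero.2 w.ne_bot) w.associates_irreducible,
      Associates.count_self w.associates_irreducible, mul_one]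
  · rw [ord_int_eq_zero_iff w h0]
    intro hm
    have : v.asIdeal ^ n ≤ w.asIdeal := by rw [h, Ideal.span_singleton_le_iff_mem]; exact hm
    have := w.isPrime.le_of_pow_le this
    exact hw (HeightOneSpectrum.ext (v.isMaximal.eq_of_le w.isPrime.ne_top this).symm)

/-- chosen generator of `v ^ h` -/
noncomputable def gen (v : Pl K) : 𝓞 K := (exists_gen v).choose
lemma gen_spec (v : Pl K) : v.asIdeal ^ classNumber K = Ideal.span {gen v} := (exists_gen v).choose_spec

lemma exists_ord (n : Pl K → ℤ) (hn : {v | n v ≠ 0}.Finite) :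
    ∃ a : K, a ≠ 0 ∧ ∀ v, ord v a = classNumber K * n v := by
  have hne : ∀ v : Pl K, ((gen v : 𝓞 K) : K) ≠ 0 := fun v => by
    simpa using gen_ne_zero v (gen_spec v)
  refine ⟨∏ v ∈ hn.toFinset, ((gen v : 𝓞 K) : K) ^ n v,
    Finset.prod_ne_zero_iff.2 fun v _ => zpow_ne_zero _ (hne v), fun v => ?_⟩
  rw [ord_prod _ _ _ fun v _ => zpow_ne_zero _ (hne v)]
  simp only [ord_zpow, ord_gen _ _ (gen_spec _)]
  simp only [mul_ite, mul_zero, Finset.sum_ite_eq]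
  split_ifs with h
  · ring
  · simp at h; simp [h]

end ord

section ext
variable {F L : Type*} [Field F] [NumberField F] [Field L] [NumberField L] [Algebra F L]

/-- prime below -/
noncomputable def below (F : Type*) [Field F] [NumberField F] [Algebra F L] (w : Pl L) : Pl F :=
  w.under (𝓞 F)

/-- ramification index -/
noncomputable def ram (F : Type*) [Field F] [NumberField F] [Algebra F L] (w : Pl L) : ℕ :=
  (below F w).asIdeal.ramificationIdx' w.asIdeal

lemma ord_ext (w : Pl L) (x : F) : ord w (algebraMap F L x) = ram F w * ord (below F w) x := by
  have : w.asIdeal.LiesOver (below F w).asIdeal := ⟨rfl⟩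
  rw [ord, ← valuation_liesOver (A := 𝓞 F) L (below F w) w x, WithZero.log_pow, ord, ram]
  simp

lemma mem_below (w : Pl L) (a : 𝓞 F) : a ∈ (below F w).asIdeal ↔ algebraMap (𝓞 F) (𝓞 L) a ∈ w.asIdeal :=
  Iff.rfl

lemma ram_pos (w : Pl L) : 0 < ram F w := by
  have : w.asIdeal.LiesOver (below F w).asIdeal := ⟨rfl⟩
  exact Nat.pos_of_ne_zero (Ideal.IsDedekindDomain.ramificationIdx'_ne_zero_of_liesOver w.asIdeal (below F w).ne_bot)

end ext
end Sch

namespace Sch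

section grp

/-- multiplication by two -/
abbrev dbl (A : Type*) [AddCommGroup A] : A →+ A := nsmulAddMonoidHom 2

lemma dbl_finite (B : Type*) [AddCommGroup B] [Finite B] :
    (dbl B).range.index = Nat.card (dbl B).ker := by
  have h1 := AddSubgroup.card_mul_index (dbl B).range
  have h2 := AddSubgroup.card_mul_index (dbl B).ker
  rw [AddSubgroup.index_ker] at h2
  have h3 : 0 < Nat.card (dbl B).range := Nat.card_pos
  rw [← h2, mul_comm] at h1
  exact Nat.eq_of_mul_eq_mul_right h3 h1

lemma dbl_free (n : ℕ) : (dbl (Fin n →₀ ℤ)).range.index = 2 ^ n := by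
  let f : (Fin n →₀ ℤ) →+ (Fin n → ZMod 2) :=
    { toFun := fun x i => (x i : ZMod 2), map_zero' := by ext; simp, map_add' := by intros; ext; simp }
  have hf : Function.Surjective f := fun y =>
    ⟨Finsupp.equivFunOnFinite.symm fun i => ((y i).val : ℤ), by ext i; simp [f]⟩
  have hk : f.ker = (dbl (Fin n →₀ ℤ)).range := by
    ext x
    simp only [AddMonoidHom.mem_ker, AddMonoidHom.mem_range, nsmulAddMonoidHom_apply]
    constructor
    · intro h
      have h' : ∀ i, ∃ c, x i = 2 * c := fun i => by
        have := congrFun h i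
        exact (ZMod.intCast_zmod_eq_zero_iff_dvd _ 2).1 this
      choose c hc using h'
      exact ⟨Finsupp.equivFunOnFinite.symm c, by ext i; simp [hc]⟩
    · rintro ⟨y, rfl⟩
      ext i
      simp only [f, AddMonoidHom.coe_mk, ZeroHom.coe_mk, Finsupp.smul_apply, nsmul_eq_mul]
      push_cast
      have : (2 : ZMod 2) = 0 := rfl
      simp [this]
  rw [← hk, AddSubgroup.index_ker, AddMonoidHom.range_eq_top.2 hf, AddSubgroup.card_top]
  simp [Nat.card_eq_fintype_card]

lemma dbl_equiv {A B : Type*} [AddCommGroup A] [AddCommGroup B] (e : A ≃+ B) :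
    (dbl A).range.index = (dbl B).range.index ∧ Nat.card (dbl A).ker = Nat.card (dbl B).ker := by
  constructor
  · rw [← AddSubgroup.index_map_equiv _ e]
    congr 1
    ext x
    constructor
    · rintro ⟨_, ⟨y, rfl⟩, rfl⟩; exact ⟨e y, by simp⟩
    · rintro ⟨y, rfl⟩; exact ⟨2 • e.symm y, ⟨e.symm y, rfl⟩, by simp⟩
  · apply Nat.card_congr
    refine e.toEquiv.subtypeEquiv fun a => ?_
    simp only [AddMonoidHom.mem_ker, nsmulAddMonoidHom_apply]
    constructor
    · intro h; simpa [h] using (map_nsmul e 2 a).symm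
    · intro h; apply e.injective; simpa using h

lemma finrank_rk {A B : Type*} [AddCommGroup A] [AddCommGroup B] [Module.Finite ℤ A] (f : A →ₗ[ℤ] B) :
    Module.finrank ℤ (LinearMap.range f) + Module.finrank ℤ (LinearMap.ker f) = Module.finrank ℤ A := by
  rw [← Submodule.finrank_quotient_add_finrank (LinearMap.ker f), f.quotKerEquivRange.finrank_eq]

lemma dbl_index (A : Type*) [AddCommGroup A] [Module.Finite ℤ A] :
    (dbl A).range.index = 2 ^ Module.finrank ℤ A * Nat.card (dbl A).ker := by
  have : AddGroup.FG A := AddGroup.fg_iff_addMonoid_fg.2 (Module.Finite.iff_addMonoid_fg.1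
    (Module.Finite.iff_addGroup_fg.1 inferInstance |> fun h => Module.Finite.iff_addMonoid_fg.2 (AddGroup.fg_iff_addMonoid_fg.1 h)))
  obtain ⟨n, ι, _, p, hp, e, ⟨E⟩⟩ := AddCommGroup.equiv_free_prod_directSum_zmod A
  let B := DirectSum ι fun i => ZMod (p i ^ e i)
  have : ∀ i, NeZero (p i ^ e i) := fun i => ⟨pow_ne_zero _ (hp i).ne_zero⟩
  have hB : Finite B := Finite.of_equiv _ (DirectSum.addEquivProd (fun i => ZMod (p i ^ e i))).symm.toEquiv
  have hfr : Module.finrank ℤ A = n := by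
    rw [E.toIntLinearEquiv.finrank_eq]
    have hB0 : Module.finrank ℤ B = 0 := by
      rw [Module.finrank_eq_zero_iff_isTorsion]
      intro b
      refine ⟨⟨Nat.card B, ?_⟩, ?_⟩
      · exact mem_nonZeroDivisors_of_ne_zero (by exact_mod_cast Nat.card_pos.ne')
      · show ((Nat.card B : ℕ) : ℤ) • b = 0
        rw [natCast_zsmul]; exact card_nsmul_eq_zero'
    have : Module.Finite ℤ B := Module.Finite.of_finite
    have h := finrank_rk (LinearMap.fst ℤ (Fin n →₀ ℤ) B)
    rw [LinearMap.ker_fst, LinearMap.finrank_range_of_inj LinearMap.inr_injective, hB0,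
      LinearMap.range_eq_top.2 LinearMap.fst_surjective, finrank_top] at h
    refine Eq.trans ?_ (h.symm.trans ?_)
    · rfl
    · simp
  obtain ⟨h1, h2⟩ := dbl_equiv E
  rw [h1, h2, hfr]
  have hr : (dbl ((Fin n →₀ ℤ) × B)).range = (dbl (Fin n →₀ ℤ)).range.prod (dbl B).range := by
    ext ⟨x, y⟩
    simp only [AddMonoidHom.mem_range, AddSubgroup.mem_prod, Prod.exists, nsmulAddMonoidHom_apply, Prod.smul_mk, Prod.mk.injEq]
    tauto
  have hk : Nat.card (dbl ((Fin n →₀ ℤ) × B)).ker = Nat.card (dbl B).ker := by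
    apply Nat.card_congr
    refine ⟨fun x => ⟨x.1.2, ?_⟩, fun y => ⟨(0, y.1), ?_⟩, ?_, ?_⟩
    · exact congrArg Prod.snd x.2
    · have := y.2
      simp only [AddMonoidHom.mem_ker, nsmulAddMonoidHom_apply] at this ⊢
      ext1 <;> simp [this]
    · rintro ⟨⟨x, y⟩, hx⟩
      ext1; ext1
      · have := congrArg Prod.fst hx
        simp at this
        simp [this]
      · rfl
    · intro y; rfl
  change (dbl ((Fin n →₀ ℤ) × B)).range.index = 2 ^ n * Nat.card (dbl ((Fin n →₀ ℤ) × B)).ker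
  rw [hr, AddSubgroup.index_prod, hk, dbl_free, dbl_finite]

/-- squares of a subgroup -/
def sqs {G : Type*} [CommGroup G] (H : Subgroup G) : Subgroup G := H.map (powMonoidHom 2)

lemma sqs_relIndex {G : Type*} [CommGroup G] (H : Subgroup G) [Module.Finite ℤ (Additive H)] :
    (sqs H).relIndex H = 2 ^ Module.finrank ℤ (Additive H) * Nat.card {x : H // x ^ 2 = 1} := by
  have h := dbl_index (Additive H)
  have e1 : (dbl (Additive H)).range.index = (sqs H).relIndex H := by
    rw [Subgroup.relIndex, ← Subgroup.index_toAddSubgroup]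
    congr 1
    ext x
    constructor
    · rintro ⟨y, rfl⟩
      have : (y.toMul ^ 2 : H) ∈ (sqs H).subgroupOf H := by
        rw [Subgroup.mem_subgroupOf]
        exact ⟨y.toMul, y.toMul.2, rfl⟩
      exact this
    · intro hx
      have hx : x.toMul ∈ (sqs H).subgroupOf H := hx
      rw [Subgroup.mem_subgroupOf] at hx
      obtain ⟨y, hy, h⟩ := hx
      exact ⟨Additive.ofMul ⟨y, hy⟩, by apply Additive.toMul.injective; ext; exact h⟩
  rw [← e1, h]; rfl

variable {G : Type*} [CommGroup G] (σ : G →* G)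

/-- norm map -/
def nm : G →* G := MonoidHom.id G * σ
/-- difference map -/
def df : G →* G := MonoidHom.id G / σ

lemma herbrand (hσ : ∀ x, σ (σ x) = x) (M : Subgroup G) (hM : ∀ x ∈ M, σ x ∈ M):
    (M.map (nm σ)).relIndex (M ⊓ (df σ).ker) * (sqs (M ⊓ (nm σ).ker)).relIndex (M ⊓ (nm σ).ker)
    = (sqs (M ⊓ (df σ).ker)).relIndex (M ⊓ (df σ).ker) *
      (M.map (df σ)).relIndex (M ⊓ (nm σ).ker) := by
  set P := M ⊓ (df σ).ker
  set Q := M ⊓ (nm σ).ker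
  have memP : ∀ x, x ∈ P ↔ x ∈ M ∧ σ x = x := fun x => by
    have : (x / σ x = 1) ↔ σ x = x := by rw [div_eq_one, eq_comm]
    simpa [P, df, Subgroup.mem_inf, MonoidHom.mem_ker] using fun _ => this
  have memQ : ∀ x, x ∈ Q ↔ x ∈ M ∧ x * σ x = 1 := fun x => by
    simp [Q, nm, Subgroup.mem_inf, MonoidHom.mem_ker]
  have hPQ : P ⊔ Q ≤ M := sup_le inf_le_left inf_le_left
  have n1 : P.map (nm σ) = sqs P := by
    ext y; constructor
    · rintro ⟨x, hx, rfl⟩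
      exact ⟨x, hx, by simp [nm, ((memP x).1 hx).2, sq]⟩
    · rintro ⟨x, hx, rfl⟩
      exact ⟨x, hx, by simp [nm, ((memP x).1 hx).2, sq]⟩
  have n2 : Q.map (nm σ) = ⊥ := by
    rw [eq_bot_iff]; rintro y ⟨x, hx, rfl⟩; exact hx.2
  have d1 : P.map (df σ) = ⊥ := by
    rw [eq_bot_iff]; rintro y ⟨x, hx, rfl⟩; exact hx.2
  have hq : ∀ x ∈ Q, σ x = x⁻¹ := fun x hx => (inv_eq_of_mul_eq_one_right ((memQ x).1 hx).2).symm
  have d2 : Q.map (df σ) = sqs Q := by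
    ext y; constructor
    · rintro ⟨x, hx, rfl⟩
      exact ⟨x, hx, by simp [df, hq x hx, sq]⟩
    · rintro ⟨x, hx, rfl⟩
      exact ⟨x, hx, by simp [df, hq x hx, sq]⟩
  have c1 : (sqs P).relIndex (M.map (nm σ)) = (P ⊔ Q).relIndex M := by
    have : sqs P = (P ⊔ Q).map (nm σ) := by rw [Subgroup.map_sup, n2, sup_bot_eq, n1]
    rw [this, ← Subgroup.relIndex_comap, Subgroup.comap_map_eq, ← Subgroup.inf_relIndex_right,
      sup_inf_assoc_of_le _ hPQ, inf_comm, sup_assoc, sup_idem]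
  have c2 : (sqs Q).relIndex (M.map (df σ)) = (P ⊔ Q).relIndex M := by
    have : sqs Q = (P ⊔ Q).map (df σ) := by rw [Subgroup.map_sup, d1, bot_sup_eq, d2]
    rw [this, ← Subgroup.relIndex_comap, Subgroup.comap_map_eq, ← Subgroup.inf_relIndex_right,
      sup_inf_assoc_of_le _ hPQ, inf_comm, sup_comm, ← sup_assoc, sup_idem]
  have l1 : sqs P ≤ M.map (nm σ) := by rw [← n1]; exact Subgroup.map_mono inf_le_left
  have l2 : M.map (nm σ) ≤ P := by
    rintro _ ⟨x, hx, rfl⟩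
    rw [memP]
    exact ⟨M.mul_mem hx (hM x hx), by simp [nm, hσ, mul_comm]⟩
  have l3 : sqs Q ≤ M.map (df σ) := by rw [← d2]; exact Subgroup.map_mono inf_le_left
  have l4 : M.map (df σ) ≤ Q := by
    rintro _ ⟨x, hx, rfl⟩
    rw [memQ]
    exact ⟨M.div_mem hx (hM x hx), by simp [df, hσ]⟩
  have e1 := Subgroup.relIndex_mul_relIndex _ _ _ l1 l2
  have e2 := Subgroup.relIndex_mul_relIndex _ _ _ l3 l4
  rw [← e1, ← e2, c1, c2]; ring
end grp
end Sch

namespace Sch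
section su
variable {K : Type*} [Field K] [NumberField K]

/-- S-units -/
def SU (S : Set (Pl K)) : Subgroup Kˣ where
  carrier := {x | ∀ v ∉ S, ord v (x : K) = 0}
  one_mem' := fun v _ => by simp [ord_one]
  mul_mem' := fun {x y} hx hy v hv => by
    rw [Units.val_mul, ord_mul v x.ne_zero y.ne_zero, hx v hv, hy v hv]; rfl
  inv_mem' := fun {x} hx v hv => by
    rw [Units.val_inv_eq_inv_val, ord_inv, hx v hv]; rfl

lemma mem_SU {S : Set (Pl K)} {x : Kˣ} : x ∈ SU S ↔ ∀ v ∉ S, ord v (x : K) = 0 := Iff.rfl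

/-- valuations of S-units -/
noncomputable def suOrd (S : Finset (Pl K)) : Additive (SU (S : Set (Pl K))) →ₗ[ℤ] (S → ℤ) :=
  AddMonoidHom.toIntLinearMap
  { toFun := fun x v => ord v.1 (x.toMul.1 : K)
    map_zero' := by ext; simp [ord_one]
    map_add' := fun x y => by
      ext v; simp [ord_mul v.1 (x.toMul.1).ne_zero (y.toMul.1).ne_zero] }

lemma suOrd_apply (S : Finset (Pl K)) (x) (v) : suOrd S x v = ord v.1 (x.toMul.1 : K) := rfl

/-- units as S-units, multiplicatively -/
noncomputable def uSU0 (S : Finset (Pl K)) : (𝓞 K)ˣ →* SU (S : Set (Pl K)) :=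
  (Units.map (algebraMap (𝓞 K) K : 𝓞 K →* K)).codRestrict (SU (S : Set (Pl K)))
    (fun x v _ => ord_unit v x)

/-- units as S-units -/
noncomputable def uSU (S : Finset (Pl K)) : Additive (𝓞 K)ˣ →ₗ[ℤ] Additive (SU (S : Set (Pl K))) :=
  AddMonoidHom.toIntLinearMap (MonoidHom.toAdditive (uSU0 S))

lemma uSU_inj (S : Finset (Pl K)) : Function.Injective (uSU S) := by
  intro x y h
  have h1 := congrArg (fun z => ((Additive.toMul z).1 : K)) h
  apply Additive.toMul.injective
  ext
  exact h1

lemma range_uSU (S : Finset (Pl K)) : LinearMap.range (uSU S) = LinearMap.ker (suOrd S) := by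
  ext x
  rw [LinearMap.mem_range, LinearMap.mem_ker]
  constructor
  · rintro ⟨y, rfl⟩
    ext v
    exact ord_unit v.1 _
  · intro h
    obtain ⟨u, hu⟩ := exists_unit_of_ord (x := (x.toMul.1 : K)) (x.toMul.1).ne_zero fun v => by
      by_cases hv : v ∈ S
      · exact congrFun h ⟨v, hv⟩
      · exact x.toMul.2 v hv
    refine ⟨Additive.ofMul u, ?_⟩
    apply Additive.toMul.injective
    ext
    exact hu

instance suFinite (S : Finset (Pl K)) : Module.Finite ℤ (Additive (SU (S : Set (Pl K)))) := by
  have : Module.Finite ℤ (LinearMap.ker (suOrd S)) := by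
    rw [← range_uSU]; infer_instance
  have : Module.Finite ℤ (Additive (SU (S : Set (Pl K))) ⧸ LinearMap.ker (suOrd S)) :=
    Module.Finite.equiv (suOrd S).quotKerEquivRange.symm
  exact Module.Finite.of_submodule_quotient (LinearMap.ker (suOrd S))

lemma finrank_SU (S : Finset (Pl K)) :
    Module.finrank ℤ (Additive (SU (S : Set (Pl K)))) = Units.rank K + S.card := by
  have h := finrank_rk (suOrd S)
  rw [← range_uSU, LinearMap.finrank_range_of_inj (uSU_inj S), Units.finrank_eq] at h
  rw [← h, add_comm]
  congr 1
  apply le_antisymm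
  · refine (Submodule.finrank_le _).trans ?_
    simp
  · -- h • ℤ^S in the range
    let m : (S → ℤ) →ₗ[ℤ] (S → ℤ) := (classNumber K : ℤ) • LinearMap.id
    have hm : Function.Injective m := by
      intro x y hxy
      ext i
      have := congrFun hxy i
      simpa [m, classNumber_ne_zero] using this
    have hr : LinearMap.range m ≤ LinearMap.range (suOrd S) := by
      rintro _ ⟨n, rfl⟩
      obtain ⟨a, ha0, ha⟩ := exists_ord (K := K) (fun v => if hv : v ∈ S then n ⟨v, hv⟩ else 0)
        (S.finite_toSet.subset fun v hv => by
          by_contra hc; exact hv (dif_neg hc))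
      refine ⟨Additive.ofMul ⟨Units.mk0 a ha0, fun v hv => ?_⟩, ?_⟩
      · have := ha v
        rw [dif_neg (by simpa using hv)] at this
        simpa using this
      · ext v
        rw [suOrd_apply]
        have := ha v.1
        rw [dif_pos v.2] at this
        exact this
    have := Submodule.finrank_mono hr
    rw [LinearMap.finrank_range_of_inj hm] at this
    simpa using this

lemma rank_add_one : Units.rank K + 1 = Fintype.card (InfinitePlace K) := by
  have : 0 < Fintype.card (InfinitePlace K) := Fintype.card_pos
  unfold Units.rank; omega

end su
end Sch

namespace Sch
set_option linter.unusedSectionVars false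
section qe
variable {F L : Type*} [Field F] [NumberField F] [Field L] [NumberField L] [Algebra F L]

/-- quadratic extension `L = F(β)`, `β² = α`. -/
structure QE (F L : Type*) [Field F] [NumberField F] [Field L] [NumberField L] [Algebra F L]
    (α : 𝓞 F) (β : 𝓞 L) : Prop where
  fr : Module.finrank F L = 2
  hβ : β ^ 2 = algebraMap (𝓞 F) (𝓞 L) α
  ns : ∀ x : F, x ^ 2 ≠ (α : F)

variable {α : 𝓞 F} {β : 𝓞 L}

lemma coe_am (x : 𝓞 F) : ((algebraMap (𝓞 F) (𝓞 L) x : 𝓞 L) : L) = algebraMap F L (x : F) := rfl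

lemma am_inj : Function.Injective (algebraMap (𝓞 F) (𝓞 L)) :=
  FaithfulSMul.algebraMap_injective _ _

lemma QE.sq (Q : QE F L α β) : (β : L) ^ 2 = algebraMap F L (α : F) := by
  have := congrArg (fun z : 𝓞 L => (z : L)) Q.hβ
  exact this

lemma QE.β0 (Q : QE F L α β) : (β : L) ≠ 0 := by
  intro h
  have := Q.sq
  rw [h] at this
  apply Q.ns 0
  have h2 : algebraMap F L (α : F) = 0 := by rw [← this]; ring
  rw [map_eq_zero] at h2
  rw [h2]; ring

lemma QE.exists_sigma (Q : QE F L α β) : ∃ σ : L ≃ₐ[F] L, σ (β : L) = -(β : L) ∧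
    (∀ z, σ (σ z) = z) ∧ ∀ z, σ z = z → ∃ x, algebraMap F L x = z := by
  have : Algebra.IsQuadraticExtension F L := ⟨Q.fr⟩
  have : IsGalois F L := inferInstance
  have hc : Nat.card (L ≃ₐ[F] L) = 2 := by rw [IsGalois.card_aut_eq_finrank, Q.fr]
  obtain ⟨σ, hσ⟩ : ∃ σ : L ≃ₐ[F] L, σ ≠ 1 := by
    have : Nontrivial (L ≃ₐ[F] L) := (Finite.one_lt_card_iff_nontrivial).1 (by omega)
    exact exists_ne 1
  have hall : ∀ τ : L ≃ₐ[F] L, τ = 1 ∨ τ = σ := by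
    intro τ
    by_contra! h
    have h3 : ({1, σ, τ} : Finset (L ≃ₐ[F] L)).card ≤ Nat.card (L ≃ₐ[F] L) := by
      rw [Nat.card_eq_fintype_card]; exact Finset.card_le_univ _
    rw [hc, Finset.card_eq_three.2 ⟨1, σ, τ, hσ.symm, h.1.symm, h.2.symm, rfl⟩] at h3
    omega
  have hfix : ∀ z, σ z = z → ∃ x, algebraMap F L x = z := by
    intro z hz
    have := (IsGalois.mem_bot_iff_fixed (F := F) z).2 (fun τ => by
      rcases hall τ with rfl | rfl
      · rfl
      · exact hz)
    exact IntermediateField.mem_bot.1 this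
  refine ⟨σ, ?_, ?_, hfix⟩
  · have h1 : σ (β : L) ^ 2 = (β : L) ^ 2 := by
      rw [← map_pow, Q.sq, AlgEquiv.commutes]
    rcases sq_eq_sq_iff_eq_or_eq_neg.1 h1 with h | h
    · exfalso
      obtain ⟨x, hx⟩ := hfix _ h
      apply Q.ns x
      apply (algebraMap F L).injective
      rw [map_pow, hx, Q.sq]
    · exact h
  · intro z
    have : σ ^ 2 = 1 := by rw [← hc]; exact pow_card_eq_one'
    have := congrArg (fun τ : L ≃ₐ[F] L => τ z) this
    simpa [pow_two] using this

/-- the conjugation -/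
noncomputable def QE.σ (Q : QE F L α β) : L ≃ₐ[F] L := Q.exists_sigma.choose
lemma QE.σβ (Q : QE F L α β) : Q.σ (β : L) = -(β : L) := Q.exists_sigma.choose_spec.1
lemma QE.σσ (Q : QE F L α β) (z : L) : Q.σ (Q.σ z) = z := Q.exists_sigma.choose_spec.2.1 z
lemma QE.fixed (Q : QE F L α β) {z : L} (h : Q.σ z = z) : ∃ x, algebraMap F L x = z :=
  Q.exists_sigma.choose_spec.2.2 z h

lemma QE.coords (Q : QE F L α β) (z : L) :
    ∃ x y : F, z = algebraMap F L x + algebraMap F L y * β := by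
  obtain ⟨x, hx⟩ := Q.fixed (z := (z + Q.σ z) / 2) (by
    rw [map_div₀, map_add, Q.σσ, map_ofNat]; ring)
  obtain ⟨y, hy⟩ := Q.fixed (z := (z - Q.σ z) / (2 * β)) (by
    rw [map_div₀, map_sub, Q.σσ, map_mul, map_ofNat, Q.σβ]
    have := Q.β0
    field_simp; ring)
  refine ⟨x, y, ?_⟩
  rw [hx, hy]
  have := Q.β0
  field_simp; ring

lemma QE.norm_eq (Q : QE F L α β) (x y : F) :
    (algebraMap F L x + algebraMap F L y * β) * Q.σ (algebraMap F L x + algebraMap F L y * β) =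
      algebraMap F L (x ^ 2 - α * y ^ 2) := by
  simp only [map_add, map_mul, Q.σβ, AlgEquiv.commutes, map_sub, map_pow, ← Q.sq]
  ring

lemma QE.hilbert90 (Q : QE F L α β) {u : L} (h : u * Q.σ u = 1) : ∃ y : L, y ≠ 0 ∧ u = y / Q.σ y := by
  have hu : u ≠ 0 := left_ne_zero_of_mul_eq_one h
  by_cases h1 : u = -1
  · refine ⟨β, Q.β0, ?_⟩
    rw [Q.σβ, h1]
    have := Q.β0
    field_simp
  · have h2 : 1 + u ≠ 0 := fun h => h1 (by linear_combination h)
    refine ⟨1 + u, h2, ?_⟩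
    have : Q.σ (1 + u) ≠ 0 := (map_ne_zero _).2 h2
    rw [eq_div_iff this, map_add, map_one, mul_add, h]; ring

/-- conjugation on integers -/
noncomputable def QE.τ (Q : QE F L α β) : 𝓞 L ≃+* 𝓞 L := RingOfIntegers.mapRingEquiv (Q.σ : L ≃+* L)

lemma QE.coe_τ (Q : QE F L α β) (z : 𝓞 L) : ((Q.τ z : 𝓞 L) : L) = Q.σ (z : L) := rfl

lemma QE.ττ (Q : QE F L α β) (z : 𝓞 L) : Q.τ (Q.τ z) = z := by
  apply RingOfIntegers.ext; rw [Q.coe_τ, Q.coe_τ, Q.σσ]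

lemma QE.τ_am (Q : QE F L α β) (x : 𝓞 F) : Q.τ (algebraMap (𝓞 F) (𝓞 L) x) = algebraMap (𝓞 F) (𝓞 L) x := by
  apply RingOfIntegers.ext; rw [Q.coe_τ, coe_am, AlgEquiv.commutes]

lemma QE.τβ (Q : QE F L α β) : Q.τ β = -β := by
  apply RingOfIntegers.ext; rw [Q.coe_τ, Q.σβ]; simp

lemma QE.fixed_int (Q : QE F L α β) {z : 𝓞 L} (h : Q.τ z = z) : ∃ x : 𝓞 F, algebraMap (𝓞 F) (𝓞 L) x = z := by
  have h1 : Q.σ (z : L) = z := by rw [← Q.coe_τ, h]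
  obtain ⟨x, hx⟩ := Q.fixed h1
  have hi : IsIntegral ℤ x := by
    have : IsIntegral ℤ (z : L) := RingOfIntegers.isIntegral_coe z
    rw [← hx] at this
    exact (isIntegral_algebraMap_iff (algebraMap F L).injective).1 this
  exact ⟨⟨x, hi⟩, RingOfIntegers.ext hx⟩

lemma QE.τ_mul (Q : QE F L α β) (z : 𝓞 L) : ∃ x : 𝓞 F, algebraMap (𝓞 F) (𝓞 L) x = z * Q.τ z :=
  Q.fixed_int (by rw [map_mul, Q.ττ, mul_comm])

lemma QE.τ_add (Q : QE F L α β) (z : 𝓞 L) : ∃ x : 𝓞 F, algebraMap (𝓞 F) (𝓞 L) x = z + Q.τ z :=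
  Q.fixed_int (by rw [map_add, Q.ττ, add_comm])

lemma QE.card_places (Q : QE F L α β) (hpos : ∀ φ : F →+* ℝ, 0 < φ (α : F)) :
    Fintype.card (InfinitePlace L) = 2 * Fintype.card (InfinitePlace F) := by
  have : Algebra.IsQuadraticExtension F L := ⟨Q.fr⟩
  have : IsUnramifiedAtInfinitePlaces F L := by
    refine ⟨fun w => ?_⟩
    rw [InfinitePlace.isUnramified_iff]
    by_contra! hcon
    obtain ⟨h1, h2⟩ := hcon
    rw [InfinitePlace.not_isComplex_iff_isReal] at h2
    apply h1
    have hβ2 : w.embedding (β : L) ^ 2 = w.embedding (algebraMap F L α) := by rw [← map_pow, Q.sq]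
    have hF : ∀ x : F, w.embedding (algebraMap F L x) = ((InfinitePlace.embedding_of_isReal h2 x : ℝ) : ℂ) := by
      intro x
      rw [InfinitePlace.embedding_of_isReal_apply, InfinitePlace.comap_embedding_of_isReal _ h2]
      rfl
    set φ := InfinitePlace.embedding_of_isReal h2
    have hs : (w.embedding (β : L)) ^ 2 = ((Real.sqrt (φ α) : ℝ) : ℂ) ^ 2 := by
      rw [hβ2, hF, ← Complex.ofReal_pow, Real.sq_sqrt (hpos φ).le]
    have hb : ∃ b : ℝ, w.embedding (β : L) = (b : ℂ) := by
      rcases sq_eq_sq_iff_eq_or_eq_neg.1 hs with h | h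
      · exact ⟨_, h⟩
      · exact ⟨-Real.sqrt (φ α), by rw [h]; simp⟩
    obtain ⟨b, hb⟩ := hb
    rw [InfinitePlace.isReal_iff, ComplexEmbedding.isReal_iff]
    ext z
    obtain ⟨x, y, rfl⟩ := Q.coords z
    rw [ComplexEmbedding.conjugate_coe_eq, map_add, map_mul, hF, hF, hb, map_add, map_mul,
      Complex.conj_ofReal, Complex.conj_ofReal, Complex.conj_ofReal]
  rw [IsUnramifiedAtInfinitePlaces.card_infinitePlace F L, Q.fr, mul_comm]

end qe

lemma exists_QE {F : Type u} [Field F] [NumberField F] (α : 𝓞 F) (ns : ∀ x : F, x ^ 2 ≠ (α : F)) :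
    ∃ (L : Type u) (_ : Field L) (_ : NumberField L) (_ : Algebra F L) (β : 𝓞 L), QE F L α β := by
  let f : Polynomial F := Polynomial.X ^ 2 - Polynomial.C (α : F)
  have hirr : Irreducible f := X_pow_sub_C_irreducible_of_prime Nat.prime_two (fun b hb => ns b hb)
  have : Fact (Irreducible f) := ⟨hirr⟩
  have hf : f ≠ 0 := hirr.ne_zero
  have : Module.Finite F (AdjoinRoot f) := (AdjoinRoot.powerBasis hf).finite
  have : NumberField (AdjoinRoot f) := NumberField.of_module_finite F _
  have hr : (AdjoinRoot.root f) ^ 2 = algebraMap F (AdjoinRoot f) (α : F) := by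
    have := AdjoinRoot.eval₂_root f
    simp only [f, Polynomial.eval₂_sub, Polynomial.eval₂_pow, Polynomial.eval₂_X, Polynomial.eval₂_C] at this
    rw [sub_eq_zero] at this
    exact this
  have hi : IsIntegral ℤ (AdjoinRoot.root f) := by
    apply IsIntegral.of_pow (n := 2) (by norm_num)
    rw [hr]
    exact (RingOfIntegers.isIntegral_coe α).map (IsScalarTower.toAlgHom ℤ F (AdjoinRoot f))
  refine ⟨AdjoinRoot f, inferInstance, inferInstance, inferInstance, ⟨AdjoinRoot.root f, hi⟩, ?_, ?_, ns⟩
  · rw [(AdjoinRoot.powerBasis hf).finrank]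
    simp [f, AdjoinRoot.powerBasis_dim, Polynomial.natDegree_X_pow_sub_C]
  · apply RingOfIntegers.ext
    exact hr
end Sch

namespace Sch
set_option linter.unusedSectionVars false
section qe2
variable {F L : Type*} [Field F] [NumberField F] [Field L] [NumberField L] [Algebra F L]
variable {α : 𝓞 F} {β : 𝓞 L}

lemma exists_above (q : Pl F) : ∃ w : Pl L, below F w = q := by
  have : Algebra.IsIntegral (𝓞 F) (𝓞 L) := inferInstance
  obtain ⟨P, hP1, hP2⟩ := Ideal.exists_ideal_over_maximal_of_isIntegral (S := 𝓞 L) q.asIdeal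
    (by rw [(RingHom.injective_iff_ker_eq_bot _).1 am_inj]; exact bot_le)
  have hne : P ≠ ⊥ := by
    rintro rfl
    apply q.ne_bot
    rw [← hP2, ← RingHom.ker_eq_comap_bot, (RingHom.injective_iff_ker_eq_bot _).1 am_inj]
  exact ⟨⟨P, hP1.isPrime, hne⟩, IsDedekindDomain.HeightOneSpectrum.ext hP2⟩

lemma ram_le (Q : QE F L α β) (w : Pl L) : ram F w ≤ 2 := by
  have : w.asIdeal.LiesOver (below F w).asIdeal := ⟨rfl⟩
  have : NoZeroSMulDivisors (𝓞 F) (𝓞 L) := ⟨fun {c x} h => by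
    rw [Algebra.smul_def, mul_eq_zero] at h
    exact h.imp_left fun h => am_inj (h.trans (map_zero _).symm)⟩
  have := Ideal.ramificationIdx_le_finrank (R := 𝓞 F) (S := 𝓞 L) F L (p := (below F w).asIdeal) w.asIdeal
  rwa [Q.fr] at this

/-- conjugate prime -/
noncomputable def QE.conj (Q : QE F L α β) (w : Pl L) : Pl L :=
  ⟨w.asIdeal.comap (Q.τ : 𝓞 L →+* 𝓞 L), inferInstance, by
    obtain ⟨x, hx, h0⟩ := Submodule.exists_mem_ne_zero_of_ne_bot w.ne_bot
    rw [Submodule.ne_bot_iff]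
    refine ⟨Q.τ x, ?_, by simpa using h0⟩
    rw [Ideal.mem_comap]
    simpa [Q.ττ] using hx⟩

lemma QE.mem_conj (Q : QE F L α β) (w : Pl L) (x : 𝓞 L) : x ∈ (Q.conj w).asIdeal ↔ Q.τ x ∈ w.asIdeal :=
  Iff.rfl

lemma QE.below_conj (Q : QE F L α β) (w : Pl L) : below F (Q.conj w) = below F w := by
  apply IsDedekindDomain.HeightOneSpectrum.ext
  ext x
  rw [mem_below, mem_below, Q.mem_conj, Q.τ_am]

lemma QE.ord_conj (Q : QE F L α β) (w : Pl L) {x : L} (hx : x ≠ 0) (h : ord (Q.conj w) x = 0) :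
    ord w (Q.σ x) = 0 := by
  obtain ⟨a, b, hb, hab⟩ := exists_frac (Q.conj w) hx h.ge
  have hb0 : b ≠ 0 := by rintro rfl; exact hb (Ideal.zero_mem _)
  have hb0' : (b : L) ≠ 0 := by simpa using hb0
  have ha0' : (a : L) ≠ 0 := by rw [← hab]; exact mul_ne_zero hx hb0'
  have ha0 : a ≠ 0 := by rintro rfl; simp at ha0'
  have h1 : ord (Q.conj w) (a : L) = 0 := by
    rw [← hab, ord_mul _ hx hb0', h, (ord_int_eq_zero_iff _ hb0).2 hb]; rfl
  rw [ord_int_eq_zero_iff _ ha0, Q.mem_conj, ← ord_int_eq_zero_iff _ (by simpa using ha0)] at h1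
  rw [Q.mem_conj, ← ord_int_eq_zero_iff _ (by simpa using hb0)] at hb
  have h3 := congrArg Q.σ hab
  rw [map_mul] at h3
  have h4 := ord_mul w (x := Q.σ x) (y := Q.σ b) ((map_ne_zero _).2 hx) ((map_ne_zero _).2 hb0')
  rw [h3] at h4
  rw [Q.coe_τ] at h1 hb
  omega

lemma QE.theta (Q : QE F L α β) {ξ c : 𝓞 F} (h : α = ξ ^ 2 - 4 * c) :
    ∃ θ : 𝓞 L, 2 * θ = algebraMap (𝓞 F) (𝓞 L) ξ + β ∧ θ + Q.τ θ = algebraMap (𝓞 F) (𝓞 L) ξ ∧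
      θ - Q.τ θ = β ∧ θ * Q.τ θ = algebraMap (𝓞 F) (𝓞 L) c ∧
      θ ^ 2 - algebraMap (𝓞 F) (𝓞 L) ξ * θ + algebraMap (𝓞 F) (𝓞 L) c = 0 := by
  set X := algebraMap (𝓞 F) (𝓞 L) ξ with hX
  set C := algebraMap (𝓞 F) (𝓞 L) c with hC
  have hβ : β ^ 2 = X ^ 2 - 4 * C := by rw [Q.hβ, h, map_sub, map_mul, map_pow, map_ofNat]
  have hβ' : (β : L) ^ 2 = (X : L) ^ 2 - 4 * (C : L) := by
    have := congrArg (algebraMap (𝓞 L) L) hβ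
    rw [map_sub, map_mul, map_pow, map_pow, map_ofNat] at this
    exact this
  let t : L := ((X : L) + β) / 2
  have ht : t ^ 2 - X * t + C = 0 := by
    simp only [t]; linear_combination (1/4 : L) * hβ'
  have hti : IsIntegral (𝓞 L) t := by
    refine ⟨Polynomial.X ^ 2 - Polynomial.C X * Polynomial.X + Polynomial.C C, ?_, ?_⟩
    · monicity!
    · simp only [Polynomial.eval₂_add, Polynomial.eval₂_sub, Polynomial.eval₂_mul, Polynomial.eval₂_pow,
        Polynomial.eval₂_X, Polynomial.eval₂_C]
      exact ht
  obtain ⟨θ, hθ⟩ := IsIntegrallyClosed.isIntegral_iff.1 hti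
  have h2 : 2 * θ = X + β := by
    apply RingOfIntegers.ext
    change algebraMap (𝓞 L) L (2 * θ) = algebraMap (𝓞 L) L (X + β)
    rw [map_mul, map_add, map_ofNat, hθ]
    simp only [t]; ring
  have h20 : (2 : 𝓞 L) ≠ 0 := two_ne_zero
  have h2' : 2 * Q.τ θ = X - β := by
    have := congrArg Q.τ h2
    rw [map_mul, map_add, Q.τ_am, Q.τβ, map_ofNat] at this
    rw [this]; ring
  refine ⟨θ, h2, ?_, ?_, ?_, ?_⟩
  · apply mul_left_cancel₀ h20; linear_combination h2 + h2'
  · apply mul_left_cancel₀ h20; linear_combination h2 - h2'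
  · apply mul_left_cancel₀ h20; apply mul_left_cancel₀ h20
    linear_combination (2 * Q.τ θ) * h2 + (X + β) * h2' - hβ
  · apply mul_left_cancel₀ h20; apply mul_left_cancel₀ h20
    linear_combination (2 * θ + β - X) * h2 + hβ

lemma QE.mem_β (Q : QE F L α β) (w : Pl L) : β ∈ w.asIdeal ↔ α ∈ (below F w).asIdeal := by
  rw [mem_below, ← Q.hβ]
  exact (w.isPrime.pow_mem_iff_mem 2 (by norm_num)).symm

lemma QE.ram_one (Q : QE F L α β) {ξ c : 𝓞 F} (h : α = ξ ^ 2 - 4 * c) (w : Pl L)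
    (hw : α ∉ (below F w).asIdeal) : ram F w = 1 := by
  obtain ⟨θ, h2, -, -, -, h0⟩ := Q.theta h
  have : w.asIdeal.IsPrime := w.isPrime
  have hnd : ¬ w.asIdeal ∣ differentIdeal (𝓞 F) (𝓞 L) := by
    intro hd
    rw [Ideal.dvd_iff_le] at hd
    have hadj : Algebra.adjoin F {algebraMap (𝓞 L) L θ} = ⊤ := by
      rw [eq_top_iff]
      rintro z -
      obtain ⟨x, y, rfl⟩ := Q.coords z
      have hθ : algebraMap (𝓞 L) L θ ∈ Algebra.adjoin F {algebraMap (𝓞 L) L θ} :=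
        Algebra.self_mem_adjoin_singleton _ _
      have hb : (β : L) = 2 * algebraMap (𝓞 L) L θ - algebraMap F L (ξ : F) := by
        have := congrArg (fun z : 𝓞 L => (z : L)) h2
        simp only [map_mul, map_add, map_ofNat, coe_am] at this
        rw [this]; ring
      rw [hb]
      exact Subalgebra.add_mem _ (Subalgebra.algebraMap_mem _ _) (Subalgebra.mul_mem _ (Subalgebra.algebraMap_mem _ _)
        (Subalgebra.sub_mem _ (Subalgebra.mul_mem _ (by exact_mod_cast Subalgebra.natCast_mem _ 2) hθ) (Subalgebra.algebraMap_mem _ _)))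
    have h1 := aeval_derivative_mem_differentIdeal (𝓞 F) F L θ hadj
    let f : Polynomial (𝓞 F) := Polynomial.X ^ 2 - Polynomial.C ξ * Polynomial.X + Polynomial.C c
    have hf : Polynomial.aeval θ f = 0 := by
      simp only [f, map_add, map_sub, map_mul, map_pow, Polynomial.aeval_X, Polynomial.aeval_C]
      exact h0
    obtain ⟨g, hg⟩ := minpoly.isIntegrallyClosed_dvd (R := 𝓞 F) (s := θ) (Algebra.IsIntegral.isIntegral θ) hf
    have h3 : Polynomial.aeval θ (Polynomial.derivative f) = β := by
      simp only [f, Polynomial.derivative_add, Polynomial.derivative_sub, Polynomial.derivative_mul, Polynomial.derivative_X_pow,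
        Polynomial.derivative_C, Polynomial.derivative_X, map_add, map_sub, map_mul, map_pow, Polynomial.aeval_X, Polynomial.aeval_C]
      simp only [Nat.cast_ofNat, map_ofNat]
      simp
      linear_combination h2
    rw [hg, Polynomial.derivative_mul, map_add, map_mul, map_mul, minpoly.aeval, zero_mul, add_zero] at h3
    exact hw ((Q.mem_β w).1 (h3 ▸ hd (Ideal.mul_mem_right _ _ h1)))
  rw [not_dvd_differentIdeal_iff] at hnd
  have : w.asIdeal.LiesOver (below F w).asIdeal := ⟨rfl⟩
  rw [ram, Ideal.ramificationIdx'_eq_ramificationIdx _ _ (below F w).ne_bot]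
  exact Ideal.ramificationIdx_eq_one_iff.2 hnd

lemma QE.split (Q : QE F L α β) {ξ c : 𝓞 F} (h : α = ξ ^ 2 - 4 * c) (w : Pl L)
    (hα : α ∉ (below F w).asIdeal) (hc : c ∈ (below F w).asIdeal) : Q.conj w ≠ w := by
  obtain ⟨θ, -, -, h1, h2, -⟩ := Q.theta h
  intro he
  have hm : θ * Q.τ θ ∈ w.asIdeal := by rw [h2]; exact hc
  have hβ : β ∉ w.asIdeal := fun hh => hα ((Q.mem_β w).1 hh)
  have he' : ∀ x, Q.τ x ∈ w.asIdeal ↔ x ∈ w.asIdeal := fun x => by rw [← Q.mem_conj, he]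
  apply hβ
  rw [← h1]
  rcases w.isPrime.mem_or_mem hm with h | h
  · exact Ideal.sub_mem _ h ((he' _).2 h)
  · exact Ideal.sub_mem _ ((he' _).1 h) h
end qe2
end Sch

namespace Sch
set_option linter.unusedSectionVars false

lemma relIndex_le {G X : Type*} [CommGroup G] [Finite X] (H K : Subgroup G) (f : K → X)
    (hf : ∀ a b : K, f a = f b → (a : G) / b ∈ H) : H.relIndex K ≤ Nat.card X := by
  rw [Subgroup.relIndex, Subgroup.index]
  refine Nat.card_le_card_of_injective (fun q : K ⧸ H.subgroupOf K => f q.out) ?_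
  intro p q hpq
  have := hf _ _ hpq
  rw [← QuotientGroup.out_eq' p, ← QuotientGroup.out_eq' q, eq_comm, QuotientGroup.eq, Subgroup.mem_subgroupOf]
  simpa [div_eq_mul_inv, mul_comm] using this

lemma relIndex_ge {G X : Type*} [CommGroup G] (H K : Subgroup G) (f : K → X) (h0 : H.relIndex K ≠ 0)
    (hf : ∀ a b : K, (a : G) / b ∈ H → f a = f b) : Nat.card (Set.range f) ≤ H.relIndex K := by
  have : Finite (K ⧸ H.subgroupOf K) := Nat.finite_of_card_ne_zero h0
  rw [Subgroup.relIndex, Subgroup.index]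
  refine Nat.card_le_card_of_surjective (fun q : K ⧸ H.subgroupOf K => (⟨f q.out, _, rfl⟩ : Set.range f)) ?_
  rintro ⟨_, a, rfl⟩
  refine ⟨QuotientGroup.mk a, ?_⟩
  apply Subtype.ext
  apply hf
  have := QuotientGroup.out_eq' (QuotientGroup.mk a : K ⧸ H.subgroupOf K)
  rw [eq_comm, QuotientGroup.eq, Subgroup.mem_subgroupOf] at this
  simpa [div_eq_mul_inv, mul_comm] using this

section
variable {F L : Type*} [Field F] [NumberField F] [Field L] [NumberField L] [Algebra F L]
variable {α : 𝓞 F} {β : 𝓞 L}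

lemma above_finite (S : Finset (Pl F)) : {w : Pl L | below F w ∈ S}.Finite := by
  have : {w : Pl L | below F w ∈ S} ⊆ ⋃ q ∈ S, {w : Pl L | ord w (algebraMap F L (gen q : F)) ≠ 0} := by
    intro w hw
    simp only [Set.mem_iUnion]
    refine ⟨_, hw, ?_⟩
    change ord w (algebraMap F L (gen (below F w) : F)) ≠ 0
    rw [ord_ext, ord_gen _ _ (gen_spec (below F w)), if_pos rfl]
    have := ram_pos (F := F) w
    have := classNumber_ne_zero F
    positivity
  refine Set.Finite.subset (S.finite_toSet.biUnion fun q _ => ord_finite ?_) this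
  rw [map_ne_zero]
  simpa using gen_ne_zero q (gen_spec q)

/-- primes above S -/
noncomputable def SL (L : Type*) [Field L] [NumberField L] [Algebra F L] (S : Finset (Pl F)) : Finset (Pl L) :=
  (above_finite (L := L) S).toFinset

lemma mem_SL {S : Finset (Pl F)} {w : Pl L} : w ∈ SL L S ↔ below F w ∈ S := by simp [SL]

/-- conjugation on units -/
noncomputable def QE.s (Q : QE F L α β) : Lˣ →* Lˣ := Units.map (Q.σ : L →* L)
lemma QE.coe_s (Q : QE F L α β) (u : Lˣ) : ((Q.s u : Lˣ) : L) = Q.σ (u : L) := rfl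
lemma QE.ss (Q : QE F L α β) (u : Lˣ) : Q.s (Q.s u) = u := by ext; simp [Q.coe_s, Q.σσ]

lemma QE.s_mem (Q : QE F L α β) (S : Finset (Pl F)) (x : Lˣ) (hx : x ∈ SU (SL L S : Set (Pl L))) :
    Q.s x ∈ SU (SL L S : Set (Pl L)) := by
  intro w hw
  rw [Q.coe_s]
  apply Q.ord_conj w x.ne_zero
  apply hx
  simpa [mem_SL, Q.below_conj] using hw

lemma nm_apply {G : Type*} [CommGroup G] (s : G →* G) (x : G) : nm s x = x * s x := rfl
lemma df_apply {G : Type*} [CommGroup G] (s : G →* G) (x : G) : df s x = x / s x := rfl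

/-- data for the basic lemma -/
structure Dat (S T : Finset (Pl F)) (α : 𝓞 F) : Prop where
  ns : ∀ x : F, x ^ 2 ≠ (α : F)
  pos : ∀ φ : F →+* ℝ, 0 < φ (α : F)
  oddT : ∀ v ∈ T, Odd (ord v (α : F))
  unT : ∀ v ∉ T, α ∉ v.asIdeal
  four : ∃ ξ c : 𝓞 F, α = ξ ^ 2 - 4 * c
  spl : ∀ q ∈ S, ∃ ξ c : 𝓞 F, α = ξ ^ 2 - 4 * c ∧ c ∈ q.asIdeal
  disj : Disjoint S T

lemma QE.A0 (Q : QE F L α β) (hodd : Odd (classNumber F)) {S T : Finset (Pl F)} (D : Dat S T α)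
    (R : Pl F → Pl L) (hR : ∀ v, below F (R v) = v) (y : Lˣ)
    (hy : df Q.s y ∈ SU (SL L S : Set (Pl L))) (he : ∀ v ∈ T, Even (ord (R v) (y : L))) :
    df Q.s y ∈ (SU (SL L S : Set (Pl L))).map (df Q.s) := by
  obtain ⟨x0, hx0⟩ := Q.fixed (z := (y : L) * Q.σ y) (by rw [map_mul, Q.σσ, mul_comm])
  have hsy : Q.σ (y : L) ≠ 0 := (map_ne_zero _).2 y.ne_zero
  have hx00 : x0 ≠ 0 := by
    rintro rfl
    rw [map_zero] at hx0
    exact mul_ne_zero y.ne_zero hsy hx0.symm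
  have key : ∀ w : Pl L, below F w ∉ S → (ram F w : ℤ) * ord (below F w) x0 = 2 * ord w (y : L) := by
    intro w hw
    have h1 := hy w (by simpa [mem_SL] using hw)
    rw [df_apply, Units.val_div_eq_div_val, Q.coe_s, ord_div _ y.ne_zero hsy] at h1
    rw [← ord_ext, hx0, ord_mul _ y.ne_zero hsy]; omega
  have hev : ∀ v, v ∉ S → Even (ord v x0) := by
    intro v hv
    have h1 := key (R v) (by rwa [hR])
    rw [hR] at h1
    by_cases hT : v ∈ T
    · have h2 := ram_le Q (R v)
      have h3 := ram_pos (F := F) (R v)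
      obtain ⟨k, hk⟩ := he v hT
      interval_cases hr : ram F (R v)
      · exact ⟨2 * k, by push_cast at h1; omega⟩
      · exact ⟨k, by push_cast at h1; omega⟩
    · obtain ⟨ξ, c, h4⟩ := D.four
      rw [Q.ram_one h4 (R v) (by rw [hR]; exact D.unT v hT)] at h1
      exact ⟨ord (R v) (y : L), by push_cast at h1; omega⟩
  obtain ⟨a, ha0, ha⟩ := exists_ord (K := F) (fun v => if v ∈ S then 0 else ord v x0 / 2)
    ((ord_finite hx00).subset fun v hv => by
      intro h0
      apply hv
      simp only [h0]; simp)
  have ha0' : algebraMap F L a ≠ 0 := (map_ne_zero _).2 ha0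
  let z : Lˣ := y ^ classNumber F / Units.mk0 (algebraMap F L a) ha0'
  have hz : z ∈ SU (SL L S : Set (Pl L)) := by
    intro w hw
    have hw' : below F w ∉ S := by simpa [mem_SL] using hw
    have h1 := key w hw'
    obtain ⟨k, hk⟩ := hev _ hw'
    simp only [z, Units.val_div_eq_div_val, Units.val_pow_eq_pow_val, Units.val_mk0]
    rw [ord_div _ (pow_ne_zero _ y.ne_zero) ha0', ord_pow, ord_ext, ha, if_neg hw', hk]
    rw [hk] at h1
    have : (k + k) / 2 = k := by omega
    rw [this]
    have : ord w (y : L) = ram F w * k := by linarith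
    rw [this]; ring
  have hdz : df Q.s z = (df Q.s y) ^ classNumber F := by
    have : df Q.s (Units.mk0 (algebraMap F L a) ha0') = 1 := by
      rw [df_apply, div_eq_one]; ext; simp [Q.coe_s]
    simp only [z]
    rw [map_div, this, div_one, map_pow]
  have hdd : df Q.s (df Q.s y) = df Q.s y ^ 2 := by
    have : Q.s (df Q.s y) = (df Q.s y)⁻¹ := by
      rw [df_apply, map_div, Q.ss, inv_div]
    rw [df_apply _ (df Q.s y), this, div_inv_eq_mul, pow_two]
  obtain ⟨k, hk⟩ := hodd
  refine ⟨z / (df Q.s y) ^ k, div_mem hz (pow_mem hy k), ?_⟩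
  rw [map_div, hdz, map_pow, hdd, ← pow_mul, hk, pow_succ, mul_div_assoc, div_eq_mul_inv]
  rw [mul_comm, mul_assoc]
  simp

lemma QE.indexA (Q : QE F L α β) (hodd : Odd (classNumber F)) {S T : Finset (Pl F)} (D : Dat S T α) :
    ((SU (SL L S : Set (Pl L))).map (df Q.s)).relIndex (SU (SL L S : Set (Pl L)) ⊓ (nm Q.s).ker) ≤ 2 ^ T.card := by
  choose R hR using fun v : Pl F => exists_above (F := F) (L := L) v
  have h90 : ∀ x : (SU (SL L S : Set (Pl L)) ⊓ (nm Q.s).ker : Subgroup Lˣ), ∃ y : Lˣ, df Q.s y = x := by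
    rintro ⟨x, hx, hn⟩
    have h1 : (x : L) * Q.σ (x : L) = 1 := by
      have := congrArg (fun u : Lˣ => (u : L)) hn
      simpa [nm_apply, Q.coe_s] using this
    obtain ⟨y, hy0, hy⟩ := Q.hilbert90 h1
    refine ⟨Units.mk0 y hy0, ?_⟩
    ext
    rw [df_apply, Units.val_div_eq_div_val, Q.coe_s]
    exact hy.symm
  choose Y hY using h90
  have := relIndex_le ((SU (SL L S : Set (Pl L))).map (df Q.s)) (SU (SL L S : Set (Pl L)) ⊓ (nm Q.s).ker)
    (X := T → ZMod 2) (fun x v => (ord (R v.1) (Y x : L) : ZMod 2)) (by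
      intro a b hab
      have h1 : df Q.s (Y a / Y b) = (a : Lˣ) / b := by rw [map_div, hY, hY]
      rw [← h1]
      apply Q.A0 hodd D R hR
      · rw [h1]; exact div_mem a.2.1 b.2.1
      · intro v hv
        have := congrFun hab ⟨v, hv⟩
        simp only at this
        rw [Units.val_div_eq_div_val, ord_div _ (Units.ne_zero _) (Units.ne_zero _)]
        rw [← ZMod.intCast_eq_zero_iff_even]
        push_cast
        rw [this, sub_self])
  simpa using this

lemma two_torsion {H : Subgroup Lˣ} (hneg : (-1 : Lˣ) ∈ H) : Nat.card {x : H // x ^ 2 = 1} = 2 := by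
  have : {x : H | x ^ 2 = 1} = {1, ⟨-1, hneg⟩} := by
    ext x
    simp only [Set.mem_ofPred_eq, Set.mem_insert_iff, Set.mem_singleton_iff]
    constructor
    · intro h
      have h1 : ((x : Lˣ) : L) ^ 2 = 1 := by
        have := congrArg (fun u : H => ((u : Lˣ) : L)) h
        simpa using this
      rcases mul_self_eq_one_iff.1 ((pow_two _).symm.trans h1) with h | h
      · left; ext; simpa using h
      · right; ext; simpa using h
    · rintro (rfl | rfl)
      · simp
      · ext; simp
  change Nat.card ({x : H | x ^ 2 = 1} : Set H) = 2
  rw [this, Nat.card_coe_set_eq, Set.ncard_pair]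
  intro h
  have := congrArg (fun u : H => ((u : Lˣ) : L)) h
  simp at this
  norm_num at this

end
end Sch

namespace Sch
set_option linter.unusedSectionVars false
section
variable {F L : Type*} [Field F] [NumberField F] [Field L] [NumberField L] [Algebra F L]
variable {α : 𝓞 F} {β : 𝓞 L}

/-- inclusion on units -/
noncomputable def inc (F L : Type*) [Field F] [Field L] [Algebra F L] : Fˣ →* Lˣ :=
  Units.map (algebraMap F L : F →* L)

lemma inc_inj : Function.Injective (inc F L) :=
  Units.map_injective (algebraMap F L).injective

lemma QE.plus_eq (Q : QE F L α β) (S : Finset (Pl F)) :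
    SU (SL L S : Set (Pl L)) ⊓ (df Q.s).ker = (SU (S : Set (Pl F))).map (inc F L) := by
  ext x
  constructor
  · rintro ⟨hx, hd⟩
    have h1 : Q.σ (x : L) = x := by
      rw [SetLike.mem_coe, Subgroup.mem_toSubmonoid, MonoidHom.mem_ker, df_apply, div_eq_one] at hd
      exact (congrArg (fun u : Lˣ => (u : L)) hd).symm
    obtain ⟨a, ha⟩ := Q.fixed h1
    have ha0 : a ≠ 0 := by rintro rfl; rw [map_zero] at ha; exact x.ne_zero ha.symm
    refine ⟨Units.mk0 a ha0, ?_, Units.ext ha⟩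
    intro v hv
    obtain ⟨w, hw⟩ := exists_above (L := L) v
    have h2 := hx w (by simpa [mem_SL, hw] using hv)
    rw [← ha, ord_ext, hw] at h2
    have := ram_pos (F := F) w
    rcases mul_eq_zero.1 h2 with h | h
    · exfalso; omega
    · exact h
  · rintro ⟨a, ha, rfl⟩
    constructor
    · intro w hw
      change ord w (algebraMap F L (a : F)) = 0
      rw [ord_ext, ha _ (by simpa [mem_SL] using hw), mul_zero]
    · rw [SetLike.mem_coe, Subgroup.mem_toSubmonoid, MonoidHom.mem_ker, df_apply, div_eq_one]
      ext
      simp [Q.coe_s, inc]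

lemma QE.card_SL (Q : QE F L α β) {S T : Finset (Pl F)} (D : Dat S T α) : 2 * S.card ≤ (SL L S).card := by
  choose R hR using fun v : Pl F => exists_above (F := F) (L := L) v
  have hsp : ∀ q ∈ S, Q.conj (R q) ≠ R q := by
    intro q hq
    obtain ⟨ξ, c, h, hc⟩ := D.spl q hq
    refine Q.split h (R q) ?_ ?_
    · rw [hR]; exact D.unT q (Finset.disjoint_left.1 D.disj hq)
    · rw [hR]; exact hc
  have : ∀ q ∈ S, 2 ≤ ((SL L S).filter (fun w => below F w = q)).card := by
    intro q hq
    have h2 : ({Q.conj (R q), R q} : Finset (Pl L)) ⊆ (SL L S).filter (fun w => below F w = q) := by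
      intro w hw
      rw [Finset.mem_insert, Finset.mem_singleton] at hw
      rw [Finset.mem_filter, mem_SL]
      rcases hw with rfl | rfl
      · rw [Q.below_conj, hR]; exact ⟨hq, rfl⟩
      · rw [hR]; exact ⟨hq, rfl⟩
    have := Finset.card_le_card h2
    rwa [Finset.card_pair (hsp q hq)] at this
  rw [Finset.card_eq_sum_card_fiberwise (f := fun w => below F w) (t := S) (fun w hw => mem_SL.1 hw)]
  calc 2 * S.card = ∑ q ∈ S, 2 := by rw [Finset.sum_const, smul_eq_mul, mul_comm]
    _ ≤ _ := Finset.sum_le_sum this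

lemma subFinite {G : Type*} [CommGroup G] {M N : Subgroup G} (h : N ≤ M) [Module.Finite ℤ (Additive M)] :
    Module.Finite ℤ (Additive N) :=
  Module.Finite.of_injective (MonoidHom.toAdditive (Subgroup.inclusion h)).toIntLinearMap
    (fun _ _ hab => Subgroup.inclusion_injective h hab)

lemma QE.indexB (Q : QE F L α β) (hodd : Odd (classNumber F)) {S T : Finset (Pl F)} (D : Dat S T α) :
    ((SU (SL L S : Set (Pl L))).map (nm Q.s)).relIndex (SU (SL L S : Set (Pl L)) ⊓ (df Q.s).ker) ≠ 0 ∧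
    2 * ((SU (SL L S : Set (Pl L))).map (nm Q.s)).relIndex (SU (SL L S : Set (Pl L)) ⊓ (df Q.s).ker)
      ≤ 2 ^ T.card := by
  have hA := Q.indexA hodd D
  have hH := herbrand Q.s Q.ss (SU (SL L S : Set (Pl L))) (Q.s_mem S)
  set M := SU (SL L S : Set (Pl L)) with hM
  set P := M ⊓ (df Q.s).ker with hP
  set N := M ⊓ (nm Q.s).ker with hN
  have : Module.Finite ℤ (Additive M) := suFinite (SL L S)
  have : Module.Finite ℤ (Additive P) := subFinite inf_le_left
  have : Module.Finite ℤ (Additive N) := subFinite inf_le_left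
  have hneg : (-1 : Lˣ) ∈ M := fun v _ => by simp [ord_neg, ord_one]
  have hsneg : Q.s (-1) = -1 := by ext; simp [Q.coe_s]
  have hnegP : (-1 : Lˣ) ∈ P := ⟨hneg, by
    rw [SetLike.mem_coe, Subgroup.mem_toSubmonoid, MonoidHom.mem_ker, df_apply, hsneg, div_self']⟩
  have hnegN : (-1 : Lˣ) ∈ N := ⟨hneg, by
    rw [SetLike.mem_coe, Subgroup.mem_toSubmonoid, MonoidHom.mem_ker, nm_apply, hsneg]; simp⟩
  rw [sqs_relIndex N, sqs_relIndex P, two_torsion hnegP, two_torsion hnegN] at hH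
  have rM : Module.finrank ℤ (Additive M) = Units.rank L + (SL L S).card := finrank_SU _
  have rP : Module.finrank ℤ (Additive P) = Units.rank F + S.card := by
    rw [← finrank_SU S]
    have e := (SU (S : Set (Pl F))).equivMapOfInjective (inc F L) inc_inj
    rw [← Q.plus_eq S] at e
    exact (MulEquiv.toAdditive e).toIntLinearEquiv.finrank_eq.symm
  have rN : Module.finrank ℤ (Additive M) ≤ Module.finrank ℤ (Additive P) + Module.finrank ℤ (Additive N) := by
    let f0 : M →* P := ((nm Q.s).comp M.subtype).codRestrict P (fun x =>
      ⟨mul_mem x.2 (Q.s_mem S _ x.2), by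
        rw [SetLike.mem_coe, Subgroup.mem_toSubmonoid, MonoidHom.mem_ker, df_apply]
        simp only [MonoidHom.comp_apply, nm_apply, map_mul, Q.ss, Subgroup.subtype_apply]
        rw [mul_comm, div_self']⟩)
    let f : Additive M →ₗ[ℤ] Additive P := (MonoidHom.toAdditive f0).toIntLinearMap
    rw [← finrank_rk f]
    refine add_le_add (Submodule.finrank_le _) ?_
    let g : LinearMap.ker f →ₗ[ℤ] Additive N := AddMonoidHom.toIntLinearMap
      { toFun := fun x => Additive.ofMul ⟨x.1.toMul.1, x.1.toMul.2, by
          have := x.2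
          rw [LinearMap.mem_ker] at this
          exact congrArg (fun u : Additive P => (u.toMul : Lˣ)) this⟩
        map_zero' := rfl
        map_add' := fun _ _ => rfl }
    refine LinearMap.finrank_le_finrank_of_injective (f := g) ?_
    intro x y hxy
    apply Subtype.ext
    apply Additive.toMul.injective
    apply Subtype.ext
    exact congrArg (fun u : Additive N => (u.toMul : Lˣ)) hxy
  have c1 := Q.card_places D.pos
  have c2 := rank_add_one (K := F)
  have c3 := rank_add_one (K := L)
  have c4 := Q.card_SL D
  have hle : Module.finrank ℤ (Additive P) + 1 ≤ Module.finrank ℤ (Additive N) := by omega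
  obtain ⟨d, hd⟩ := Nat.exists_eq_add_of_le hle
  set rp := Module.finrank ℤ (Additive P)
  set X := (M.map (nm Q.s)).relIndex P
  set Y := (M.map (df Q.s)).relIndex N
  rw [hd] at hH
  have hH' : X * 2 ^ (d + 1) = Y := by
    have : 2 ^ rp * 2 * (X * 2 ^ (d + 1)) = 2 ^ rp * 2 * Y := by
      rw [← hH]; ring
    exact Nat.eq_of_mul_eq_mul_left (by positivity) this
  constructor
  · -- contains squares
    intro hX
    have hle : sqs P ≤ M.map (nm Q.s) := by
      rintro _ ⟨x, hx, rfl⟩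
      refine ⟨x, hx.1, ?_⟩
      have := hx.2
      rw [SetLike.mem_coe, Subgroup.mem_toSubmonoid, MonoidHom.mem_ker, df_apply, div_eq_one] at this
      rw [nm_apply, ← this]
      simp [pow_two]
    have h1 := Subgroup.relIndex_dvd_of_le_left P hle
    have h2 : (sqs P).relIndex P ≠ 0 := by
      rw [sqs_relIndex P, two_torsion hnegP]; positivity
    change X ∣ _ at h1
    rw [hX, zero_dvd_iff] at h1
    exact h2 h1
  · have : 1 ≤ 2 ^ d := Nat.one_le_two_pow
    calc 2 * X ≤ 2 * X * 2 ^ d := Nat.le_mul_of_pos_right _ this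
      _ = Y := by rw [← hH']; ring
      _ ≤ _ := hA

/-- every unit is the norm of a unit -/
lemma QE.unit_norm (Q : QE F L α β) (hodd : Odd (classNumber F)) {p : Pl F} (D : Dat ∅ {p} α) (e : (𝓞 F)ˣ) :
    ∃ z : (𝓞 L)ˣ, (z : 𝓞 L) * Q.τ z = algebraMap (𝓞 F) (𝓞 L) e := by
  obtain ⟨h1, h2⟩ := Q.indexB hodd D
  have h3 : ((SU (SL L (∅ : Finset (Pl F)) : Set (Pl L))).map (nm Q.s)).relIndex
    (SU (SL L (∅ : Finset (Pl F)) : Set (Pl L)) ⊓ (df Q.s).ker) = 1 := by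
    rw [Finset.card_singleton] at h2; omega
  rw [Subgroup.relIndex_eq_one, Q.plus_eq] at h3
  have he : Units.map (algebraMap (𝓞 F) F : 𝓞 F →* F) e ∈ SU ((∅ : Finset (Pl F)) : Set (Pl F)) :=
    fun v _ => ord_unit v e
  obtain ⟨z, hz, hze⟩ := h3 ⟨_, he, rfl⟩
  obtain ⟨u, hu⟩ := exists_unit_of_ord (x := (z : L)) z.ne_zero (fun v => hz v (by simp [SL]))
  refine ⟨u, ?_⟩
  apply RingOfIntegers.ext
  have := congrArg (fun u : Lˣ => (u : L)) hze
  rw [nm_apply] at this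
  simp only [Units.val_mul, Q.coe_s, ← hu] at this
  exact this
end
end Sch

namespace Sch
set_option linter.unusedSectionVars false
section chi
variable {F : Type*} [Field F] [NumberField F]

/-- additive quadratic character -/
noncomputable def chi (r : Pl F) (a : 𝓞 F) : ZMod 2 := if ∃ b, a - b ^ 2 ∈ r.asIdeal then 0 else 1

lemma chi_zero_iff {r : Pl F} {a : 𝓞 F} : chi r a = 0 ↔ ∃ b, a - b ^ 2 ∈ r.asIdeal := by
  unfold chi; split_ifs with h <;> simp [h]

lemma zmod2 (x : ZMod 2) : x = 0 ∨ x = 1 := by revert x; decide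

lemma chi_one_iff {r : Pl F} {a : 𝓞 F} : chi r a = 1 ↔ ¬ ∃ b, a - b ^ 2 ∈ r.asIdeal := by
  rw [← chi_zero_iff]
  rcases zmod2 (chi r a) with h | h <;> simp [h]

lemma chi_sq (r : Pl F) (b : 𝓞 F) : chi r (b ^ 2) = 0 := chi_zero_iff.2 ⟨b, by simp⟩
lemma chi_one' (r : Pl F) : chi r 1 = 0 := chi_zero_iff.2 ⟨1, by simp⟩

lemma chi_congr {r : Pl F} {a b : 𝓞 F} (h : a - b ∈ r.asIdeal) : chi r a = chi r b := by
  have : (∃ x, a - x ^ 2 ∈ r.asIdeal) ↔ ∃ x, b - x ^ 2 ∈ r.asIdeal := by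
    constructor
    · rintro ⟨x, hx⟩
      exact ⟨x, by have := Ideal.sub_mem _ hx h; ring_nf at this ⊢; exact this⟩
    · rintro ⟨x, hx⟩
      exact ⟨x, by have := Ideal.add_mem _ hx h; ring_nf at this ⊢; exact this⟩
  unfold chi; simp only [this]

lemma res_sq {r : Pl F} {a : 𝓞 F} : (∃ b, a - b ^ 2 ∈ r.asIdeal) ↔ IsSquare (Ideal.Quotient.mk r.asIdeal a) := by
  constructor
  · rintro ⟨b, hb⟩
    refine ⟨Ideal.Quotient.mk _ b, ?_⟩
    rw [← map_mul, Ideal.Quotient.eq, ← pow_two]; exact hb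
  · rintro ⟨b, hb⟩
    obtain ⟨b, rfl⟩ := Ideal.Quotient.mk_surjective b
    rw [← map_mul, Ideal.Quotient.eq, ← pow_two] at hb
    exact ⟨b, hb⟩

lemma chi_mul {r : Pl F} {a b : 𝓞 F} (ha : a ∉ r.asIdeal) (hb : b ∉ r.asIdeal) :
    chi r (a * b) = chi r a + chi r b := by
  have : r.asIdeal.IsMaximal := r.isMaximal
  let _ : Field (𝓞 F ⧸ r.asIdeal) := Ideal.Quotient.field _
  have : Finite (𝓞 F ⧸ r.asIdeal) := Ideal.finiteQuotientOfFreeOfNeBot _ r.ne_bot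
  let _ : Fintype (𝓞 F ⧸ r.asIdeal) := Fintype.ofFinite _
  have h0 : ∀ c : 𝓞 F, c ∉ r.asIdeal → Ideal.Quotient.mk r.asIdeal c ≠ 0 := fun c hc h =>
    hc (Ideal.Quotient.eq_zero_iff_mem.1 h)
  have key : ∀ c : 𝓞 F, c ∉ r.asIdeal →
      (chi r c = 0 ↔ quadraticChar (𝓞 F ⧸ r.asIdeal) (Ideal.Quotient.mk r.asIdeal c) = 1) := by
    intro c hc
    rw [chi_zero_iff, res_sq, quadraticChar_one_iff_isSquare (h0 c hc)]
  have hd : ∀ c : 𝓞 F, c ∉ r.asIdeal →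
      quadraticChar (𝓞 F ⧸ r.asIdeal) (Ideal.Quotient.mk r.asIdeal c) = if chi r c = 0 then 1 else -1 := by
    intro c hc
    have := key c hc
    split_ifs with h
    · exact this.1 h
    · exact (quadraticChar_dichotomy (h0 c hc)).resolve_left (fun hh => h (this.2 hh))
  have hab : a * b ∉ r.asIdeal := fun h => (r.isPrime.mem_or_mem h).elim ha hb
  have h1 := hd _ hab
  rw [map_mul, map_mul, hd a ha, hd b hb] at h1
  rcases zmod2 (chi r a) with h | h <;> rcases zmod2 (chi r b) with h' | h' <;>
    rcases zmod2 (chi r (a * b)) with h'' | h'' <;> rw [h, h', h''] at h1 ⊢ <;>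
    first | rfl | (exfalso; revert h1; simp)

lemma chi_pow {r : Pl F} {a : 𝓞 F} (ha : a ∉ r.asIdeal) (n : ℕ) : chi r (a ^ n) = n * chi r a := by
  induction n with
  | zero => simp [chi_one']
  | succ n ih =>
    rw [pow_succ, chi_mul (fun h => ha (r.isPrime.mem_of_pow_mem _ h)) ha, ih]; push_cast; ring

lemma chi_norm {r : Pl F} {α u : 𝓞 F} (hα : Odd (ord r (α : F))) (hu : u ∉ r.asIdeal) {x y : F}
    (h : (u : F) = x ^ 2 - α * y ^ 2) : chi r u = 0 := by
  have hu0 : u ≠ 0 := by rintro rfl; exact hu (Ideal.zero_mem _)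
  have hou := (ord_int_eq_zero_iff r hu0).2 hu
  have hα0 : (α : F) ≠ 0 := by rintro h; rw [h, ord_zero] at hα; simp at hα
  have hx : x ≠ 0 := by
    rintro rfl
    have hy : y ≠ 0 := by
      rintro rfl
      apply hu0
      apply RingOfIntegers.ext
      simpa using h
    have h' : (u : F) = -(α * y ^ 2) := by rw [h]; ring
    rw [h', ord_neg, ord_mul _ hα0 (pow_ne_zero _ hy), ord_pow] at hou
    obtain ⟨k, hk⟩ := hα
    push_cast at hou; omega
  have hor : ord r x = 0 ∧ (y = 0 ∨ 0 < ord r ((α : F) * y ^ 2)) := by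
    by_cases hy : y = 0
    · subst hy
      have h' : (u : F) = x ^ 2 := by rw [h]; ring
      rw [h', ord_pow] at hou
      push_cast at hou
      exact ⟨by omega, Or.inl rfl⟩
    · have hB : -((α : F) * y ^ 2) ≠ 0 := neg_ne_zero.2 (mul_ne_zero hα0 (pow_ne_zero _ hy))
      have hA : x ^ 2 ≠ 0 := pow_ne_zero _ hx
      have eB : ord r (-((α : F) * y ^ 2)) = ord r (α : F) + 2 * ord r y := by
        rw [ord_neg, ord_mul _ hα0 (pow_ne_zero _ hy), ord_pow]; norm_cast
      have eA : ord r (x ^ 2) = 2 * ord r x := by rw [ord_pow]; norm_cast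
      rw [ord_neg] at eB
      obtain ⟨k, hk⟩ := hα
      rw [h, sub_eq_add_neg] at hou
      rcases lt_trichotomy (ord r (x ^ 2)) (ord r (-((α : F) * y ^ 2))) with hlt | heq | hgt
      · rw [ord_add_eq r hA hB hlt] at hou
        rw [ord_neg] at hlt
        exact ⟨by omega, Or.inr (by omega)⟩
      · rw [ord_neg] at heq; omega
      · rw [add_comm, ord_add_eq r hB hA hgt, ord_neg] at hou; omega
  obtain ⟨h1, h2⟩ := hor
  obtain ⟨a, b, hb, hab⟩ := exists_frac r hx h1.ge
  have hb0 : b ≠ 0 := by rintro rfl; exact hb (Ideal.zero_mem _)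
  have e : ((a ^ 2 - u * b ^ 2 : 𝓞 F) : F) = (α : F) * y ^ 2 * (b : F) ^ 2 := by
    have : ((a ^ 2 - u * b ^ 2 : 𝓞 F) : F) = (a : F) ^ 2 - u * (b : F) ^ 2 := by simp
    rw [this, ← hab, h]; ring
  have hm : a ^ 2 - u * b ^ 2 ∈ r.asIdeal := by
    by_cases h0 : a ^ 2 - u * b ^ 2 = 0
    · rw [h0]; exact Ideal.zero_mem _
    · rw [← ord_int_pos_iff r h0, e]
      rcases h2 with rfl | h2
      · exfalso; apply h0; apply RingOfIntegers.ext; rw [e]; simp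
      · have hne : (α : F) * y ^ 2 ≠ 0 := by intro hh; rw [hh, ord_zero] at h2; omega
        rw [ord_mul _ hne (pow_ne_zero _ (by simpa using hb0)), ord_pow, (ord_int_eq_zero_iff r hb0).2 hb]
        simpa using h2
  have h3 : chi r (u * b ^ 2) = 0 := by rw [← chi_congr hm, chi_sq]
  rwa [chi_mul hu (fun hh => hb (r.isPrime.mem_of_pow_mem _ hh)), chi_sq, add_zero] at h3

end chi

section lemI
variable {F : Type u} [Field F] [NumberField F]

/-- support of an integer in S -/
def supp (S : Finset (Pl F)) (u : 𝓞 F) : Prop := u ≠ 0 ∧ ∀ v : Pl F, u ∈ v.asIdeal → v ∈ S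

lemma supp.mul {S : Finset (Pl F)} {u v : 𝓞 F} (hu : supp S u) (hv : supp S v) : supp S (u * v) :=
  ⟨mul_ne_zero hu.1 hv.1, fun w hw => (w.isPrime.mem_or_mem hw).elim (hu.2 w) (hv.2 w)⟩

lemma supp.coe0 {S : Finset (Pl F)} {u : 𝓞 F} (hu : supp S u) : (u : F) ≠ 0 := by simpa using hu.1

/-- as S-unit -/
noncomputable def supp.u {S : Finset (Pl F)} {u : 𝓞 F} (hu : supp S u) : Fˣ := Units.mk0 (u : F) hu.coe0

lemma supp.mem {S : Finset (Pl F)} {u : 𝓞 F} (hu : supp S u) : hu.u ∈ SU (S : Set (Pl F)) := fun v hv =>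
  (ord_int_eq_zero_iff v hu.1).2 (fun h => hv (hu.2 v h))

lemma exists_int_rep (S : Finset (Pl F)) (x : Fˣ) (hx : x ∈ SU (S : Set (Pl F))) :
    ∃ (u : 𝓞 F) (hu : supp S u) (s : Fˣ), s ∈ SU (S : Set (Pl F)) ∧ hu.u = x * s ^ 2 := by
  obtain ⟨a, ha0, ha⟩ := exists_ord (K := F) (fun v => |ord v (x : F)|)
    ((ord_finite x.ne_zero).subset fun v hv => by
      intro h0; apply hv; simp only [h0]; simp)
  have ho : ∀ v, ord v ((x : F) * a ^ 2) = ord v (x : F) + 2 * (classNumber F * |ord v (x : F)|) := by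
    intro v
    rw [ord_mul _ x.ne_zero (pow_ne_zero _ ha0), ord_pow, ha]; norm_cast
  have hh : (1 : ℤ) ≤ classNumber F := by
    have := classNumber_ne_zero F
    omega
  obtain ⟨u, hu⟩ := exists_int_of_ord (mul_ne_zero x.ne_zero (pow_ne_zero 2 ha0)) (fun v => by
    rw [ho]
    have h1 : |ord v (x : F)| ≤ classNumber F * |ord v (x : F)| := by
      nlinarith [abs_nonneg (ord v (x : F))]
    have := neg_abs_le (ord v (x : F))
    have := abs_nonneg (ord v (x : F))
    omega)
  have hu0 : u ≠ 0 := by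
    rintro rfl
    exact mul_ne_zero x.ne_zero (pow_ne_zero 2 ha0) (by rw [← hu]; simp)
  refine ⟨u, ⟨hu0, fun v hv => ?_⟩, Units.mk0 a ha0, fun v hv => ?_, ?_⟩
  · by_contra hvS
    rw [← ord_int_pos_iff v hu0, hu, ho, hx v hvS] at hv
    simp at hv
  · simp only [Units.val_mk0]; rw [ha, hx v hv]; simp
  · ext; simpa [supp.u] using hu

theorem lemI (hodd : Odd (classNumber F)) {S T : Finset (Pl F)} {α : 𝓞 F} (D : Dat S T α) :
    ∃ C ⊆ T, C.Nonempty ∧ ∀ u, supp S u → ∑ r ∈ C, chi r u = 0 := by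
  obtain ⟨L, _, _, _, β, Q⟩ := exists_QE α D.ns
  obtain ⟨h1, h2⟩ := Q.indexB hodd D
  rw [Q.plus_eq S] at h1 h2
  set NM := (SU (SL L S : Set (Pl L))).map (nm Q.s) with hNM
  set K := (SU (S : Set (Pl F))).map (inc F L) with hK
  have hnot : ∀ u, supp S u → ∀ r ∈ T, u ∉ r.asIdeal := fun u hu r hr hm =>
    Finset.disjoint_left.1 D.disj (hu.2 r hm) hr
  have claim : ∀ u (hu : supp S u), inc F L hu.u ∈ NM → ∀ r ∈ T, chi r u = 0 := by
    rintro u hu ⟨z, hz, hzu⟩ r hr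
    have h3 : (z : L) * Q.σ (z : L) = algebraMap F L (u : F) := congrArg (fun t : Lˣ => (t : L)) hzu
    obtain ⟨x, y, hxy⟩ := Q.coords (z : L)
    rw [hxy, Q.norm_eq] at h3
    exact chi_norm (D.oddT r hr) (hnot u hu r hr) ((algebraMap F L).injective h3).symm
  have hsq : ∀ s ∈ SU (S : Set (Pl F)), inc F L s ^ 2 ∈ NM := by
    intro s hs
    have hm : inc F L s ∈ K := ⟨s, hs, rfl⟩
    rw [hK, ← Q.plus_eq S] at hm
    refine ⟨inc F L s, hm.1, ?_⟩
    have := hm.2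
    rw [SetLike.mem_coe, Subgroup.mem_toSubmonoid, MonoidHom.mem_ker, df_apply, div_eq_one] at this
    rw [nm_apply, ← this, pow_two]
  have claim2 : ∀ u u' (hu : supp S u) (hu' : supp S u'), (∃ s ∈ SU (S : Set (Pl F)),
      inc F L (hu.u / hu'.u * s ^ 2) ∈ NM) → ∀ r ∈ T, chi r u = chi r u' := by
    rintro u u' hu hu' ⟨s, hs, hn⟩ r hr
    have h3 := claim (u * u') (hu.mul hu') (by
      have e : inc F L (hu.mul hu').u = inc F L (hu.u / hu'.u * s ^ 2) * inc F L (hu'.u / s) ^ 2 := by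
        rw [← map_pow, ← map_mul]
        congr 1
        have : (hu.mul hu').u = hu.u * hu'.u := by ext; simp [supp.u]
        rw [this, div_pow, div_eq_mul_inv, div_eq_mul_inv]
        calc hu.u * hu'.u = (hu.u * hu'.u⁻¹ * hu'.u ^ 2) * (s ^ 2 * (s ^ 2)⁻¹) := by
              rw [mul_inv_cancel, mul_one, pow_two, mul_assoc, inv_mul_cancel_left]
          _ = _ := by
            rw [mul_assoc, mul_assoc, mul_assoc, mul_assoc]
            congr 2
            rw [← mul_assoc, ← mul_assoc, mul_comm (hu'.u ^ 2)]
      rw [e]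
      exact mul_mem hn (hsq _ (div_mem hu'.mem hs))) r hr
    rw [chi_mul (hnot _ hu r hr) (hnot _ hu' r hr)] at h3
    rcases zmod2 (chi r u) with h | h <;> rcases zmod2 (chi r u') with h' | h' <;>
      rw [h, h'] at h3 ⊢ <;> revert h3 <;> decide
  have hrep : ∀ k : K, ∃ u, ∃ hu : supp S u, ∃ s ∈ SU (S : Set (Pl F)), inc F L hu.u = k * inc F L s ^ 2 := by
    rintro ⟨_, x, hx, rfl⟩
    obtain ⟨u, hu, s, hs, he⟩ := exists_int_rep S x hx
    exact ⟨u, hu, s, hs, by rw [he]; simp⟩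
  choose U hU s hs hUs using hrep
  let f : K → (T → ZMod 2) := fun k r => chi r.1 (U k)
  have hge := relIndex_ge NM K f h1 (by
    intro a b hab
    funext r
    refine claim2 _ _ (hU a) (hU b) ⟨s b / s a, div_mem (hs b) (hs a), ?_⟩ r.1 r.2
    rw [map_mul, map_div, map_pow, map_div, hUs, hUs]
    convert hab using 1
    rw [div_pow, mul_div_mul_comm, mul_assoc]
    simp)
  let W : Submodule (ZMod 2) (T → ZMod 2) :=
    { carrier := {x | ∃ u, supp S u ∧ ∀ r : T, chi r.1 u = x r}
      zero_mem' := ⟨1, ⟨one_ne_zero, fun v hv => absurd ((Ideal.eq_top_iff_one _).2 hv) v.isPrime.ne_top⟩,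
        fun r => chi_one' _⟩
      add_mem' := by
        rintro x y ⟨u, hu, hx⟩ ⟨v, hv, hy⟩
        refine ⟨u * v, hu.mul hv, fun r => ?_⟩
        rw [chi_mul (hnot _ hu _ r.2) (hnot _ hv _ r.2), hx, hy]; rfl
      smul_mem' := by
        rintro c x ⟨u, hu, hx⟩
        rcases zmod2 c with rfl | rfl
        · exact ⟨1, ⟨one_ne_zero, fun v hv => absurd ((Ideal.eq_top_iff_one _).2 hv) v.isPrime.ne_top⟩,
            fun r => by rw [chi_one']; simp⟩
        · exact ⟨u, hu, fun r => by rw [hx]; simp⟩ }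
  have hW : (W : Set (T → ZMod 2)) ⊆ Set.range f := by
    rintro x ⟨u, hu, hx⟩
    let k : K := ⟨inc F L hu.u, _, hu.mem, rfl⟩
    refine ⟨k, ?_⟩
    funext r
    rw [← hx]
    refine claim2 _ _ (hU k) hu ⟨(s k)⁻¹, inv_mem (hs k), ?_⟩ r.1 r.2
    rw [map_mul, map_div, map_pow, hUs, map_inv]
    have : (k : Lˣ) * inc F L (s k) ^ 2 / inc F L hu.u * (inc F L (s k))⁻¹ ^ 2 = 1 := by
      change inc F L hu.u * inc F L (s k) ^ 2 / inc F L hu.u * (inc F L (s k))⁻¹ ^ 2 = 1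
      simp
    rw [this]; exact one_mem _
  have hlt : W < ⊤ := by
    rw [lt_top_iff_ne_top]
    intro hW'
    rw [hW'] at hW
    have h4 : Set.range f = Set.univ := Set.eq_univ_of_univ_subset (by simpa using hW)
    rw [h4] at hge
    have h5 : Nat.card (Set.univ : Set (T → ZMod 2)) = 2 ^ T.card := by simp
    rw [h5] at hge
    have : 0 < 2 ^ T.card := by positivity
    omega
  obtain ⟨g, hg0, hg⟩ := Submodule.exists_le_ker_of_lt_top W hlt
  refine ⟨(Finset.univ.filter fun r : T => g (Pi.single r 1) = 1).map (Function.Embedding.subtype _), ?_, ?_, ?_⟩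
  · intro r hr
    rw [Finset.mem_map] at hr
    obtain ⟨a, -, rfl⟩ := hr
    exact a.2
  · rw [Finset.map_nonempty]
    by_contra hne
    rw [Finset.not_nonempty_iff_eq_empty, Finset.filter_eq_empty_iff] at hne
    apply hg0
    apply LinearMap.pi_ext'
    intro r
    ext
    have := hne (Finset.mem_univ r)
    simpa using (zmod2 _).resolve_right this
  · intro u hu
    rw [Finset.sum_map, Finset.sum_filter]
    have h6 : g (fun r : T => chi r.1 u) = 0 := hg ⟨u, hu, fun r => rfl⟩
    rw [LinearMap.pi_apply_eq_sum_univ] at h6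
    refine Eq.trans ?_ h6
    apply Finset.sum_congr rfl
    intro r _
    have e : (fun j => if r = j then (1 : ZMod 2) else 0) = Pi.single r 1 := by
      ext j; simp [Pi.single_apply, eq_comm]
    rw [e]
    rcases zmod2 (g (Pi.single r 1)) with h | h <;> simp [h]
end lemI
end Sch

namespace Sch
set_option linter.unusedSectionVars false
section cnt
open Filter Topology nonZeroDivisors
variable {K : Type*} [Field K] [NumberField K]

/-- norm of a multiset of primes -/
noncomputable def nrm (m : Multiset (Pl K)) : ℕ := (m.map fun v => Ideal.absNorm v.asIdeal).prod

noncomputable def idl (m : Multiset (Pl K)) : Ideal (𝓞 K) := (m.map fun v => v.asIdeal).prod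

lemma nrm_idl (m : Multiset (Pl K)) : Ideal.absNorm (idl m) = nrm m := by
  unfold idl nrm
  rw [map_multiset_prod, Multiset.map_map]; rfl

lemma nrm_add (m m' : Multiset (Pl K)) : nrm (m + m') = nrm m * nrm m' := by
  simp [nrm]

lemma nrm_cons (v) (m : Multiset (Pl K)) : nrm (v ::ₘ m) = Ideal.absNorm v.asIdeal * nrm m := by
  simp [nrm]

lemma absNorm_pos (v : Pl K) : 0 < Ideal.absNorm v.asIdeal :=
  Nat.pos_of_ne_zero (by rw [Ne, Ideal.absNorm_eq_zero_iff]; exact v.ne_bot)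

lemma nrm_pos (m : Multiset (Pl K)) : 0 < nrm m := by
  unfold nrm
  induction m using Multiset.induction with
  | empty => simp
  | cons a s ih => simp only [Multiset.map_cons, Multiset.prod_cons]; exact Nat.mul_pos (absNorm_pos a) ih

lemma idl_ne (m : Multiset (Pl K)) : idl m ≠ ⊥ := by
  rw [Ne, ← Ideal.absNorm_eq_zero_iff, nrm_idl]; exact (nrm_pos m).ne'

lemma idl_inj : Function.Injective (idl (K := K)) := by
  intro m m' h
  have key : ∀ m : Multiset (Pl K), UniqueFactorizationMonoid.normalizedFactors (idl m) = m.map fun v => v.asIdeal := by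
    intro m
    apply UniqueFactorizationMonoid.normalizedFactors_prod_of_prime
    intro p hp
    rw [Multiset.mem_map] at hp
    obtain ⟨v, -, rfl⟩ := hp
    exact v.prime
  have h1 := key m
  rw [h, key m'] at h1
  exact (Multiset.map_injective (fun v w h => IsDedekindDomain.HeightOneSpectrum.ext h) h1).symm

lemma idl_surj {I : Ideal (𝓞 K)} (hI : I ≠ ⊥) : ∃ m, idl m = I := by
  have h := Ideal.prod_normalizedFactors_eq_self hI
  have hp : ∀ p ∈ UniqueFactorizationMonoid.normalizedFactors I, Prime p :=
    fun p hp => UniqueFactorizationMonoid.prime_of_normalized_factor p hp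
  refine ⟨(UniqueFactorizationMonoid.normalizedFactors I).attach.map fun p =>
    ⟨p.1, Ideal.isPrime_of_prime (hp p.1 p.2), (hp p.1 p.2).ne_zero⟩, ?_⟩
  unfold idl
  rw [Multiset.map_map]
  conv_rhs => rw [← h]
  congr 1
  exact Multiset.attach_map_val _

def cs (B : Finset (Pl K)) (x : ℝ) : Set (Multiset (Pl K)) := {m | (∀ v ∈ m, v ∉ B) ∧ (nrm m : ℝ) ≤ x}

noncomputable def idlEquiv (x : ℝ) : cs (∅ : Finset (Pl K)) x ≃ {I : (Ideal (𝓞 K))⁰ // (Ideal.absNorm (I : Ideal (𝓞 K)) : ℝ) ≤ x} :=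
  Equiv.ofBijective (fun m => ⟨⟨idl m.1, mem_nonZeroDivisors_of_ne_zero (idl_ne _)⟩, by
    have := m.2.2; rw [nrm_idl]; exact this⟩) ⟨by
    intro m m' h
    apply Subtype.ext
    apply idl_inj
    exact congrArg (fun z => (z.1 : Ideal (𝓞 K))) h, by
    rintro ⟨⟨I, hI⟩, h⟩
    obtain ⟨m, rfl⟩ := idl_surj (nonZeroDivisors.ne_zero hI)
    refine ⟨⟨m, by simp, ?_⟩, rfl⟩
    rw [← nrm_idl]; exact h⟩

lemma tend0 : ∃ c : ℝ, 0 < c ∧ Tendsto (fun x : ℝ => (Nat.card (cs (∅ : Finset (Pl K)) x) : ℝ) / x) atTop (𝓝 c) := by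
  refine ⟨_, dedekindZeta_residue_pos K, ?_⟩
  have := Ideal.tendsto_norm_le_div_atTop₀ K
  rw [dedekindZeta_residue_def]
  refine this.congr fun x => ?_
  congr 2
  exact (Nat.card_congr (idlEquiv (K := K) x)).symm

lemma cs_finite (B : Finset (Pl K)) (x : ℝ) : (cs B x).Finite := by
  have h0 : (cs (∅ : Finset (Pl K)) x).Finite := by
    have : {I : Ideal (𝓞 K) | Ideal.absNorm I ≤ ⌊x⌋₊}.Finite := Ideal.finite_setOfPred_absNorm_le _
    refine Set.Finite.of_finite_image (f := idl) (this.subset ?_) idl_inj.injOn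
    rintro _ ⟨m, hm, rfl⟩
    show Ideal.absNorm _ ≤ _
    rw [nrm_idl]
    exact Nat.le_floor hm.2
  exact h0.subset fun m hm => ⟨by simp, hm.2⟩

lemma cs_insert (B : Finset (Pl K)) (r : Pl K) (hr : r ∉ B) (x : ℝ) :
    Nat.card (cs B x) = Nat.card (cs (insert r B) x) + Nat.card (cs B (x / Ideal.absNorm r.asIdeal)) := by
  have hN : (0 : ℝ) < Ideal.absNorm r.asIdeal := by exact_mod_cast absNorm_pos r
  have e : cs B x = cs (insert r B) x ∪ (fun m => r ::ₘ m) '' cs B (x / Ideal.absNorm r.asIdeal) := by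
    ext m
    constructor
    · rintro ⟨h1, h2⟩
      by_cases hm : r ∈ m
      · right
        obtain ⟨m', rfl⟩ := Multiset.exists_cons_of_mem hm
        refine ⟨m', ⟨fun v hv => h1 v (Multiset.mem_cons_of_mem hv), ?_⟩, rfl⟩
        rw [le_div_iff₀ hN, mul_comm]
        rw [nrm_cons] at h2; exact_mod_cast h2
      · left
        refine ⟨fun v hv => ?_, h2⟩
        rw [Finset.mem_insert, not_or]
        exact ⟨fun h => hm (h ▸ hv), h1 v hv⟩
    · rintro (⟨h1, h2⟩ | ⟨m', ⟨h1, h2⟩, rfl⟩)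
      · exact ⟨fun v hv h => h1 v hv (Finset.mem_insert_of_mem h), h2⟩
      · refine ⟨fun v hv => ?_, ?_⟩
        · rcases Multiset.mem_cons.1 hv with rfl | h
          · exact hr
          · exact h1 v h
        · rw [le_div_iff₀ hN, mul_comm] at h2
          rw [nrm_cons]; exact_mod_cast h2
  have hd : Disjoint (cs (insert r B) x) ((fun m => r ::ₘ m) '' cs B (x / Ideal.absNorm r.asIdeal)) := by
    rw [Set.disjoint_left]
    rintro _ ⟨h1, h2⟩ ⟨m', -, rfl⟩
    exact h1 r (Multiset.mem_cons_self _ _) (Finset.mem_insert_self _ _)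
  simp only [Nat.card_coe_set_eq]
  conv_lhs => rw [e]
  rw [Set.ncard_union_eq hd (cs_finite _ _) ((cs_finite _ _).image _),
    Set.ncard_image_of_injective _ (fun a b h => (Multiset.cons_inj_right r).1 h)]

lemma tendB (B : Finset (Pl K)) : ∃ c : ℝ, 0 < c ∧ Tendsto (fun x : ℝ => (Nat.card (cs B x) : ℝ) / x) atTop (𝓝 c) := by
  induction B using Finset.induction_on with
  | empty => exact tend0
  | insert r B hr ih =>
    obtain ⟨c, hc, ht⟩ := ih
    have hN : (1 : ℝ) < Ideal.absNorm r.asIdeal := by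
      have h1 := absNorm_pos r
      have h2 : Ideal.absNorm r.asIdeal ≠ 1 := fun h => r.isPrime.ne_top (Ideal.absNorm_eq_one_iff.1 h)
      exact_mod_cast (show 1 < Ideal.absNorm r.asIdeal by omega)
    set N : ℝ := (Ideal.absNorm r.asIdeal : ℝ) with hNdef
    have hN0 : 0 < N := by linarith
    have h2 : Tendsto (fun x : ℝ => (Nat.card (cs B (x / N)) : ℝ) / (x / N)) atTop (𝓝 c) :=
      ht.comp (tendsto_id.atTop_div_const hN0)
    refine ⟨c - c / N, ?_, ?_⟩
    · rw [sub_pos]; exact div_lt_self hc hN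
    · refine (ht.sub (h2.div_const N)).congr fun x => ?_
      rw [cs_insert B r hr x]
      push_cast
      rw [div_div, div_mul_cancel₀ _ hN0.ne']
      ring

/-- the analytic core -/
lemma analytic {L : Type*} [Field L] [NumberField L] (B : Finset (Pl K))
    (g g' : Pl K → Pl L) (hg : Function.Injective g) (hg' : Function.Injective g')
    (hgg : ∀ v w, v ∉ B → w ∉ B → g v ≠ g' w)
    (hN : ∀ v ∉ B, Ideal.absNorm (g v).asIdeal = Ideal.absNorm v.asIdeal)
    (hN' : ∀ v ∉ B, Ideal.absNorm (g' v).asIdeal = Ideal.absNorm v.asIdeal) : False := by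
  obtain ⟨c, hc, ht⟩ := tendB B
  obtain ⟨C, -, hT⟩ := tend0 (K := L)
  have nm : ∀ g : Pl K → Pl L, (∀ v ∉ B, Ideal.absNorm (g v).asIdeal = Ideal.absNorm v.asIdeal) →
      ∀ m : Multiset (Pl K), (∀ v ∈ m, v ∉ B) → nrm (m.map g) = nrm m := by
    intro g hg m hm
    unfold nrm
    rw [Multiset.map_map]
    congr 1
    exact Multiset.map_congr rfl fun v hv => hg v (hm v hv)
  let X : Set (Multiset (Pl K)) := {m | ∀ v ∈ m, v ∉ B}
  -- count of pairs
  have hle : ∀ (s : Finset X) (x : ℝ), ∑ I ∈ s, Nat.card (cs B (x / nrm I.1)) ≤ Nat.card (cs (∅ : Finset (Pl L)) x) := by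
    intro s x
    have : Finite (cs (∅ : Finset (Pl L)) x) := cs_finite _ _
    have hf : ∀ I : X, Finite (cs B (x / nrm I.1)) := fun I => cs_finite _ _
    rw [← Finset.sum_coe_sort, ← Nat.card_sigma]
    let f : (Σ I : s, cs B (x / nrm I.1.1)) → cs (∅ : Finset (Pl L)) x := fun p =>
      ⟨p.1.1.1.map g + p.2.1.map g', by simp, by
        rw [nrm_add, nm g hN _ p.1.1.2, nm g' hN' _ p.2.2.1]
        have h1 := p.2.2.2
        have h0 : (0 : ℝ) < nrm p.1.1.1 := by exact_mod_cast nrm_pos _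
        rw [le_div_iff₀ h0, mul_comm] at h1
        exact_mod_cast h1⟩
    refine Nat.card_le_card_of_injective f ?_
    rintro ⟨⟨⟨I, hI⟩, hIs⟩, ⟨J, hJ⟩⟩ ⟨⟨⟨I', hI'⟩, hIs'⟩, ⟨J', hJ'⟩⟩ h
    have h1 : I.map g + J.map g' = I'.map g + J'.map g' := congrArg Subtype.val h
    have key : ∀ I J : Multiset (Pl K), (∀ v ∈ I, v ∉ B) → (∀ v ∈ J, v ∉ B) →
        (I.map g + J.map g').filter (fun w => ∃ v ∉ B, g v = w) = I.map g := by
      intro I J hI hJ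
      rw [Multiset.filter_add, Multiset.filter_eq_self.2, Multiset.filter_eq_nil.2, add_zero]
      · intro w hw
        obtain ⟨v, hv, rfl⟩ := Multiset.mem_map.1 hw
        rintro ⟨v', hv', e⟩
        exact hgg _ _ hv' (hJ v hv) e
      · intro w hw
        obtain ⟨v, hv, rfl⟩ := Multiset.mem_map.1 hw
        exact ⟨v, hI v hv, rfl⟩
    have h2 := congrArg (Multiset.filter (fun w => ∃ v ∉ B, g v = w)) h1
    rw [key I J hI hJ.1, key I' J' hI' hJ'.1] at h2
    rw [h2] at h1
    have hII := Multiset.map_injective hg h2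
    have hJJ := Multiset.map_injective hg' (add_left_cancel h1)
    subst hII; subst hJJ; rfl
  have hsum : ∀ s : Finset X, ∑ I ∈ s, (1 / (nrm I.1 : ℝ)) ≤ C / c := by
    intro s
    rw [le_div_iff₀ hc, Finset.sum_mul]
    have h1 : Tendsto (fun x : ℝ => ∑ I ∈ s, (Nat.card (cs B (x / nrm I.1)) : ℝ) / x) atTop
        (𝓝 (∑ I ∈ s, 1 / (nrm I.1 : ℝ) * c)) := by
      refine tendsto_finsetSum _ fun I _ => ?_
      have h0 : (0 : ℝ) < nrm I.1 := by exact_mod_cast nrm_pos _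
      have h2 : Tendsto (fun x : ℝ => (Nat.card (cs B (x / nrm I.1)) : ℝ) / (x / nrm I.1)) atTop (𝓝 c) :=
        ht.comp (tendsto_id.atTop_div_const h0)
      refine (h2.const_mul (1 / (nrm I.1 : ℝ))).congr fun x => ?_
      field_simp
    refine le_of_tendsto_of_tendsto h1 hT ?_
    filter_upwards [eventually_gt_atTop 0] with x hx
    rw [← Finset.sum_div]
    gcongr
    exact_mod_cast hle s x
  have hsm : Summable fun I : X => 1 / (nrm I.1 : ℝ) :=
    summable_of_sum_le (fun I => by positivity) hsum
  obtain ⟨s, hs⟩ := (summable_iff_vanishing_norm.1 hsm) (c / 2) (by positivity)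
  have hcnt : ∀ x : ℝ, 0 < x → (Nat.card (cs B x) : ℝ) / x ≤ s.card / x + c / 2 := by
    intro x hx
    let t : Finset X := (cs_finite B x).toFinset.subtype (· ∈ X)
    have ht : Nat.card (cs B x) = t.card := by
      rw [Finset.card_subtype, Nat.card_coe_set_eq, Set.ncard_eq_toFinset_card _ (cs_finite B x)]
      congr 1
      rw [Finset.filter_true_of_mem]
      intro m hm
      exact ((Set.Finite.mem_toFinset _).1 hm).1
    have h1 : t.card ≤ s.card + (t \ s).card := by
      have := Finset.card_le_card_sdiff_add_card (s := t) (t := s)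
      omega
    have h2 : ((t \ s).card : ℝ) ≤ x * (c / 2) := by
      have h3 := hs (t \ s) Finset.sdiff_disjoint
      rw [Real.norm_of_nonneg (Finset.sum_nonneg fun I _ => by positivity)] at h3
      have h4 : ((t \ s).card : ℝ) * (1 / x) ≤ ∑ I ∈ t \ s, 1 / (nrm I.1 : ℝ) := by
        rw [← nsmul_eq_mul]
        refine Finset.card_nsmul_le_sum _ _ _ fun I hI => ?_
        have h5 : I ∈ t := (Finset.mem_sdiff.1 hI).1
        have h6 : I.1 ∈ cs B x := (Set.Finite.mem_toFinset _).1 (Finset.mem_subtype.1 h5)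
        have h0 : (0 : ℝ) < nrm I.1 := by exact_mod_cast nrm_pos _
        exact one_div_le_one_div_of_le h0 h6.2
      have h7 := h4.trans h3.le
      rw [mul_one_div, div_le_iff₀ hx] at h7
      linarith
    rw [ht, div_le_iff₀ hx, add_mul, div_mul_cancel₀ _ hx.ne']
    have : (t.card : ℝ) ≤ s.card + (t \ s).card := by exact_mod_cast h1
    linarith
  have hlim : Tendsto (fun x : ℝ => (s.card : ℝ) / x + c / 2) atTop (𝓝 (0 + c / 2)) :=
    (tendsto_const_nhds.div_atTop tendsto_id).add_const _
  have := le_of_tendsto_of_tendsto ht hlim (by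
    filter_upwards [eventually_gt_atTop 0] with x hx using hcnt x hx)
  linarith
end cnt
end Sch

namespace Sch
set_option linter.unusedSectionVars false
section res
variable {F L : Type*} [Field F] [NumberField F] [Field L] [NumberField L] [Algebra F L]
variable {α : 𝓞 F} {β : 𝓞 L}

lemma exists_inv (q : Pl F) {a : 𝓞 F} (ha : a ∉ q.asIdeal) : ∃ e, a * e - 1 ∈ q.asIdeal := by
  have := q.isMaximal
  obtain ⟨y, i, hi, h⟩ := (Ideal.isMaximal_iff.1 q.isMaximal).2 _ a le_sup_left ha
    (Ideal.mem_sup_right (Ideal.mem_span_singleton_self a)) |> Ideal.mem_span_singleton_sup.1 ∘ (by rw [sup_comm]; exact id)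
  refine ⟨y, ?_⟩
  have : a * y - 1 = - i := by rw [← h]; ring
  rw [this]; exact Ideal.neg_mem_iff _ |>.2 hi

lemma QE.beta_cong (Q : QE F L α β) (w : Pl L) {b : 𝓞 F} (h : α - b ^ 2 ∈ (below F w).asIdeal) :
    ∃ b', (b' = b ∨ b' = -b) ∧ β - algebraMap (𝓞 F) (𝓞 L) b' ∈ w.asIdeal := by
  have h1 : (β - algebraMap (𝓞 F) (𝓞 L) b) * (β - algebraMap (𝓞 F) (𝓞 L) (-b)) ∈ w.asIdeal := by
    rw [mem_below, map_sub, map_pow, ← Q.hβ] at h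
    rw [map_neg]
    convert h using 1; ring
  rcases w.isPrime.mem_or_mem h1 with h | h
  · exact ⟨b, Or.inl rfl, h⟩
  · exact ⟨-b, Or.inr rfl, h⟩

lemma QE.res_surj (Q : QE F L α β) (w : Pl L) {b : 𝓞 F} (h : α - b ^ 2 ∈ (below F w).asIdeal)
    (h2 : 2 * α ∉ (below F w).asIdeal) (z : 𝓞 L) : ∃ x, z - algebraMap (𝓞 F) (𝓞 L) x ∈ w.asIdeal := by
  obtain ⟨b', -, hb⟩ := Q.beta_cong w h
  obtain ⟨t, ht⟩ := Q.τ_add z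
  obtain ⟨u, hu⟩ := Q.fixed_int (z := (z - Q.τ z) * β) (by
    rw [map_mul, map_sub, Q.ττ, Q.τβ]; ring)
  obtain ⟨e, he⟩ := exists_inv _ h2
  rw [mem_below, map_sub, map_mul, map_mul, map_one, map_ofNat, ← Q.hβ] at he
  refine ⟨e * (α * t + b' * u), ?_⟩
  rw [map_mul, map_add, map_mul, map_mul, ht, hu, ← Q.hβ]
  have h3 := Ideal.sub_mem _ (Ideal.mul_mem_left _ (algebraMap (𝓞 F) (𝓞 L) e * ((z - Q.τ z) * β)) hb) (Ideal.mul_mem_left _ z he)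
  convert h3 using 1
  ring

lemma QE.conj_ne (Q : QE F L α β) (w : Pl L) {b : 𝓞 F} (h : α - b ^ 2 ∈ (below F w).asIdeal)
    (h2 : 2 * α ∉ (below F w).asIdeal) : Q.conj w ≠ w := by
  intro he
  have he' : ∀ x, Q.τ x ∈ w.asIdeal ↔ x ∈ w.asIdeal := fun x => by rw [← Q.mem_conj, he]
  obtain ⟨b', -, hb⟩ := Q.beta_cong w h
  have h3 := (he' _).2 hb
  rw [map_sub, Q.τβ, Q.τ_am] at h3
  have h4 := Ideal.sub_mem _ hb h3
  apply h2
  rw [mem_below, map_mul, map_ofNat, ← Q.hβ]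
  convert Ideal.mul_mem_left _ β h4 using 1
  ring

lemma norm_eq_of_surj (w : Pl L) (h : ∀ z : 𝓞 L, ∃ x, z - algebraMap (𝓞 F) (𝓞 L) x ∈ w.asIdeal) :
    Ideal.absNorm w.asIdeal = Ideal.absNorm (below F w).asIdeal := by
  rw [Ideal.absNorm_apply, Ideal.absNorm_apply, Submodule.cardQuot_apply, Submodule.cardQuot_apply]
  symm
  refine Nat.card_congr (Equiv.ofBijective (Ideal.quotientMap w.asIdeal (algebraMap (𝓞 F) (𝓞 L)) (le_refl _)) ⟨?_, ?_⟩)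
  · exact Ideal.quotientMap_injective
  · intro z
    obtain ⟨z, rfl⟩ := Ideal.Quotient.mk_surjective z
    obtain ⟨x, hx⟩ := h z
    exact ⟨Ideal.Quotient.mk _ x, (Ideal.Quotient.eq.2 hx).symm⟩

lemma chi_surj (w : Pl L) (h : ∀ z : 𝓞 L, ∃ x, z - algebraMap (𝓞 F) (𝓞 L) x ∈ w.asIdeal) (a : 𝓞 F) :
    chi w (algebraMap (𝓞 F) (𝓞 L) a) = chi (below F w) a := by
  have : chi w (algebraMap (𝓞 F) (𝓞 L) a) = 0 ↔ chi (below F w) a = 0 := by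
    rw [chi_zero_iff, chi_zero_iff]
    constructor
    · rintro ⟨z, hz⟩
      obtain ⟨x, hx⟩ := h z
      refine ⟨x, ?_⟩
      rw [mem_below, map_sub, map_pow]
      have h3 := Ideal.add_mem _ hz (Ideal.mul_mem_left _ (z + algebraMap (𝓞 F) (𝓞 L) x) hx)
      convert h3 using 1
      ring
    · rintro ⟨x, hx⟩
      refine ⟨algebraMap _ _ x, ?_⟩
      rw [mem_below, map_sub, map_pow] at hx
      exact hx
  rcases zmod2 (chi (below F w) a) with h | h <;> rcases zmod2 (chi w (algebraMap (𝓞 F) (𝓞 L) a)) with h' | h' <;>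
    rw [h, h'] at this <;> rw [h, h'] <;> revert this <;> simp

lemma mem_finite {a : 𝓞 F} (ha : a ≠ 0) : {v : Pl F | a ∈ v.asIdeal}.Finite := by
  refine (ord_finite (x := (a : F)) (by simpa using ha)).subset fun v hv => ?_
  have := (ord_int_pos_iff v ha).2 hv
  exact this.ne'
end res

section cheb
lemma cheb1 {F : Type u} [Field F] [NumberField F] (a : 𝓞 F) (ns : ∀ x : F, x ^ 2 ≠ (a : F))
    (b : 𝓞 F) (hb : b ≠ 0) : ∃ r : Pl F, b ∉ r.asIdeal ∧ chi r a = 1 := by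
  by_contra hcon
  push Not at hcon
  have ha0 : a ≠ 0 := by rintro rfl; exact ns 0 (by simp)
  obtain ⟨L, _, _, _, β, Q⟩ := exists_QE a ns
  have hc0 : b * (2 * a) ≠ 0 := mul_ne_zero hb (mul_ne_zero two_ne_zero ha0)
  let B := (mem_finite hc0).toFinset
  have hB : ∀ v : Pl F, v ∉ B → b * (2 * a) ∉ v.asIdeal := fun v hv h => hv ((Set.Finite.mem_toFinset _).2 h)
  choose g hg using fun q : Pl F => exists_above (L := L) q
  have hres : ∀ v ∉ B, ∃ c, a - c ^ 2 ∈ v.asIdeal := fun v hv =>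
    chi_zero_iff.1 ((zmod2 _).resolve_right (hcon v fun h => hB v hv (Ideal.mul_mem_right _ _ h)))
  have h2 : ∀ v ∉ B, 2 * a ∉ v.asIdeal := fun v hv h => hB v hv (Ideal.mul_mem_left _ _ h)
  have hn : ∀ w : Pl L, below F w ∉ B → Ideal.absNorm w.asIdeal = Ideal.absNorm (below F w).asIdeal := by
    intro w hw
    obtain ⟨c, hc⟩ := hres _ hw
    exact norm_eq_of_surj w (Q.res_surj w hc (h2 _ hw))
  refine analytic B g (fun q => Q.conj (g q)) ?_ ?_ ?_ ?_ ?_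
  · intro v w h; rw [← hg v, h, hg]
  · intro v w h
    have := congrArg (below F) h
    simpa only [Q.below_conj, hg] using this
  · intro v w hv hw h
    have := congrArg (below F) h
    simp only [Q.below_conj, hg] at this
    subst this
    have hb := hg v
    rw [← hb] at hv
    obtain ⟨c, hc⟩ := hres _ hv
    exact Q.conj_ne _ hc (h2 _ hv) h.symm
  · intro v hv
    rw [hn _ (by rw [hg]; exact hv), hg]
  · intro v hv
    rw [hn _ (by rw [Q.below_conj, hg]; exact hv), Q.below_conj, hg]

/-- no `a * (product of a sublist)` is a square -/
def indep {F : Type*} [Field F] [NumberField F] : 𝓞 F → List (𝓞 F) → Prop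
  | a, [] => ∀ x : F, x ^ 2 ≠ (a : F)
  | a, c :: l => indep a l ∧ indep (a * c) l

lemma indep_ne {F : Type*} [Field F] [NumberField F] {l : List (𝓞 F)} : ∀ {a : 𝓞 F}, indep a l → a ≠ 0 := by
  induction l with
  | nil => rintro a h rfl; exact h 0 (by simp)
  | cons c l ih => intro a h; exact ih h.1

lemma indep_up {F L : Type*} [Field F] [NumberField F] [Field L] [NumberField L] [Algebra F L]
    {c : 𝓞 F} {β : 𝓞 L} (Q : QE F L c β) (l : List (𝓞 F)) : ∀ a : 𝓞 F, indep a l → indep (a * c) l →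
    indep (algebraMap (𝓞 F) (𝓞 L) a) (l.map (algebraMap (𝓞 F) (𝓞 L))) := by
  induction l with
  | nil =>
    intro a h1 h2 z hz
    obtain ⟨x, y, rfl⟩ := Q.coords z
    rw [coe_am] at hz
    have e : 2 * (algebraMap F L x) * (algebraMap F L y) * β = algebraMap F L (a - x ^ 2 - y ^ 2 * c) := by
      rw [map_sub, map_sub, map_mul, map_pow, map_pow, ← Q.sq, ← hz]; ring
    have e2 := congrArg Q.σ e
    rw [AlgEquiv.commutes, map_mul, map_mul, map_mul, AlgEquiv.commutes, AlgEquiv.commutes, Q.σβ, map_ofNat, ← e] at e2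
    have e3 : (4 : L) * (algebraMap F L x * algebraMap F L y) * β = 0 := by linear_combination -e2
    have e4 : algebraMap F L x * algebraMap F L y = 0 := by
      have := Q.β0
      rcases mul_eq_zero.1 e3 with h | h
      · exact (mul_eq_zero.1 h).resolve_left (by norm_num)
      · exact absurd h this
    have e5 : algebraMap F L (a - x ^ 2 - y ^ 2 * c) = 0 := by
      rw [← e, mul_assoc 2, e4]; ring
    rw [map_eq_zero] at e5
    rw [← map_mul, map_eq_zero] at e4
    rcases mul_eq_zero.1 e4 with h | h
    · apply h2 (y * c)
      rw [h] at e5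
      rw [show ((a * c : 𝓞 F) : F) = a * c from map_mul (algebraMap (𝓞 F) F) a c]
      linear_combination -(c : F) * e5
    · apply h1 x
      rw [h] at e5
      linear_combination -e5
  | cons d l ih =>
    intro a h1 h2
    refine ⟨ih a h1.1 h2.1, ?_⟩
    rw [← map_mul]
    refine ih _ h1.2 ?_
    have := h2.2
    rwa [mul_right_comm] at this

lemma cheb2 (n : ℕ) : ∀ {F : Type u} [Field F] [NumberField F] (a : 𝓞 F) (l : List (𝓞 F)), l.length = n → indep a l →
    ∀ b : 𝓞 F, b ≠ 0 → ∃ r : Pl F, b ∉ r.asIdeal ∧ chi r a = 1 ∧ ∀ c ∈ l, chi r c = 0 := by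
  induction n with
  | zero =>
    intro F _ _ a l hl hi b hb
    rw [List.length_eq_zero_iff] at hl
    subst hl
    obtain ⟨r, h1, h2⟩ := cheb1 a hi b hb
    exact ⟨r, h1, h2, by simp⟩
  | succ n ih =>
    intro F _ _ a l hl hi b hb
    obtain ⟨c, l, rfl⟩ := List.exists_cons_of_length_eq_add_one hl
    simp only [List.length_cons, add_left_inj] at hl
    by_cases ns : ∀ x : F, x ^ 2 ≠ (c : F)
    · obtain ⟨L, _, _, _, β, Q⟩ := exists_QE c ns
      have ha0 : a ≠ 0 := indep_ne hi
      have hc0 : c ≠ 0 := by rintro rfl; exact ns 0 (by simp)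
      have hd : b * (2 * a * c) ≠ 0 := mul_ne_zero hb (mul_ne_zero (mul_ne_zero two_ne_zero ha0) hc0)
      have hd' : algebraMap (𝓞 F) (𝓞 L) (b * (2 * a * c)) ≠ 0 := by
        rw [Ne, map_eq_zero_iff _ am_inj]; exact hd
      obtain ⟨R, h1, h2, h3⟩ := ih (algebraMap (𝓞 F) (𝓞 L) a) (l.map (algebraMap (𝓞 F) (𝓞 L))) (by simpa using hl)
        (indep_up Q l a hi.1 hi.2) _ hd'
      rw [← mem_below] at h1
      have hbR : b ∉ (below F R).asIdeal := fun h => h1 (Ideal.mul_mem_right _ _ h)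
      have haR : a ∉ (below F R).asIdeal := fun h => h1 (by
        rw [show b * (2 * a * c) = (b * 2 * c) * a by ring]; exact Ideal.mul_mem_left _ _ h)
      have hcR : c ∉ (below F R).asIdeal := fun h => h1 (by
        rw [show b * (2 * a * c) = (b * 2 * a) * c by ring]; exact Ideal.mul_mem_left _ _ h)
      have h2c : 2 * c ∉ (below F R).asIdeal := fun h => h1 (by
        rw [show b * (2 * a * c) = (b * a) * (2 * c) by ring]; exact Ideal.mul_mem_left _ _ h)
      have up : ∀ x, chi (below F R) x = 0 → chi R (algebraMap (𝓞 F) (𝓞 L) x) = 0 := by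
        intro x hx
        rw [chi_zero_iff] at hx ⊢
        obtain ⟨y, hy⟩ := hx
        rw [mem_below, map_sub, map_pow] at hy
        exact ⟨_, hy⟩
      have ha1 : chi (below F R) a = 1 := by
        refine (zmod2 _).resolve_left fun h => ?_
        rw [up _ h] at h2; exact zero_ne_one h2
      have hc1 : chi (below F R) c = 0 := by
        refine (zmod2 _).resolve_right fun h => ?_
        have h4 := up (a * c) (by rw [chi_mul haR hcR, ha1, h]; decide)
        rw [map_mul, chi_mul (r := R) (fun h => haR h) (fun h => hcR h), ← Q.hβ, chi_sq, h2] at h4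
        revert h4; decide
      obtain ⟨y, hy⟩ := chi_zero_iff.1 hc1
      have hs := chi_surj R (Q.res_surj R hy h2c)
      refine ⟨below F R, hbR, ha1, fun x hx => ?_⟩
      rcases List.mem_cons.1 hx with rfl | hx
      · exact hc1
      · rw [← hs]
        exact h3 _ (List.mem_map_of_mem hx)
    · push Not at ns
      obtain ⟨x, hx⟩ := ns
      obtain ⟨y, hy⟩ := IsIntegrallyClosed.exists_algebraMap_eq_of_isIntegral_pow (R := 𝓞 F) (x := x) (n := 2) (by norm_num) (by rw [hx]; exact isIntegral_algebraMap)
      obtain ⟨r, h1, h2, h3⟩ := ih a l hl hi.1 b hb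
      refine ⟨r, h1, h2, fun z hz => ?_⟩
      rcases List.mem_cons.1 hz with rfl | hz
      · have : z = y ^ 2 := by
          apply RingOfIntegers.ext
          change (z : F) = algebraMap (𝓞 F) F (y ^ 2)
          rw [map_pow, hy, hx]
        rw [this, chi_sq]
      · exact h3 z hz

lemma indep_of {F : Type*} [Field F] [NumberField F] {ι : Type*} [Fintype ι] (e : ι → 𝓞 F)
    (ind : ∀ n : ι → ℕ, (∃ y : F, y ^ 2 = ((∏ i, e i ^ n i : 𝓞 F) : F)) → ∀ i, Even (n i)) (x : ι → ZMod 2)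
    (l : List (𝓞 F)) (hl : ∀ c ∈ l, ∃ n : ι → ℕ, c = ∏ i, e i ^ n i ∧ ∑ i, n i * x i = 0) :
    ∀ n : ι → ℕ, ∑ i, n i * x i = 1 → indep (∏ i, e i ^ n i) l := by
  induction l with
  | nil =>
    intro n hn y hy
    have := ind n ⟨y, hy⟩
    have h0 : ∑ i, (n i : ZMod 2) * x i = 0 := Finset.sum_eq_zero fun i _ => by
      rw [(ZMod.natCast_eq_zero_iff_even).2 (this i), zero_mul]
    rw [h0] at hn; exact zero_ne_one hn
  | cons c l ih =>
    intro n hn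
    have hl' := fun c hc => hl c (List.mem_cons_of_mem _ hc)
    refine ⟨ih hl' n hn, ?_⟩
    obtain ⟨m, rfl, hm⟩ := hl c List.mem_cons_self
    rw [← Finset.prod_mul_distrib]
    simp only [← pow_add]
    refine ih hl' (fun i => n i + m i) ?_
    simp only [Nat.cast_add, add_mul, Finset.sum_add_distrib, hn, hm, add_zero]

theorem cheb {F : Type u} [Field F] [NumberField F] {ι : Type*} [Fintype ι] (e : ι → 𝓞 F)
    (ind : ∀ n : ι → ℕ, (∃ y : F, y ^ 2 = ((∏ i, e i ^ n i : 𝓞 F) : F)) → ∀ i, Even (n i)) (x : ι → ZMod 2)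
    (hx : x ≠ 0) (b : 𝓞 F) (hb : b ≠ 0) :
    ∃ r : Pl F, b ∉ r.asIdeal ∧ (∀ i, e i ∉ r.asIdeal) ∧ ∀ i, chi r (e i) = x i := by
  obtain ⟨i₀, hi₀⟩ := Function.ne_iff.1 hx
  have hi₀ : x i₀ = 1 := (zmod2 _).resolve_left hi₀
  have he0 : ∀ i, e i ≠ 0 := by
    intro i h
    have := ind (fun j => if j = i then 1 else 0) ⟨0, by
      rw [Finset.prod_eq_zero (Finset.mem_univ i) (by simp [h])]; simp⟩ i
    simp at this
  let l : List (𝓞 F) := Finset.univ.toList.map fun i => e i * e i₀ ^ (x i).val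
  have hp : ∀ (i : ι) (k : ℕ), e i₀ ^ k = ∏ j, e j ^ (if j = i₀ then k else 0) := by
    intro i k; simp
  have h1 : indep (∏ j, e j ^ (if j = i₀ then 1 else 0)) l := by
    refine indep_of e ind x l ?_ _ ?_
    · intro c hc
      obtain ⟨i, -, rfl⟩ := List.mem_map.1 hc
      refine ⟨fun j => (if j = i then 1 else 0) + if j = i₀ then (x i).val else 0, ?_, ?_⟩
      · simp only [pow_add, Finset.prod_mul_distrib]
        simp
      · simp only [Nat.cast_add, add_mul, Finset.sum_add_distrib]
        simp [hi₀]
        generalize x i = t; revert t; decide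
    · simp [hi₀]
  obtain ⟨r, h2, h3, h4⟩ := cheb2 l.length (∏ j, e j ^ (if j = i₀ then 1 else 0)) l rfl h1 (b * ∏ i, e i)
    (mul_ne_zero hb (Finset.prod_ne_zero_iff.2 fun i _ => he0 i))
  have hei : ∀ i, e i ∉ r.asIdeal := fun i h => h2 (Ideal.mul_mem_left _ _ (Ideal.mem_of_dvd _ (Finset.dvd_prod_of_mem e (Finset.mem_univ i)) h))
  refine ⟨r, fun h => h2 (Ideal.mul_mem_right _ _ h), hei, fun i => ?_⟩
  have h5 := h4 _ (List.mem_map.2 ⟨i, by simp, rfl⟩)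
  rw [chi_mul (hei _) (fun h => hei _ (r.isPrime.mem_of_pow_mem _ h)), chi_pow (hei _)] at h5
  have h6 : chi r (e i₀) = 1 := by simpa using h3
  rw [h6] at h5
  simp at h5
  generalize x i = t at *
  generalize chi r (e i) = u at *
  revert h5 t u; decide
end cheb
end Sch

namespace Sch
set_option linter.unusedSectionVars false
section ub
variable (F : Type*) [Field F] [NumberField F]

noncomputable def ubas : Option (Fin (Units.rank F)) → (𝓞 F)ˣ
  | none => ((IsCyclic.exists_generator (α := Units.torsion F)).choose : (𝓞 F)ˣ)
  | some i => Units.fundSystem F i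

variable {F}
lemma ubas_ind (m : Option (Fin (Units.rank F)) → ℕ) (v : (𝓞 F)ˣ) (h : v ^ 2 = ∏ i, ubas F i ^ m i) (i) : Even (m i) := by
  let g : Units.torsion F := (IsCyclic.exists_generator (α := Units.torsion F)).choose
  have hg : ∀ x, x ∈ Subgroup.zpowers g := (IsCyclic.exists_generator (α := Units.torsion F)).choose_spec
  obtain ⟨⟨ζ, e⟩, hv, -⟩ := Units.exist_unique_eq_mul_prod F v
  dsimp only at hv
  have hu := (Units.exist_unique_eq_mul_prod F (v ^ 2)).unique
    (y₁ := (ζ ^ 2, fun i => 2 * e i)) (y₂ := (g ^ m none, fun i => (m (some i) : ℤ))) (by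
      rw [hv, mul_pow, ← Finset.prod_pow]
      simp only [zpow_mul, Subgroup.coe_pow]
      congr 1
      refine Finset.prod_congr rfl fun i _ => ?_
      rw [← zpow_natCast, ← zpow_mul, mul_comm, zpow_mul]; rfl) (by
      rw [h, Fintype.prod_option]
      simp only [zpow_natCast]
      rfl)
  rw [Prod.mk.injEq] at hu
  rcases i with _ | i
  · obtain ⟨k, hk⟩ := Subgroup.mem_zpowers_iff.1 (hg ζ)
    have h1 : g ^ ((m none : ℤ) - 2 * k) = 1 := by
      rw [zpow_sub, zpow_natCast, ← hu.1, mul_comm 2 k, zpow_mul, hk]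
      norm_cast
      simp
    have h2 : (orderOf g : ℤ) ∣ (m none : ℤ) - 2 * k := orderOf_dvd_iff_zpow_eq_one.2 h1
    have h3 : orderOf g = Nat.card (Units.torsion F) := orderOf_eq_card_of_forall_mem_zpowers hg
    have h4 : Even (orderOf g) := by
      rw [h3]; exact Units.even_torsionOrder F
    have h5 : (2 : ℤ) ∣ (m none : ℤ) - 2 * k := (by exact_mod_cast h4.two_dvd : (2 : ℤ) ∣ (orderOf g : ℤ)).trans h2
    rw [even_iff_two_dvd]; omega
  · have := congrFun hu.2 i
    rw [even_iff_two_dvd]; omega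

lemma supp_unit (S : Finset (Pl F)) (e : (𝓞 F)ˣ) : supp S (e : 𝓞 F) :=
  ⟨e.ne_zero, fun v hv => absurd (Ideal.eq_top_of_isUnit_mem _ hv e.isUnit) v.isPrime.ne_top⟩

lemma unit_notin (v : Pl F) (e : (𝓞 F)ˣ) : (e : 𝓞 F) ∉ v.asIdeal := fun hv =>
  absurd (Ideal.eq_top_of_isUnit_mem _ hv e.isUnit) v.isPrime.ne_top

lemma unit_root {e : (𝓞 F)ˣ} {x : F} (h : x ^ 2 = ((e : 𝓞 F) : F)) : ∃ v : (𝓞 F)ˣ, v ^ 2 = e := by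
  have hx : x ≠ 0 := by
    rintro rfl
    have := e.ne_zero
    apply this
    apply RingOfIntegers.ext
    simpa using h.symm
  obtain ⟨v, hv⟩ := exists_unit_of_ord hx (fun v => by
    have := ord_unit v e
    rw [← h, ord_pow] at this
    push_cast at this; omega)
  refine ⟨v, ?_⟩
  apply Units.ext
  apply RingOfIntegers.ext
  rw [← h, ← hv]
  exact map_pow (algebraMap (𝓞 F) F) _ _

lemma unit_sq (hodd : Odd (classNumber F)) (e : (𝓞 F)ˣ) (hpos : ∀ φ : F →+* ℝ, 0 < φ ((e : 𝓞 F) : F))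
    {ξ c : 𝓞 F} (h4 : (e : 𝓞 F) = ξ ^ 2 - 4 * c) : ∃ v : (𝓞 F)ˣ, v ^ 2 = e := by
  by_contra hcon
  obtain ⟨C, hC, hC', -⟩ := lemI hodd (S := ∅) (T := ∅) (α := (e : 𝓞 F))
    ⟨fun x hx => hcon (unit_root hx), hpos, by simp, fun v _ => unit_notin v e, ⟨ξ, c, h4⟩, by simp, by simp⟩
  rw [Finset.subset_empty] at hC
  simp [hC] at hC'

/-- units and generators -/
noncomputable def fam (S : Finset (Pl F)) : Option (Fin (Units.rank F)) ⊕ S → 𝓞 F :=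
  Sum.elim (fun i => (ubas F i : 𝓞 F)) (fun q => gen q.1)

lemma supp_fam (S : Finset (Pl F)) (i) : supp S (fam S i) := by
  rcases i with i | q
  · exact supp_unit _ _
  · refine ⟨gen_ne_zero q.1 (gen_spec q.1), fun v hv => ?_⟩
    have h := (ord_int_pos_iff v (gen_ne_zero q.1 (gen_spec q.1))).2 hv
    have h2 := ord_gen q.1 v (gen_spec q.1)
    change 0 < ord v ((gen q.1 : 𝓞 F) : F) at h
    rw [h2] at h
    split_ifs at h with h3
    · rw [h3]; exact q.2
    · simp at h

lemma fam_ind (hodd : Odd (classNumber F)) (S : Finset (Pl F)) (n : Option (Fin (Units.rank F)) ⊕ S → ℕ)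
    (h : ∃ y : F, y ^ 2 = ((∏ i, fam S i ^ n i : 𝓞 F) : F)) (i) : Even (n i) := by
  obtain ⟨y, hy⟩ := h
  have hU : (((∏ i, ubas F i ^ n (Sum.inl i) : (𝓞 F)ˣ) : 𝓞 F)) = ∏ i, (ubas F i : 𝓞 F) ^ n (Sum.inl i) := by
    push_cast; rfl
  have hy' : y ^ 2 = (((∏ i, ubas F i ^ n (Sum.inl i) : (𝓞 F)ˣ) : 𝓞 F) : F) * ∏ q : S, ((gen q.1 : 𝓞 F) : F) ^ n (Sum.inr q) := by
    rw [hy, Fintype.prod_sum_type, hU]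
    change algebraMap (𝓞 F) F _ = algebraMap (𝓞 F) F _ * ∏ q : S, (algebraMap (𝓞 F) F (gen q.1)) ^ n (Sum.inr q)
    rw [map_mul]
    congr 1
    rw [map_prod]
    exact Finset.prod_congr rfl fun q _ => map_pow _ _ _
  have hne : ∀ v : Pl F, ((gen v : 𝓞 F) : F) ≠ 0 := fun v => by
    simpa using gen_ne_zero v (gen_spec v)
  have hP : ∀ k : S → ℕ, ∏ q : S, ((gen q.1 : 𝓞 F) : F) ^ k q ≠ 0 := fun k =>
    Finset.prod_ne_zero_iff.2 fun q _ => pow_ne_zero _ (hne _)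
  have hinr : ∀ q : S, Even (n (Sum.inr q)) := by
    intro q
    have h1 := congrArg (ord q.1) hy'
    rw [ord_mul _ (by rw [RingOfIntegers.coe_ne_zero_iff]; exact Units.ne_zero _) (hP _), ord_unit, ord_pow, ord_prod _ _ _ (fun q _ => pow_ne_zero _ (hne _))] at h1
    simp only [ord_pow, ord_gen _ _ (gen_spec _)] at h1
    rw [Finset.sum_eq_single q (by
      intro b _ hb
      rw [if_neg (fun h => hb (Subtype.ext h.symm)), mul_zero]) (by simp)] at h1
    simp only [if_true, zero_add] at h1
    have h2 : Even ((n (Sum.inr q) : ℤ) * (classNumber F : ℤ)) := by rw [← h1]; simp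
    rw [Int.even_mul] at h2
    rcases h2 with h2 | h2
    · exact_mod_cast h2
    · rw [Int.even_coe_nat] at h2
      exact absurd hodd (Nat.not_odd_iff_even.2 h2)
  rcases i with i | q
  · choose k hk using hinr
    obtain ⟨v, hv⟩ := unit_root (e := ∏ i, ubas F i ^ n (Sum.inl i)) (x := y / ∏ q : S, ((gen q.1 : 𝓞 F) : F) ^ k q) (by
      rw [div_pow, hy', div_eq_iff (pow_ne_zero _ (hP _)), ← Finset.prod_pow]
      congr 1
      refine Finset.prod_congr rfl fun q _ => ?_
      rw [hk q, pow_add, sq])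
    exact ubas_ind (fun i => n (Sum.inl i)) v hv i
  · exact hinr q
end ub
end Sch

namespace Sch
set_option linter.unusedSectionVars false
section ray
variable {F : Type*} [Field F] [NumberField F]

def Qi (S : Finset (Pl F)) : Ideal (𝓞 F) := S.inf fun q => q.asIdeal

lemma mem_Qi {S : Finset (Pl F)} {x : 𝓞 F} : x ∈ Qi S ↔ ∀ q ∈ S, x ∈ q.asIdeal := by
  unfold Qi
  rw [Submodule.mem_finsetInf]

lemma Qi_ne (S : Finset (Pl F)) : Qi S ≠ ⊥ := by
  have h : ∏ q ∈ S, q.asIdeal ≤ Qi S := Ideal.prod_le_inf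
  intro h0
  rw [h0, le_bot_iff] at h
  exact Finset.prod_ne_zero_iff.2 (fun q _ => q.ne_bot) h

def md (S : Finset (Pl F)) : Ideal (𝓞 F) := Ideal.span {4} * Qi S

lemma mem_md {S : Finset (Pl F)} {x : 𝓞 F} : x ∈ md S ↔ ∃ t ∈ Qi S, 4 * t = x := Ideal.mem_span_singleton_mul

lemma md_ne (S : Finset (Pl F)) : md S ≠ ⊥ :=
  mul_ne_zero (by simp) (Qi_ne S)

instance (S : Finset (Pl F)) : Finite (𝓞 F ⧸ md S) := Ideal.finiteQuotientOfFreeOfNeBot _ (md_ne S)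
instance (S : Finset (Pl F)) : Finite (𝓞 F ⧸ md S)ˣ := inferInstance

lemma real_inj : Function.Injective (fun φ : F →+* ℝ => (⟨InfinitePlace.mk (Complex.ofRealHom.comp φ),
    ⟨_, by rw [ComplexEmbedding.isReal_iff]; ext x; simp, rfl⟩⟩ : {w : InfinitePlace F // w.IsReal})) := by
  intro φ ψ h
  have h1 := InfinitePlace.mk_eq_iff.1 (congrArg Subtype.val h)
  ext x
  have h2 : (φ x : ℂ) = ψ x := by
    rcases h1 with h1 | h1
    · exact RingHom.congr_fun h1 x
    · have := RingHom.congr_fun h1 x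
      simpa using this
  exact_mod_cast h2

instance : Finite (F →+* ℝ) := Finite.of_injective _ real_inj

lemma card_real : Nat.card (F →+* ℝ) ≤ InfinitePlace.nrRealPlaces F := by
  have := Nat.card_le_card_of_injective _ (real_inj (F := F))
  rwa [Nat.card_eq_fintype_card (α := {w : InfinitePlace F // w.IsReal})] at this

abbrev RG (S : Finset (Pl F)) := (𝓞 F ⧸ md S)ˣ × ((F →+* ℝ) → SignTypeˣ)

structure rep (S : Finset (Pl F)) (a : 𝓞 F) (g : RG S) : Prop where
  fst : (g.1 : 𝓞 F ⧸ md S) = Ideal.Quotient.mk (md S) a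
  snd : ∀ φ, (g.2 φ : SignType) = SignType.sign (φ (a : F))

lemma rep.mul {S : Finset (Pl F)} {a b : 𝓞 F} {g h : RG S} (hg : rep S a g) (hh : rep S b h) : rep S (a * b) (g * h) := by
  constructor
  · rw [map_mul, ← hg.fst, ← hh.fst]; rfl
  · intro φ
    rw [show ((a * b : 𝓞 F) : F) = a * b from map_mul (algebraMap (𝓞 F) F) a b, map_mul, sign_mul, ← hg.snd, ← hh.snd]; rfl

lemma rep.uniq {S : Finset (Pl F)} {a : 𝓞 F} {g h : RG S} (hg : rep S a g) (hh : rep S a h) : g = h := by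
  apply Prod.ext
  · apply Units.ext; rw [hg.fst, hh.fst]
  · funext φ; apply Units.ext; rw [hg.snd, hh.snd]

lemma rep_exists {S : Finset (Pl F)} {a : 𝓞 F} (ha : a ≠ 0) (h : ∀ v : Pl F, a ∈ v.asIdeal → v ∉ S ∧ 2 ∉ v.asIdeal) :
    ∃ g, rep S a g := by
  have hu : IsUnit (Ideal.Quotient.mk (md S) a) := by
    by_contra hcon
    have hI : Ideal.span {a} ⊔ md S ≠ ⊤ := by
      intro ht
      apply hcon
      obtain ⟨x, hx, y, hy, hxy⟩ := Submodule.mem_sup.1 ((Ideal.eq_top_iff_one _).1 ht)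
      obtain ⟨z, rfl⟩ := Ideal.mem_span_singleton'.1 hx
      refine IsUnit.of_mul_eq_one (Ideal.Quotient.mk (md S) z) ?_
      rw [← map_mul, ← map_one (Ideal.Quotient.mk (md S)), Ideal.Quotient.eq, ← hxy]
      convert Ideal.neg_mem_iff _ |>.2 hy using 1
      ring
    obtain ⟨M, hM, hle⟩ := Ideal.exists_le_maximal _ hI
    have haM : a ∈ M := hle (Ideal.mem_sup_left (Ideal.mem_span_singleton_self a))
    have hmd : md S ≤ M := le_sup_right.trans hle
    let v : Pl F := ⟨M, hM.isPrime, fun h0 => md_ne S (le_bot_iff.1 (h0 ▸ hmd))⟩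
    obtain ⟨h1, h2⟩ := h v haM
    rcases (Ideal.IsPrime.mul_le hM.isPrime).1 hmd with h3 | h3
    · rw [Ideal.span_singleton_le_iff_mem] at h3
      have h4 : (4 : 𝓞 F) = 2 ^ 2 := by norm_num
      rw [h4] at h3
      exact h2 (hM.isPrime.mem_of_pow_mem _ h3)
    · obtain ⟨q, hq, hqM⟩ := (Ideal.IsPrime.inf_le' hM.isPrime).1 h3
      have : q = v := IsDedekindDomain.HeightOneSpectrum.ext (q.isMaximal.eq_of_le hM.ne_top hqM)
      exact h1 (this ▸ hq)
  have hs : ∀ φ : F →+* ℝ, IsUnit (SignType.sign (φ (a : F))) := fun φ => by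
    rw [isUnit_iff_ne_zero, Ne, sign_eq_zero_iff, map_eq_zero]; simpa using ha
  exact ⟨(hu.unit, fun φ => (hs φ).unit), rfl, fun φ => rfl⟩

lemma unit_rep (S : Finset (Pl F)) (e : (𝓞 F)ˣ) : ∃ g, rep S (e : 𝓞 F) g :=
  rep_exists e.ne_zero (fun v hv => absurd hv (unit_notin v e))

noncomputable def eh (S : Finset (Pl F)) : (𝓞 F)ˣ →* RG S where
  toFun e := (unit_rep S e).choose
  map_one' := rep.uniq (unit_rep S 1).choose_spec ⟨by simp, fun φ => by simp⟩
  map_mul' x y := rep.uniq (unit_rep S (x * y)).choose_spec (by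
    rw [Units.val_mul]
    exact (unit_rep S x).choose_spec.mul (unit_rep S y).choose_spec)

lemma rep_eh (S : Finset (Pl F)) (e : (𝓞 F)ˣ) : rep S (e : 𝓞 F) (eh S e) := (unit_rep S e).choose_spec

def SQ (S : Finset (Pl F)) : Subgroup (RG S) := (powMonoidHom 2 : RG S →* RG S).range
noncomputable def HH (S : Finset (Pl F)) : Subgroup (RG S) := SQ S ⊔ (eh S).range

/-- primary modulo `4 Qi S` -/
def prim (S : Finset (Pl F)) (a : 𝓞 F) : Prop :=
  (∃ ξ c, a = ξ ^ 2 - 4 * c ∧ ∀ q ∈ S, c ∈ q.asIdeal) ∧ ∀ φ : F →+* ℝ, 0 < φ (a : F)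

lemma prim_of_SQ {S : Finset (Pl F)} {a : 𝓞 F} {g : RG S} (h : rep S a g) (hg : g ∈ SQ S) : prim S a := by
  obtain ⟨x, rfl⟩ := hg
  constructor
  · obtain ⟨ξ, hξ⟩ := Ideal.Quotient.mk_surjective (x.1 : 𝓞 F ⧸ md S)
    have h1 := h.fst
    change ((x.1 : 𝓞 F ⧸ md S)) ^ 2 = _ at h1
    rw [← hξ, ← map_pow, Ideal.Quotient.eq] at h1
    obtain ⟨t, ht, h2⟩ := mem_md.1 h1
    exact ⟨ξ, t, by rw [h2]; ring, mem_Qi.1 ht⟩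
  · intro φ
    have h1 := h.snd φ
    change ((x.2 φ : SignType)) ^ 2 = _ at h1
    rw [← sign_eq_one_iff, ← h1]
    have : ∀ u : SignTypeˣ, (u : SignType) ^ 2 = 1 := by decide
    exact this _

lemma prim_of_HH {S : Finset (Pl F)} {a : 𝓞 F} {g : RG S} (h : rep S a g) (hg : g ∈ HH S) : ∃ e : (𝓞 F)ˣ, prim S (e * a) := by
  obtain ⟨y, hy, z, ⟨e, rfl⟩, rfl⟩ := Subgroup.mem_sup.1 hg
  refine ⟨e⁻¹, prim_of_SQ ((rep_eh S e⁻¹).mul h) ?_⟩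
  rw [mul_comm y, ← mul_assoc, ← map_mul, inv_mul_cancel, map_one, one_mul]
  exact hy

lemma norm_nat (k : ℕ) : Ideal.absNorm (Ideal.span {(k : 𝓞 F)}) = k ^ Module.finrank ℚ F := by
  rw [Ideal.absNorm_span_singleton]
  have : (k : 𝓞 F) = algebraMap ℤ (𝓞 F) k := by simp
  rw [this, Algebra.norm_algebraMap, RingOfIntegers.rank, Int.natAbs_pow, Int.natAbs_natCast]

lemma card_tors (S : Finset (Pl F)) : Nat.card {x : (𝓞 F ⧸ md S)ˣ // x ^ 2 = 1} ≤ 2 ^ S.card * 2 ^ Module.finrank ℚ F := by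
  have hle : md S ≤ Ideal.span {2} * Qi S := by
    refine Ideal.mul_mono_left ?_
    rw [Ideal.span_singleton_le_iff_mem, Ideal.mem_span_singleton]
    exact ⟨2, by norm_num⟩
  let f := Ideal.Quotient.factor hle
  have hf : Function.Surjective f := Ideal.Quotient.factor_surjective hle
  let K := f.toAddMonoidHom.ker
  have hK : Nat.card K = 2 ^ Module.finrank ℚ F := by
    have h1 := AddSubgroup.card_mul_index K
    have ht : f.toAddMonoidHom.range = ⊤ := AddMonoidHom.range_eq_top.2 hf
    rw [AddSubgroup.index_ker, ht, AddSubgroup.card_top] at h1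
    change _ * Submodule.cardQuot _ = Submodule.cardQuot _ at h1
    rw [← Ideal.absNorm_apply, ← Ideal.absNorm_apply] at h1
    have hm : Ideal.absNorm (md S) = Ideal.absNorm (Ideal.span {(4 : 𝓞 F)}) * Ideal.absNorm (Qi S) := map_mul _ _ _
    rw [hm, map_mul] at h1
    have e4 := norm_nat (F := F) 4
    have e2 := norm_nat (F := F) 2
    rw [Nat.cast_ofNat] at e4 e2
    rw [e4, e2] at h1
    have h0 : 0 < Ideal.absNorm (Qi S) := Nat.pos_of_ne_zero (by rw [Ne, Ideal.absNorm_eq_zero_iff]; exact Qi_ne S)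
    have e : (4 : ℕ) ^ Module.finrank ℚ F = 2 ^ Module.finrank ℚ F * 2 ^ Module.finrank ℚ F := by
      rw [← mul_pow]; norm_num
    rw [e, ← mul_assoc] at h1
    exact Nat.eq_of_mul_eq_mul_right (by positivity) (Nat.eq_of_mul_eq_mul_right h0 h1)
  have hy : ∀ x : {x : (𝓞 F ⧸ md S)ˣ // x ^ 2 = 1}, ∃ y : 𝓞 F, Ideal.Quotient.mk (md S) (1 + 2 * y) = x.1 ∧ y * (y + 1) ∈ Qi S := by
    rintro ⟨x, hx⟩
    obtain ⟨a, ha⟩ := Ideal.Quotient.mk_surjective (x : 𝓞 F ⧸ md S)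
    have h1 : a ^ 2 - 1 ∈ md S := by
      rw [← Ideal.Quotient.eq, map_pow, ha, map_one]
      exact congrArg Units.val hx
    obtain ⟨t, ht, h2⟩ := mem_md.1 h1
    have h2' : (4 : F) * t = a ^ 2 - 1 := by
      have := congrArg (algebraMap (𝓞 F) F) h2
      rw [map_mul, map_sub, map_pow, map_one, map_ofNat] at this
      exact this
    have hint : IsIntegral (𝓞 F) (((a : F) - 1) / 2) := by
      refine ⟨Polynomial.X ^ 2 + (Polynomial.X - Polynomial.C t), ?_, ?_⟩
      · refine Polynomial.monic_X_pow_add ?_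
        exact (Polynomial.degree_X_sub_C_le t).trans_lt (by norm_num)
      · simp only [Polynomial.eval₂_add, Polynomial.eval₂_sub, Polynomial.eval₂_pow, Polynomial.eval₂_X, Polynomial.eval₂_C]
        change _ + (_ - (t : F)) = 0
        linear_combination (-1/4 : F) * h2'
    obtain ⟨y, hy⟩ := IsIntegrallyClosed.isIntegral_iff.1 hint
    have hya : 1 + 2 * y = a := by
      apply RingOfIntegers.ext
      change algebraMap (𝓞 F) F (1 + 2 * y) = _
      rw [map_add, map_mul, map_one, map_ofNat, hy]; ring
    refine ⟨y, by rw [hya]; exact ha, ?_⟩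
    have : y * (y + 1) = t := by
      have : (4 : 𝓞 F) * (y * (y + 1)) = 4 * t := by rw [h2, ← hya]; ring
      exact mul_left_cancel₀ (by norm_num) this
    rw [this]; exact ht
  choose y hy1 hy2 using hy
  let σ : {x : (𝓞 F ⧸ md S)ˣ // x ^ 2 = 1} → S.powerset := fun x =>
    ⟨S.filter fun q => y x ∈ q.asIdeal, Finset.mem_powerset.2 (Finset.filter_subset _ _)⟩
  have hdiff : ∀ x x', σ x = σ x' → (x.1 : 𝓞 F ⧸ md S) - x'.1 ∈ K := by
    intro x x' h
    have hq : y x - y x' ∈ Qi S := by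
      rw [mem_Qi]
      intro q hq
      have h1 : y x ∈ q.asIdeal ↔ y x' ∈ q.asIdeal := by
        have := Finset.ext_iff.1 (congrArg Subtype.val h) q
        simpa [σ, hq] using this
      by_cases h2 : y x ∈ q.asIdeal
      · exact Ideal.sub_mem _ h2 (h1.1 h2)
      · have h3 := (q.isPrime.mem_or_mem (mem_Qi.1 (hy2 x) q hq)).resolve_left h2
        have h4 := (q.isPrime.mem_or_mem (mem_Qi.1 (hy2 x') q hq)).resolve_left (fun h => h2 (h1.2 h))
        convert Ideal.sub_mem _ h3 h4 using 1
        ring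
    rw [← hy1, ← hy1, ← map_sub]
    change f (Ideal.Quotient.mk (md S) _) = 0
    rw [Ideal.Quotient.factor_mk, Ideal.Quotient.eq_zero_iff_mem, Ideal.mem_span_singleton_mul]
    exact ⟨_, hq, by ring⟩
  have hc : Nat.card (S.powerset × K) = 2 ^ S.card * 2 ^ Module.finrank ℚ F := by
    rw [Nat.card_prod, hK, Nat.card_eq_fintype_card, Fintype.card_coe, Finset.card_powerset]
  rw [← hc]
  have : Finite K := inferInstance
  let b : S.powerset → {x : (𝓞 F ⧸ md S)ˣ // x ^ 2 = 1} := fun s => if h : ∃ x, σ x = s then h.choose else ⟨1, by simp⟩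
  have hb : ∀ x, σ (b (σ x)) = σ x := by
    intro x
    have h : ∃ x', σ x' = σ x := ⟨x, rfl⟩
    simp only [b, dif_pos h]
    exact h.choose_spec
  refine Nat.card_le_card_of_injective (fun x => (σ x, (⟨(x.1 : 𝓞 F ⧸ md S) - (b (σ x)).1, hdiff _ _ (hb x).symm⟩ : K))) ?_
  intro x x' h
  rw [Prod.mk.injEq] at h
  have h2 := congrArg Subtype.val h.2
  dsimp only at h2
  rw [h.1] at h2
  exact Subtype.ext (Units.ext (sub_left_injective h2))

lemma index_HH (hodd : Odd (classNumber F)) (S : Finset (Pl F)) : (HH S).index ≤ 2 ^ (Fintype.card (InfinitePlace F) + S.card) := by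
  set n := Fintype.card (InfinitePlace F) with hn
  have hG : Finite (RG S) := inferInstance
  have h1 : (SQ S).index = Nat.card (powMonoidHom 2 : RG S →* RG S).ker := by
    have a := Subgroup.card_mul_index (powMonoidHom 2 : RG S →* RG S).ker
    have b := Subgroup.card_mul_index (SQ S)
    rw [Subgroup.index_ker] at a
    change Nat.card (powMonoidHom 2 : RG S →* RG S).range * _ = _ at b
    rw [← a, mul_comm] at b
    exact Nat.eq_of_mul_eq_mul_right Nat.card_pos b
  have h2 : Nat.card (powMonoidHom 2 : RG S →* RG S).ker ≤ 2 ^ (2 * n + S.card) := by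
    have := Nat.card_le_card_of_injective (fun x : (powMonoidHom 2 : RG S →* RG S).ker =>
      ((⟨x.1.1, congrArg Prod.fst x.2⟩, x.1.2) : {x : (𝓞 F ⧸ md S)ˣ // x ^ 2 = 1} × ((F →+* ℝ) → SignTypeˣ))) (by
        intro x x' h
        rw [Prod.mk.injEq] at h
        exact Subtype.ext (Prod.ext (congrArg Subtype.val h.1) h.2))
    refine this.trans ?_
    have e2 : Nat.card SignTypeˣ = 2 := by rw [Nat.card_eq_fintype_card]; decide
    rw [Nat.card_prod, Nat.card_fun, e2]
    have h3 := InfinitePlace.card_add_two_mul_card_eq_rank F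
    have h4 := InfinitePlace.card_eq_nrRealPlaces_add_nrComplexPlaces F
    calc _ ≤ (2 ^ S.card * 2 ^ Module.finrank ℚ F) * 2 ^ InfinitePlace.nrRealPlaces F :=
          Nat.mul_le_mul (card_tors S) (Nat.pow_le_pow_right (by norm_num) card_real)
      _ = _ := by rw [← pow_add, ← pow_add]; congr 1; omega
  have h3 : 2 ^ n ≤ (SQ S).relIndex (HH S) := by
    have hF : Finite (HH S ⧸ (SQ S).subgroupOf (HH S)) := inferInstance
    let pu : Finset (Option (Fin (Units.rank F))) → (𝓞 F)ˣ := fun A => ∏ i, ubas F i ^ (if i ∈ A then 1 else 0)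
    have := Nat.card_le_card_of_injective (fun A : Finset (Option (Fin (Units.rank F))) =>
      (QuotientGroup.mk ⟨eh S (pu A), (le_sup_right : _ ≤ HH S) ⟨_, rfl⟩⟩ : HH S ⧸ (SQ S).subgroupOf (HH S))) (by
        intro A B h
        rw [QuotientGroup.eq, Subgroup.mem_subgroupOf] at h
        change (eh S (pu A))⁻¹ * eh S (pu B) ∈ SQ S at h
        have h2 : eh S (pu A * pu B) ∈ SQ S := by
          have : eh S (pu A * pu B) = eh S (pu A) ^ 2 * ((eh S (pu A))⁻¹ * eh S (pu B)) := by
            rw [map_mul, sq]; group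
          rw [this]
          exact mul_mem ⟨_, rfl⟩ h
        obtain ⟨⟨ξ, c, hc, -⟩, hp⟩ := prim_of_SQ (rep_eh S _) h2
        obtain ⟨v, hv⟩ := unit_sq hodd _ hp hc
        have h3 := ubas_ind (fun i => (if i ∈ A then 1 else 0) + if i ∈ B then 1 else 0) v (by
          rw [hv]; simp only [pu, pow_add, Finset.prod_mul_distrib])
        ext i
        have := h3 i
        by_cases ha : i ∈ A <;> by_cases hb : i ∈ B <;> simp [ha, hb] at this ⊢)
    have hc : Nat.card (Finset (Option (Fin (Units.rank F)))) = 2 ^ n := by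
      rw [Nat.card_eq_fintype_card, Fintype.card_finset, Fintype.card_option, Fintype.card_fin, rank_add_one]
    rw [hc] at this
    exact this
  have h4 := Subgroup.relIndex_mul_index (show SQ S ≤ HH S from le_sup_left)
  rw [h1] at h4
  have h5 : 2 ^ n * (HH S).index ≤ 2 ^ n * 2 ^ (n + S.card) := by
    calc _ ≤ (SQ S).relIndex (HH S) * (HH S).index := Nat.mul_le_mul_right _ h3
      _ ≤ 2 ^ (2 * n + S.card) := by rw [h4]; exact h2
      _ = _ := by rw [← pow_add]; congr 1; omega
  exact Nat.le_of_mul_le_mul_left h5 (by positivity)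
end ray
end Sch

namespace Sch
set_option linter.unusedSectionVars false
section core
variable {F : Type*} [Field F] [NumberField F]

lemma Qi_mono {S S0 : Finset (Pl F)} (h : S ⊆ S0) : Qi S0 ≤ Qi S := fun _ hx =>
  mem_Qi.2 fun q hq => mem_Qi.1 hx q (h hq)

lemma md_mono {S S0 : Finset (Pl F)} (h : S ⊆ S0) : md S0 ≤ md S := Ideal.mul_mono_right (Qi_mono h)

noncomputable def rho {S S0 : Finset (Pl F)} (h : S ⊆ S0) : RG S0 →* RG S :=
  MonoidHom.prodMap (Units.map (Ideal.Quotient.factor (md_mono h) : _ →* _)) (MonoidHom.id _)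

lemma rep_rho {S S0 : Finset (Pl F)} (h : S ⊆ S0) {a : 𝓞 F} {g : RG S0} (hg : rep S0 a g) : rep S a (rho h g) := by
  constructor
  · change Ideal.Quotient.factor (md_mono h) (g.1 : 𝓞 F ⧸ md S0) = _
    rw [hg.fst, Ideal.Quotient.factor_mk]
  · exact hg.snd

lemma rho_HH {S S0 : Finset (Pl F)} (h : S ⊆ S0) : HH S0 ≤ (HH S).comap (rho h) := by
  refine sup_le ?_ ?_
  · rintro _ ⟨x, rfl⟩
    rw [Subgroup.mem_comap, powMonoidHom_apply, map_pow]
    generalize rho h x = y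
    exact (le_sup_left : SQ S ≤ HH S) ⟨y, rfl⟩
  · rintro _ ⟨e, rfl⟩
    rw [Subgroup.mem_comap]
    refine (le_sup_right : (eh S).range ≤ HH S) ⟨e, ?_⟩
    exact (rep_eh S e).uniq (rep_rho h (rep_eh S0 e))

lemma sq_HH (S : Finset (Pl F)) (g : RG S) : g ^ 2 ∈ HH S := (le_sup_left : SQ S ≤ HH S) ⟨g, rfl⟩

lemma datT (hodd : Odd (classNumber F)) {S T : Finset (Pl F)} {a : 𝓞 F} (ha : a ≠ 0)
    (hT : ∀ v, ord v (a : F) = if v ∈ T then (classNumber F : ℤ) else 0) (hne : T.Nonempty) (hd : Disjoint S T)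
    (e : (𝓞 F)ˣ) (hp : prim S (e * a)) : Dat S T (e * a) := by
  have ho : ∀ v, ord v ((e * a : 𝓞 F) : F) = if v ∈ T then (classNumber F : ℤ) else 0 := by
    intro v
    rw [show ((e * a : 𝓞 F) : F) = (e : 𝓞 F) * a from map_mul (algebraMap (𝓞 F) F) _ a,
      ord_mul v (by rw [RingOfIntegers.coe_ne_zero_iff]; exact e.ne_zero) (by rwa [RingOfIntegers.coe_ne_zero_iff]), ord_unit, zero_add, hT]
  have h0 : (e * a : 𝓞 F) ≠ 0 := mul_ne_zero e.ne_zero ha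
  obtain ⟨⟨ξ, c, h1, h2⟩, h3⟩ := hp
  refine ⟨?_, h3, ?_, ?_, ⟨ξ, c, h1⟩, fun q hq => ⟨ξ, c, h1, h2 q hq⟩, hd⟩
  · intro x hx
    obtain ⟨t, ht⟩ := hne
    have := ho t
    rw [← hx, ord_pow, if_pos ht] at this
    obtain ⟨k, hk⟩ := hodd
    push_cast at this
    omega
  · intro v hv
    rw [ho, if_pos hv]; exact_mod_cast hodd
  · intro v hv
    rw [← ord_int_eq_zero_iff v h0, ho, if_neg hv]

theorem core (hodd : Odd (classNumber F)) {S S0 : Finset (Pl F)} (hS : S ⊆ S0) (hlt : S.card < S0.card)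
    (r : (Option (Fin (Units.rank F)) ⊕ S0 → ZMod 2) → Pl F) (a : (Option (Fin (Units.rank F)) ⊕ S0 → ZMod 2) → 𝓞 F)
    (h1 : ∀ x ≠ 0, (r x).asIdeal ^ classNumber F = Ideal.span {a x})
    (h2 : ∀ x ≠ 0, r x ∉ S0) (h3 : ∀ x ≠ 0, 2 ∉ (r x).asIdeal) (h4 : ∀ x ≠ 0, ∀ i, chi (r x) (fam S0 i) = x i) :
    ∃ x ≠ 0, ∃ e : (𝓞 F)ˣ, prim S (e * a x) := by
  have hord : ∀ x ≠ 0, ∀ v, ord v (a x : F) = if v = r x then (classNumber F : ℤ) else 0 := fun x hx v => ord_gen _ _ (h1 x hx)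
  have ha : ∀ x ≠ 0, a x ≠ 0 := fun x hx => gen_ne_zero _ (h1 x hx)
  have hg : ∀ x, ∃ g : RG S0, (x = 0 → g = 1) ∧ (x ≠ 0 → rep S0 (a x) g) := by
    intro x
    by_cases hx : x = 0
    · exact ⟨1, fun _ => rfl, fun h => absurd hx h⟩
    · obtain ⟨g, hg⟩ := rep_exists (S := S0) (ha x hx) (fun v hv => by
        have := (ord_int_pos_iff v (ha x hx)).2 hv
        change 0 < ord v (a x : F) at this
        rw [hord x hx] at this
        split_ifs at this with h
        · exact h ▸ ⟨h2 x hx, h3 x hx⟩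
        · simp at this)
      exact ⟨g, fun h => absurd h hx, fun _ => hg⟩
  choose g hg0 hg1 using hg
  -- one element
  have one : ∀ x ≠ 0, g x ∉ HH S0 := by
    intro x hx hm
    obtain ⟨e, he⟩ := prim_of_HH (hg1 x hx) hm
    obtain ⟨C, hC, hC', h⟩ := lemI hodd (datT hodd (T := {r x}) (ha x hx) (by simpa using hord x hx) (by simp) (by simpa using h2 x hx) e he)
    have : C = {r x} := (Finset.subset_singleton_iff.1 hC).resolve_left hC'.ne_empty
    apply hx
    funext i
    have := h _ (supp_fam S0 i)
    rw [‹C = _›, Finset.sum_singleton, h4 x hx] at this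
    exact this
  have two : ∀ x ≠ 0, ∀ y ≠ 0, x ≠ y → g x * g y ∉ HH S0 := by
    intro x hx y hy hxy hm
    have hr : r x ≠ r y := by
      intro h
      apply hxy
      funext i
      rw [← h4 x hx, ← h4 y hy, h]
    obtain ⟨e, he⟩ := prim_of_HH ((hg1 x hx).mul (hg1 y hy)) hm
    obtain ⟨C, hC, hC', h⟩ := lemI hodd (datT hodd (T := {r x, r y}) (mul_ne_zero (ha x hx) (ha y hy)) (by
      intro v
      rw [show ((a x * a y : 𝓞 F) : F) = a x * a y from map_mul (algebraMap (𝓞 F) F) _ _,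
        ord_mul v (by rw [RingOfIntegers.coe_ne_zero_iff]; exact ha x hx) (by rw [RingOfIntegers.coe_ne_zero_iff]; exact ha y hy),
        hord x hx, hord y hy]
      by_cases e1 : v = r x
      · have e2 : v ≠ r y := fun h => hr (e1.symm.trans h)
        simp [e1, hr]
      · by_cases e2 : v = r y
        · simp [e2, hr.symm]
        · simp [e1, e2]) (by simp) (by
          rw [Finset.disjoint_right]
          intro v hv
          rcases Finset.mem_insert.1 hv with rfl | hv
          · exact h2 x hx
          · rw [Finset.mem_singleton.1 hv]; exact h2 y hy) e he)
    have hs : ∀ i, (if r x ∈ C then x i else 0) + (if r y ∈ C then y i else 0) = 0 := by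
      intro i
      have := h _ (supp_fam S0 i)
      rw [← Finset.inter_eq_right.2 hC, ← Finset.sum_ite_mem, Finset.sum_pair hr, h4 x hx, h4 y hy] at this
      exact this
    by_cases e1 : r x ∈ C <;> by_cases e2 : r y ∈ C <;> simp only [e1, e2, if_true, if_false, add_zero, zero_add] at hs
    · apply hxy
      funext i
      have := hs i
      rwa [CharTwo.add_eq_zero] at this
    · exact hx (funext hs)
    · exact hy (funext hs)
    · obtain ⟨c, hc⟩ := hC'
      rcases Finset.mem_insert.1 (hC hc) with rfl | h
      · exact e1 hc
      · rw [Finset.mem_singleton] at h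
        exact e2 (h ▸ hc)
  let f : (Option (Fin (Units.rank F)) ⊕ S0 → ZMod 2) → RG S0 ⧸ HH S0 := fun x => QuotientGroup.mk (g x)
  have hinj : Function.Injective f := by
    intro x y hxy
    by_contra hne
    have h := QuotientGroup.eq.1 hxy
    have h' : g x * g y ∈ HH S0 := by
      have := mul_mem (sq_HH S0 (g x)) h
      have e : g x ^ 2 * ((g x)⁻¹ * g y) = g x * g y := by rw [sq]; group
      rwa [e] at this
    by_cases hx : x = 0
    · have hy : y ≠ 0 := fun h => hne (hx.trans h.symm)
      rw [hg0 x hx, one_mul] at h'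
      exact one y hy h'
    · by_cases hy : y = 0
      · rw [hg0 y hy, mul_one] at h'
        exact one x hx h'
      · exact two x hx y hy hne h'
  have hcard : Nat.card (Option (Fin (Units.rank F)) ⊕ S0 → ZMod 2) = 2 ^ (Fintype.card (InfinitePlace F) + S0.card) := by
    rw [Nat.card_eq_fintype_card, Fintype.card_fun, ZMod.card, Fintype.card_sum, Fintype.card_option, Fintype.card_fin, rank_add_one, Fintype.card_coe]
  have hsurj : Function.Surjective f := by
    have hle : Nat.card (RG S0 ⧸ HH S0) ≤ Nat.card (Option (Fin (Units.rank F)) ⊕ S0 → ZMod 2) := by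
      rw [hcard]; exact index_HH hodd S0
    exact (hinj.bijective_of_nat_card_le hle).2
  obtain ⟨x, y, hxy, hne⟩ : ∃ x y, (QuotientGroup.mk (rho hS (g x)) : RG S ⧸ HH S) = QuotientGroup.mk (rho hS (g y)) ∧ x ≠ y := by
    by_contra! hcon
    have := Nat.card_le_card_of_injective (fun x => (QuotientGroup.mk (rho hS (g x)) : RG S ⧸ HH S)) (fun x y h => hcon x y h)
    have h5 : Nat.card (RG S ⧸ HH S) ≤ _ := index_HH hodd S
    rw [hcard] at this
    have h6 := (Nat.pow_le_pow_iff_right (by norm_num : 1 < 2)).1 (this.trans h5)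
    omega
  obtain ⟨z, hz⟩ := hsurj (QuotientGroup.mk ((g x)⁻¹ * g y))
  have hz' := QuotientGroup.eq.1 hz
  have hz0 : z ≠ 0 := by
    intro h
    rw [hg0 z h, inv_one, one_mul] at hz'
    exact hne (hinj (QuotientGroup.eq.2 hz'))
  refine ⟨z, hz0, prim_of_HH (rep_rho hS (hg1 z hz0)) ?_⟩
  have e1 := rho_HH hS hz'
  rw [Subgroup.mem_comap, map_mul, map_mul, map_inv, map_inv] at e1
  have e2 := QuotientGroup.eq.1 hxy
  rwa [Subgroup.mul_mem_cancel_right _ e2, inv_mem_iff] at e1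
end core
end Sch

namespace Sch
set_option linter.unusedSectionVars false
section lemR
variable {F : Type*} [Field F] [NumberField F]

lemma chi_prod {ι : Type*} {r : Pl F} (s : Finset ι) (f : ι → 𝓞 F) (h : ∀ i ∈ s, f i ∉ r.asIdeal) :
    ∏ i ∈ s, f i ∉ r.asIdeal ∧ chi r (∏ i ∈ s, f i) = ∑ i ∈ s, chi r (f i) := by
  induction s using Finset.induction_on with
  | empty => simpa using ⟨fun h1 => r.isPrime.ne_top ((Ideal.eq_top_iff_one _).2 h1), chi_one' r⟩
  | insert a s ha ih =>
    obtain ⟨h1, h2⟩ := ih fun i hi => h i (Finset.mem_insert_of_mem hi)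
    have h3 := h a (Finset.mem_insert_self a s)
    rw [Finset.prod_insert ha, Finset.sum_insert ha]
    exact ⟨fun hm => (r.isPrime.mem_or_mem hm).elim h3 h1, by rw [chi_mul h3 h1, h2]⟩

lemma pow_notin {r : Pl F} {a : 𝓞 F} (h : a ∉ r.asIdeal) (n : ℕ) : a ^ n ∉ r.asIdeal :=
  fun hm => h (r.isPrime.mem_of_pow_mem n hm)

lemma gen_mem {v w : Pl F} : gen v ∈ w.asIdeal → w = v := by
  intro h
  have h0 := gen_ne_zero v (gen_spec v)
  have h1 := (ord_int_pos_iff w h0).2 h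
  have h2 := ord_gen v w (gen_spec v)
  rw [h2] at h1
  split_ifs at h1 with h3
  · exact h3
  · simp at h1

lemma chi_fact (hodd : Odd (classNumber F)) (p : Pl F) (hu : ∀ e : (𝓞 F)ˣ, chi p (e : 𝓞 F) = 0) {s : 𝓞 F} (hs : s ∉ p.asIdeal) (h0 : s ≠ 0) :
    chi p s = ∑ v ∈ (mem_finite h0).toFinset, ((ord v (s : F)).toNat : ZMod 2) * chi p (gen v) := by
  set T := (mem_finite h0).toFinset with hT
  have hgne : ∀ v : Pl F, ((gen v : 𝓞 F) : F) ≠ 0 := fun v => by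
    simpa using gen_ne_zero v (gen_spec v)
  have hs0 : (s : F) ≠ 0 := by simpa using h0
  have hP : ((∏ v ∈ T, gen v ^ (ord v (s : F)).toNat : 𝓞 F) : F) = ∏ v ∈ T, ((gen v : 𝓞 F) : F) ^ (ord v (s : F)).toNat := by
    change algebraMap (𝓞 F) F _ = ∏ v ∈ T, (algebraMap (𝓞 F) F (gen v)) ^ (ord v (s : F)).toNat
    rw [map_prod]
    exact Finset.prod_congr rfl fun v _ => map_pow _ _ _
  have hP0 : ∏ v ∈ T, ((gen v : 𝓞 F) : F) ^ (ord v (s : F)).toNat ≠ 0 := Finset.prod_ne_zero_iff.2 fun v _ => pow_ne_zero _ (hgne v)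
  obtain ⟨e, he⟩ := exists_unit_of_ord (x := (s : F) ^ classNumber F / ∏ v ∈ T, ((gen v : 𝓞 F) : F) ^ (ord v (s : F)).toNat)
    (div_ne_zero (pow_ne_zero _ hs0) hP0) (fun w => by
      rw [ord_div _ (pow_ne_zero _ hs0) hP0, ord_pow, ord_prod _ _ _ (fun v _ => pow_ne_zero _ (hgne v))]
      simp only [ord_pow, ord_gen _ _ (gen_spec _), mul_ite, mul_zero, Finset.sum_ite_eq]
      split_ifs with h
      · rw [Int.toNat_of_nonneg (ord_int_nonneg w s)]; ring
      · have : s ∉ w.asIdeal := by simpa [hT] using h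
        rw [(ord_int_eq_zero_iff w h0).2 this]; simp)
  have key : s ^ classNumber F = e * ∏ v ∈ T, gen v ^ (ord v (s : F)).toNat := by
    apply RingOfIntegers.ext
    change algebraMap (𝓞 F) F _ = algebraMap (𝓞 F) F _
    rw [map_pow, map_mul]
    change (s : F) ^ classNumber F = ((e : 𝓞 F) : F) * ((∏ v ∈ T, gen v ^ (ord v (s : F)).toNat : 𝓞 F) : F)
    rw [he, hP, div_mul_cancel₀ _ hP0]
  have hgp : ∀ v ∈ T, gen v ∉ p.asIdeal := by
    intro v hv h
    rw [← gen_mem h] at hv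
    exact hs (by simpa [hT] using hv)
  obtain ⟨h1, h2⟩ := chi_prod T (fun v => gen v ^ (ord v (s : F)).toNat) (fun v hv => pow_notin (hgp v hv) _)
  have h3 := congrArg (chi p) key
  rw [chi_pow hs, chi_mul (unit_notin p e) h1, hu, zero_add, h2] at h3
  have h4 : ((classNumber F : ℕ) : ZMod 2) = 1 := by
    obtain ⟨k, hk⟩ := hodd
    rw [hk]; push_cast
    rw [show (2 : ZMod 2) = 0 from rfl]; ring
  rw [h4, one_mul] at h3
  rw [h3]
  exact Finset.sum_congr rfl fun v hv => chi_pow (hgp v hv) _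

lemma exists_nonres (p : Pl F) (h2 : 2 ∉ p.asIdeal) : ∃ a, a ∉ p.asIdeal ∧ chi p a = 1 := by
  let _ : Field (𝓞 F ⧸ p.asIdeal) := @Ideal.Quotient.field _ _ p.asIdeal p.isMaximal
  have : Finite (𝓞 F ⧸ p.asIdeal) := Ideal.finiteQuotientOfFreeOfNeBot _ p.ne_bot
  have hc : ringChar (𝓞 F ⧸ p.asIdeal) ≠ 2 := by
    intro h
    apply h2
    have := ringChar.Nat.cast_ringChar (R := 𝓞 F ⧸ p.asIdeal)
    rw [h] at this
    rw [← Ideal.Quotient.eq_zero_iff_mem]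
    rw [← this, Nat.cast_ofNat, map_ofNat]
  obtain ⟨b, hb⟩ := FiniteField.exists_nonsquare hc
  obtain ⟨a, rfl⟩ := Ideal.Quotient.mk_surjective b
  refine ⟨a, fun h => hb ?_, chi_one_iff.2 fun h => hb (res_sq.1 h)⟩
  rw [Ideal.Quotient.eq_zero_iff_mem.2 h]
  exact ⟨0, by simp⟩

lemma fresh_notin {S : Finset (Pl F)} {r : Pl F} (h : (∏ q ∈ S, gen q) ∉ r.asIdeal) : r ∉ S := by
  intro hr
  apply h
  refine Ideal.mem_of_dvd _ (Finset.dvd_prod_of_mem _ hr) ?_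
  have h0 := gen_ne_zero r (gen_spec r)
  rw [← ord_int_pos_iff r h0, ord_gen r r (gen_spec r), if_pos rfl]
  exact_mod_cast classNumber_pos F

lemma lemR1 (hodd : Odd (classNumber F)) {p q : Pl F} {π : 𝓞 F} (hqp : q ≠ p) (hπ : p.asIdeal ^ classNumber F = Ideal.span {π})
    (hpos : ∀ φ : F →+* ℝ, 0 < φ (π : F)) {ξ c : 𝓞 F} (h : π = ξ ^ 2 - 4 * c) (hc : c ∈ q.asIdeal) : chi p (gen q) = 0 := by
  obtain ⟨C, hC, hC', h⟩ := lemI hodd (datT hodd (S := {q}) (T := {p}) (gen_ne_zero p hπ) (fun v => by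
    rw [ord_gen p v hπ]; simp) (by simp) (by simpa using hqp) 1 (by
      rw [Units.val_one, one_mul]
      exact ⟨⟨ξ, c, h, by simpa using hc⟩, hpos⟩))
  have : C = {p} := (Finset.subset_singleton_iff.1 hC).resolve_left hC'.ne_empty
  have := h (gen q) ⟨gen_ne_zero q (gen_spec q), fun v hv => by simpa using gen_mem hv⟩
  rwa [‹C = _›, Finset.sum_singleton] at this

lemma two_inv {π ξ c e ξ' c' : 𝓞 F} {p : Pl F} {n : ℕ} (hπ : p.asIdeal ^ n = Ideal.span {π}) (h2 : 2 ∉ p.asIdeal)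
    (h : π = ξ ^ 2 - 4 * c) (h' : e * π = ξ' ^ 2 - 4 * c') : ∃ x y, e = x ^ 2 - 4 * y := by
  have hc : IsCoprime π (4 : 𝓞 F) := by
    rw [← Ideal.isCoprime_span_singleton_iff, ← hπ]
    refine IsCoprime.pow_left ?_
    rw [Ideal.isCoprime_iff_sup_eq]
    refine p.isMaximal.eq_of_le (J := p.asIdeal ⊔ Ideal.span {4}) |> fun H => ?_
    by_contra hne
    have := H hne le_sup_left
    have h4 : (4 : 𝓞 F) ∈ p.asIdeal := by
      rw [this]; exact Ideal.mem_sup_right (Ideal.mem_span_singleton_self _)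
    rw [show (4 : 𝓞 F) = 2 ^ 2 by norm_num] at h4
    exact h2 (p.isPrime.mem_of_pow_mem _ h4)
  obtain ⟨a, b, hab⟩ := hc
  -- `a π + 4 b = 1`; `e = e (aπ+4b)^2 = (eπ) π a² + ...`
  refine ⟨ξ' * ξ * a, ?_⟩
  have : (4 : 𝓞 F) ∣ (ξ' * ξ * a) ^ 2 - e := by
    refine ⟨c' * ξ ^ 2 * a ^ 2 + c * (e * π) * a ^ 2 - e * b * (1 + a * π), ?_⟩
    linear_combination (-a^2*ξ^2) * h' - a^2 * e*π*h + e * (1 + a * π) * hab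
  obtain ⟨y, hy⟩ := this
  exact ⟨y, by rw [← hy]; ring⟩

theorem lemR2 (hodd : Odd (classNumber F)) {p q : Pl F} {π : 𝓞 F} (hqp : q ≠ p) (h2 : 2 ∉ p.asIdeal)
    (hu : ∀ e : (𝓞 F)ˣ, chi p (e : 𝓞 F) = 0) (hπ : p.asIdeal ^ classNumber F = Ideal.span {π})
    (hpos : ∀ φ : F →+* ℝ, 0 < φ (π : F)) {ξ c : 𝓞 F} (h : π = ξ ^ 2 - 4 * c) (hq : chi p (gen q) = 0) :
    ∃ ξ c, π = ξ ^ 2 - 4 * c ∧ c ∈ q.asIdeal := by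
  obtain ⟨n, hn, hn1⟩ := exists_nonres p h2
  have hn0 : n ≠ 0 := by rintro rfl; exact hn (Ideal.zero_mem _)
  obtain ⟨q1, hq1p, hq1⟩ : ∃ q1 : Pl F, q1 ≠ p ∧ chi p (gen q1) = 1 := by
    rw [chi_fact hodd p hu hn hn0] at hn1
    obtain ⟨v, hv, hv'⟩ := Finset.exists_ne_zero_of_sum_ne_zero (by rw [hn1]; exact one_ne_zero)
    refine ⟨v, ?_, (zmod2 _).resolve_left (right_ne_zero_of_mul hv')⟩
    rintro rfl
    exact hn (by simpa using hv)
  have hne : q ≠ q1 := by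
    rintro rfl
    rw [hq] at hq1
    exact zero_ne_one hq1
  let S0 : Finset (Pl F) := {q, q1}
  let x1 : Option (Fin (Units.rank F)) ⊕ S0 → ZMod 2 := fun i => chi p (fam S0 i)
  have hpS : p ∉ S0 := by simp [S0, hqp.symm, hq1p.symm]
  have hx : ∀ x : Option (Fin (Units.rank F)) ⊕ S0 → ZMod 2, ∃ r : Pl F, ∃ a : 𝓞 F, (x ≠ 0 → r.asIdeal ^ classNumber F = Ideal.span {a} ∧
      r ∉ S0 ∧ 2 ∉ r.asIdeal ∧ ∀ i, chi r (fam S0 i) = x i) ∧ (x = x1 → a = π) := by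
    intro x
    by_cases hx1 : x = x1
    · exact ⟨p, π, fun _ => ⟨hπ, hpS, h2, fun i => by rw [hx1]⟩, fun _ => rfl⟩
    · by_cases hx0 : x = 0
      · exact ⟨p, π, fun h => absurd hx0 h, fun _ => rfl⟩
      · obtain ⟨r, hr1, hr2, hr3⟩ := cheb (fam S0) (fam_ind hodd S0) x hx0 (2 * ∏ q ∈ S0, gen q) (mul_ne_zero two_ne_zero
          (Finset.prod_ne_zero_iff.2 fun v _ => gen_ne_zero v (gen_spec v)))
        exact ⟨r, gen r, fun _ => ⟨gen_spec r, fresh_notin fun h => hr1 (Ideal.mul_mem_left _ _ h),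
          fun h => hr1 (Ideal.mul_mem_right _ _ h), hr3⟩, fun h => absurd h hx1⟩
  choose r a hr har using hx
  obtain ⟨x, hx0, e, he⟩ := core hodd (S := {q}) (S0 := S0) (by simp [S0]) (by simp [S0, hne]) r a (fun x hx => (hr x hx).1)
    (fun x hx => (hr x hx).2.1) (fun x hx => (hr x hx).2.2.1) (fun x hx => (hr x hx).2.2.2)
  obtain ⟨g1, g2, g3, g4⟩ := hr x hx0
  obtain ⟨C, hC, hC', hz⟩ := lemI hodd (datT hodd (T := {r x}) (gen_ne_zero _ g1) (fun v => by rw [ord_gen _ v g1]; simp) (by simp) (by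
    have : r x ≠ q := fun h => g2 (by rw [h]; simp [S0])
    simpa using this.symm) e he)
  rw [(Finset.subset_singleton_iff.1 hC).resolve_left hC'.ne_empty] at hz
  simp only [Finset.sum_singleton] at hz
  have z1 : ∀ i, x (Sum.inl i) = 0 := fun i => by
    rw [← g4]; exact hz _ (supp_unit _ (ubas F i))
  have hqm : q ∈ S0 := by simp [S0]
  have hqm1 : q1 ∈ S0 := by simp [S0]
  have z2 : x (Sum.inr ⟨q, hqm⟩) = 0 := by
    rw [← g4]; exact hz (gen q) ⟨gen_ne_zero q (gen_spec q), fun v hv => by simpa using gen_mem hv⟩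
  have z3 : x (Sum.inr ⟨q1, hqm1⟩) = 1 := by
    refine (zmod2 _).resolve_left fun h0 => hx0 ?_
    funext i
    rcases i with i | ⟨v, hv⟩
    · exact z1 i
    · rcases Finset.mem_insert.1 hv with rfl | hv'
      · exact z2
      · obtain rfl := Finset.mem_singleton.1 hv'
        exact h0
  have hxx : x = x1 := by
    funext i
    rcases i with i | ⟨v, hv⟩
    · rw [z1 i]; exact (hu (ubas F i)).symm
    · rcases Finset.mem_insert.1 hv with rfl | hv'
      · rw [z2]; exact hq.symm
      · obtain rfl := Finset.mem_singleton.1 hv'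
        rw [z3]; exact hq1.symm
  rw [har x hxx] at he
  obtain ⟨⟨ξ', c', h', hc'⟩, hp'⟩ := he
  obtain ⟨s, t, hst⟩ := two_inv hπ h2 h h'
  obtain ⟨v, hv⟩ := unit_sq hodd e (fun φ => by
    have := hp' φ
    rw [show ((e * π : 𝓞 F) : F) = (e : 𝓞 F) * π from map_mul (algebraMap (𝓞 F) F) _ π, map_mul] at this
    exact pos_of_mul_pos_left this (hpos φ).le) hst
  have hvi : ((v⁻¹ : (𝓞 F)ˣ) : 𝓞 F) * v = 1 := by simp
  have hv' : (e : 𝓞 F) = (v : 𝓞 F) ^ 2 := by rw [← hv]; simp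
  refine ⟨(v⁻¹ : (𝓞 F)ˣ) * ξ', (v⁻¹ : (𝓞 F)ˣ) ^ 2 * c', ?_, Ideal.mul_mem_left _ _ (hc' q (by simp))⟩
  rw [hv'] at h'
  linear_combination ((v⁻¹ : (𝓞 F)ˣ) : 𝓞 F) ^ 2 * h' - π * (((v⁻¹ : (𝓞 F)ˣ) : 𝓞 F) * v + 1) * hvi
end lemR
end Sch

namespace Sch
set_option linter.unusedSectionVars false
section two
variable {F L : Type*} [Field F] [NumberField F] [Field L] [NumberField L] [Algebra F L]
variable {α : 𝓞 F} {β : 𝓞 L}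

lemma QE.res_surj' (Q : QE F L α β) (w : Pl L) {ξ c : 𝓞 F} (h : α = ξ ^ 2 - 4 * c)
    (hα : α ∉ (below F w).asIdeal) (hc : c ∈ (below F w).asIdeal) (z : 𝓞 L) : ∃ x, z - algebraMap (𝓞 F) (𝓞 L) x ∈ w.asIdeal := by
  obtain ⟨θ, -, h1, h2, h3, -⟩ := Q.theta h
  obtain ⟨a, ha⟩ : ∃ a, θ - algebraMap (𝓞 F) (𝓞 L) a ∈ w.asIdeal := by
    rw [mem_below, ← h3] at hc
    rcases w.isPrime.mem_or_mem hc with hc | hc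
    · exact ⟨0, by simpa using hc⟩
    · refine ⟨ξ, ?_⟩
      rw [← h1]
      convert Ideal.neg_mem_iff _ |>.2 hc using 1
      ring
  obtain ⟨u, hu⟩ := Q.fixed_int (z := (z - Q.τ z) * β) (by
    rw [map_mul, map_sub, Q.ττ, Q.τβ]; ring)
  have hα' := Q.hβ
  have hτ : Q.τ θ = θ - β := by linear_combination -h2
  obtain ⟨x, hx⟩ := Q.fixed_int (z := algebraMap (𝓞 F) (𝓞 L) α * z - algebraMap (𝓞 F) (𝓞 L) u * θ) (by
    rw [map_sub, map_mul, map_mul, Q.τ_am, Q.τ_am, hu, hτ, ← hα']; ring)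
  obtain ⟨e, he⟩ := exists_inv _ hα
  rw [mem_below, map_sub, map_mul, map_one] at he
  refine ⟨e * (x + u * a), ?_⟩
  rw [map_mul, map_add, map_mul, hx]
  have h5 := Ideal.sub_mem _ (Ideal.mul_mem_left _ (algebraMap (𝓞 F) (𝓞 L) e * algebraMap (𝓞 F) (𝓞 L) u) ha) (Ideal.mul_mem_left _ z he)
  convert h5 using 1
  ring

lemma form_unit (w : Pl L) {ξ c : 𝓞 L} (hno : ∀ t : 𝓞 L, t ^ 2 + ξ * t + c ∉ w.asIdeal) {t : L} (ht : t ≠ 0 → 0 ≤ ord w t) :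
    t ^ 2 + ξ * t + c ≠ 0 ∧ ord w (t ^ 2 + ξ * t + c) = 0 := by
  obtain ⟨a, b, hb, hab⟩ : ∃ a b : 𝓞 L, b ∉ w.asIdeal ∧ t * b = a := by
    by_cases h : t = 0
    · exact ⟨0, 1, fun h1 => w.isPrime.ne_top ((Ideal.eq_top_iff_one _).2 h1), by simp [h]⟩
    · exact exists_frac w h (ht h)
  have hb0 : b ≠ 0 := by rintro rfl; exact hb (Ideal.zero_mem _)
  have hn : a ^ 2 + ξ * a * b + c * b ^ 2 ∉ w.asIdeal := by
    intro hm
    obtain ⟨e, he⟩ := exists_inv w hb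
    apply hno (a * e)
    have h1 := Ideal.mul_mem_left _ (e ^ 2) hm
    have h2 := Ideal.mul_mem_left _ (ξ * a * e + c * (b * e + 1)) he
    convert Ideal.sub_mem _ h1 h2 using 1
    ring
  have hn0 : a ^ 2 + ξ * a * b + c * b ^ 2 ≠ 0 := fun h => hn (h ▸ Ideal.zero_mem _)
  have e1 : ((a ^ 2 + ξ * a * b + c * b ^ 2 : 𝓞 L) : L) = (t ^ 2 + ξ * t + c) * (b : L) ^ 2 := by
    have : ((a ^ 2 + ξ * a * b + c * b ^ 2 : 𝓞 L) : L) = (a : L) ^ 2 + ξ * a * b + c * (b : L) ^ 2 := by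
      change algebraMap (𝓞 L) L _ = _
      simp only [map_add, map_mul, map_pow]
    rw [this, ← hab]; ring
  have hb' : (b : L) ≠ 0 := by simpa using hb0
  have h0 : t ^ 2 + ξ * t + c ≠ 0 := by
    intro h
    rw [h, zero_mul] at e1
    exact hn0 (RingOfIntegers.ext (e1.trans (map_zero (algebraMap (𝓞 L) L)).symm))
  refine ⟨h0, ?_⟩
  have e2 := (ord_int_eq_zero_iff w hn0).2 hn
  rw [e1, ord_mul w h0 (pow_ne_zero _ hb'), ord_pow, (ord_int_eq_zero_iff w hb0).2 hb] at e2
  simpa using e2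

lemma form_even (w : Pl L) {ξ c : 𝓞 L} (hno : ∀ t : 𝓞 L, t ^ 2 + ξ * t + c ∉ w.asIdeal) (U V : L) :
    Even (ord w (U ^ 2 + ξ * U * V + c * V ^ 2)) := by
  by_cases hV : V = 0
  · rw [hV]
    simp only [mul_zero, add_zero, ne_eq, OfNat.ofNat_ne_zero, not_false_eq_true, zero_pow, ord_pow]
    push_cast
    exact even_two_mul _
  by_cases hUV : U ≠ 0 ∧ ord w U < ord w V
  · obtain ⟨hU, hlt⟩ := hUV
    have hz : V / U ≠ 0 := div_ne_zero hV hU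
    have hz' : 0 < ord w (V / U) := by rw [ord_div w hV hU]; omega
    have e : U ^ 2 + ξ * U * V + c * V ^ 2 = U ^ 2 * (1 + (V / U) * (ξ + c * (V / U))) := by
      field_simp
      ring
    rw [e]
    have h1 : (1 : L) + (V / U) * (ξ + c * (V / U)) ≠ 0 ∧ ord w (1 + (V / U) * (ξ + c * (V / U))) = 0 := by
      by_cases hk : (ξ : L) + c * (V / U) = 0
      · rw [hk, mul_zero, add_zero]; exact ⟨one_ne_zero, ord_one w⟩
      · have h2 : 0 ≤ ord w ((ξ : L) + c * (V / U)) := by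
          obtain ⟨a, b, hb, hab⟩ := exists_frac w hz hz'.le
          have hb0 : b ≠ 0 := by rintro rfl; exact hb (Ideal.zero_mem _)
          have e1 : ((ξ * b + c * a : 𝓞 L) : L) = ((ξ : L) + c * (V / U)) * b := by
            have : ((ξ * b + c * a : 𝓞 L) : L) = (ξ : L) * b + c * a := by
              change algebraMap (𝓞 L) L _ = _
              simp only [map_add, map_mul]
            rw [this, ← hab]; ring
          have e2 := ord_int_nonneg w (ξ * b + c * a)
          rw [e1, ord_mul w hk (by simpa using hb0), (ord_int_eq_zero_iff w hb0).2 hb] at e2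
          simpa using e2
        have h3 : ord w (1 : L) < ord w ((V / U) * ((ξ : L) + c * (V / U))) := by
          rw [ord_one, ord_mul w hz hk]; omega
        have h4 := ord_add_eq w one_ne_zero (mul_ne_zero hz hk) h3
        refine ⟨?_, by rw [h4, ord_one]⟩
        intro h5
        have h6 : (V / U) * ((ξ : L) + c * (V / U)) = -1 := by linear_combination h5
        rw [h6, ord_neg] at h3
        exact lt_irrefl _ h3
    rw [ord_mul w (pow_ne_zero _ hU) h1.1, h1.2, ord_pow, add_zero]
    push_cast
    exact even_two_mul _
  · have ht : U / V ≠ 0 → 0 ≤ ord w (U / V) := by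
      intro h
      have hU : U ≠ 0 := fun h0 => h (by rw [h0, zero_div])
      have : ¬ ord w U < ord w V := fun h => hUV ⟨hU, h⟩
      rw [ord_div w hU hV]; omega
    obtain ⟨h1, h2⟩ := form_unit w hno ht
    have e : U ^ 2 + ξ * U * V + c * V ^ 2 = V ^ 2 * ((U / V) ^ 2 + ξ * (U / V) + c) := by
      field_simp
    rw [e, ord_mul w (pow_ne_zero _ hV) h1, h2, ord_pow, add_zero]
    push_cast
    exact even_two_mul _

lemma QE.even_ord (Q : QE F L α β) (w : Pl L) {ξ c : 𝓞 F} (h : α = ξ ^ 2 - 4 * c)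
    (hα : α ∉ (below F w).asIdeal) (hc : c ∈ (below F w).asIdeal) {α₂ ξ₂ c₂ : 𝓞 F} (h2 : α₂ = ξ₂ ^ 2 - 4 * c₂)
    (hno : ¬ ∃ ξ c, α₂ = ξ ^ 2 - 4 * c ∧ c ∈ (below F w).asIdeal) (X Y : L) :
    Even (ord w (X ^ 2 - algebraMap F L (α₂ : F) * Y ^ 2)) := by
  have hno' : ∀ t : 𝓞 L, t ^ 2 + algebraMap (𝓞 F) (𝓞 L) ξ₂ * t + algebraMap (𝓞 F) (𝓞 L) c₂ ∉ w.asIdeal := by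
    intro t ht
    obtain ⟨x, hx⟩ := Q.res_surj' w h hα hc t
    refine hno ⟨ξ₂ + 2 * x, x ^ 2 + ξ₂ * x + c₂, by rw [h2]; ring, ?_⟩
    rw [mem_below]
    simp only [map_add, map_mul, map_pow]
    have h5 := Ideal.sub_mem _ ht (Ideal.mul_mem_left _ (t + algebraMap (𝓞 F) (𝓞 L) x + algebraMap (𝓞 F) (𝓞 L) ξ₂) hx)
    convert h5 using 1
    ring
  have h3 := form_even w hno' (X - algebraMap F L (ξ₂ : F) * Y) (2 * Y)
  have h4 : algebraMap F L (α₂ : F) = (algebraMap F L (ξ₂ : F)) ^ 2 - 4 * algebraMap F L (c₂ : F) := by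
    rw [h2]
    change algebraMap F L (algebraMap (𝓞 F) F _) = (algebraMap F L (algebraMap (𝓞 F) F _)) ^ 2 - 4 * algebraMap F L (algebraMap (𝓞 F) F _)
    rw [map_sub, map_mul, map_pow, map_ofNat, map_sub, map_mul, map_pow, map_ofNat]
  rw [coe_am, coe_am] at h3
  convert h3 using 2
  rw [h4]; ring
end two

section half
variable {F L M : Type*} [Field F] [NumberField F] [Field L] [NumberField L] [Algebra F L]
  [Field M] [NumberField M] [Algebra F M]
variable {α α₂ : 𝓞 F} {β : 𝓞 L} {β₂ : 𝓞 M}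

lemma half (Q : QE F L α β) (Q₂ : QE F M α₂ β₂) (ε : (𝓞 L)ˣ) (ε₂ : (𝓞 M)ˣ) {γ : 𝓞 L} {δ : 𝓞 M} {n₁ n₂ d e s t₁ t₂ : 𝓞 F}
    (hn1 : algebraMap (𝓞 F) (𝓞 L) n₁ = γ * Q.τ γ) (hn2 : algebraMap (𝓞 F) (𝓞 M) n₂ = δ * Q₂.τ δ)
    (hd : n₂ = d ^ 2 - α₂) (he : algebraMap (𝓞 F) (𝓞 L) e = ε * Q.τ ε) (he2 : algebraMap (𝓞 F) (𝓞 M) e = ε₂ * Q₂.τ ε₂)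
    (ht1 : algebraMap (𝓞 F) (𝓞 L) t₁ = ε * γ ^ 2 + Q.τ (ε * γ ^ 2)) (ht2 : algebraMap (𝓞 F) (𝓞 M) t₂ = ε₂ * δ ^ 2 + Q₂.τ (ε₂ * δ ^ 2))
    (hs : s = n₂ * t₁ + n₁ * t₂) (hs0 : s ≠ 0) (hγ : γ ≠ 0) (hn20 : n₂ ≠ 0) (q : Pl F) {ξ c : 𝓞 F} (h : α = ξ ^ 2 - 4 * c)
    (hα : α ∉ q.asIdeal) (hc : c ∈ q.asIdeal) {ξ₂ c₂ : 𝓞 F} (h2 : α₂ = ξ₂ ^ 2 - 4 * c₂)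
    (hno : ¬ ∃ ξ c, α₂ = ξ ^ 2 - 4 * c ∧ c ∈ q.asIdeal) : Even (ord q (s : F)) := by
  obtain ⟨w, rfl⟩ := exists_above (L := L) q
  obtain ⟨x, y, hxy⟩ := Q₂.coords ((ε₂ * δ ^ 2 * algebraMap (𝓞 F) (𝓞 M) n₁ : 𝓞 M) : M)
  have hnorm : x ^ 2 - (α₂ : F) * y ^ 2 = (e : F) * (n₁ : F) ^ 2 * (n₂ : F) ^ 2 := by
    have h1 := Q₂.norm_eq x y
    rw [← hxy, ← Q₂.coe_τ] at h1
    have h3 : (ε₂ * δ ^ 2 * algebraMap (𝓞 F) (𝓞 M) n₁ : 𝓞 M) * Q₂.τ (ε₂ * δ ^ 2 * algebraMap (𝓞 F) (𝓞 M) n₁) =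
        algebraMap (𝓞 F) (𝓞 M) (e * n₁ ^ 2 * n₂ ^ 2) := by
      simp only [map_mul, map_pow, Q₂.τ_am, he2, hn2]; ring
    have h4 := congrArg (algebraMap (𝓞 M) M) h3
    rw [map_mul] at h4
    have h5 := h1.symm.trans h4
    have h6 := (algebraMap F M).injective (h5.trans (coe_am (L := M) (e * n₁ ^ 2 * n₂ ^ 2)))
    rw [h6]
    change algebraMap (𝓞 F) F _ = _
    simp only [map_mul, map_pow]
  have htr : (n₁ : F) * t₂ = 2 * x := by
    have h3 : algebraMap (𝓞 F) (𝓞 M) (n₁ * t₂) = (ε₂ * δ ^ 2 * algebraMap (𝓞 F) (𝓞 M) n₁ : 𝓞 M) + Q₂.τ (ε₂ * δ ^ 2 * algebraMap (𝓞 F) (𝓞 M) n₁) := by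
      rw [map_mul, ht2, map_mul Q₂.τ _ (algebraMap (𝓞 F) (𝓞 M) n₁), Q₂.τ_am]; ring
    have h4 := congrArg (algebraMap (𝓞 M) M) h3
    rw [map_add] at h4
    have h5 : algebraMap F M ((n₁ * t₂ : 𝓞 F) : F) = ((ε₂ * δ ^ 2 * algebraMap (𝓞 F) (𝓞 M) n₁ : 𝓞 M) : M) + Q₂.σ ((ε₂ * δ ^ 2 * algebraMap (𝓞 F) (𝓞 M) n₁ : 𝓞 M) : M) := h4
    rw [hxy, map_add, map_mul, Q₂.σβ, AlgEquiv.commutes, AlgEquiv.commutes] at h5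
    have h6 : algebraMap F M ((n₁ * t₂ : 𝓞 F) : F) = algebraMap F M (2 * x) := by
      rw [h5, map_mul, map_ofNat]; ring
    rw [← (algebraMap F M).injective h6]
    exact (map_mul (algebraMap (𝓞 F) F) _ _).symm
  set A : 𝓞 L := ε * γ ^ 2 * algebraMap (𝓞 F) (𝓞 L) n₂ with hA
  have hAn : A * Q.τ A = algebraMap (𝓞 F) (𝓞 L) (e * n₁ ^ 2 * n₂ ^ 2) := by
    simp only [hA, map_mul, map_pow, Q.τ_am, he, hn1]; ring
  have hAs : A * algebraMap (𝓞 F) (𝓞 L) s = A ^ 2 + algebraMap (𝓞 F) (𝓞 L) (e * n₁ ^ 2 * n₂ ^ 2) + A * algebraMap (𝓞 F) (𝓞 L) (n₁ * t₂) := by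
    rw [← hAn, hs, map_add, map_mul _ n₂ t₁, ht1, hA, map_mul Q.τ _ (algebraMap (𝓞 F) (𝓞 L) n₂), Q.τ_am]; ring
  have hAs' : (A : L) * algebraMap F L (s : F) = ((A : L) + algebraMap F L x) ^ 2 - algebraMap F L (α₂ : F) * (algebraMap F L y) ^ 2 := by
    have h3 : (A : L) * algebraMap F L (s : F) = (A : L) ^ 2 + algebraMap F L ((e * n₁ ^ 2 * n₂ ^ 2 : 𝓞 F) : F) + A * algebraMap F L ((n₁ * t₂ : 𝓞 F) : F) := by
      have := congrArg (algebraMap (𝓞 L) L) hAs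
      rw [map_mul, map_add, map_add, map_pow, map_mul] at this
      exact this
    have e1 : ((e * n₁ ^ 2 * n₂ ^ 2 : 𝓞 F) : F) = x ^ 2 - (α₂ : F) * y ^ 2 := by
      rw [hnorm]
      change algebraMap (𝓞 F) F _ = _
      simp only [map_mul, map_pow]
    have e2 : ((n₁ * t₂ : 𝓞 F) : F) = 2 * x := (map_mul (algebraMap (𝓞 F) F) _ _).trans htr
    rw [h3, e1, e2]
    simp only [map_sub, map_mul, map_pow, map_ofNat]
    ring
  have o1 := Q.even_ord w h hα hc h2 hno ((A : L) + algebraMap F L x) (algebraMap F L y)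
  have o2 := Q.even_ord w h hα hc h2 hno (algebraMap F L (d : F)) 1
  have hn2F : algebraMap F L (n₂ : F) = (algebraMap F L (d : F)) ^ 2 - algebraMap F L (α₂ : F) * 1 ^ 2 := by
    rw [hd]
    change algebraMap F L (algebraMap (𝓞 F) F _) = (algebraMap F L (algebraMap (𝓞 F) F _)) ^ 2 - algebraMap F L (algebraMap (𝓞 F) F _) * 1 ^ 2
    simp only [map_sub, map_pow, one_pow, mul_one]
  have hsF : algebraMap F L (s : F) ≠ 0 := by
    rw [Ne, map_eq_zero, ← Ne, RingOfIntegers.coe_ne_zero_iff]; exact hs0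
  have hnF : algebraMap F L (n₂ : F) ≠ 0 := by
    rw [Ne, map_eq_zero, ← Ne, RingOfIntegers.coe_ne_zero_iff]; exact hn20
  have hγF : (γ : L) ≠ 0 := by rw [RingOfIntegers.coe_ne_zero_iff]; exact hγ
  have hεF : ((ε : 𝓞 L) : L) ≠ 0 := by rw [RingOfIntegers.coe_ne_zero_iff]; exact ε.ne_zero
  have hAF : (A : L) = ((ε : 𝓞 L) : L) * (γ : L) ^ 2 * algebraMap F L (n₂ : F) := by
    change algebraMap (𝓞 L) L A = _
    rw [hA, map_mul, map_mul, map_pow]; rfl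
  rw [← hAs', hAF, ord_mul w (mul_ne_zero (mul_ne_zero hεF (pow_ne_zero _ hγF)) hnF) hsF, ord_mul w (mul_ne_zero hεF (pow_ne_zero _ hγF)) hnF,
    ord_mul w hεF (pow_ne_zero _ hγF), ord_unit, ord_pow, ord_ext w (s : F), Q.ram_one h w hα] at o1
  rw [← hn2F] at o2
  obtain ⟨a, ha⟩ := o1
  obtain ⟨b, hb⟩ := o2
  rw [hb] at ha
  push_cast at ha
  exact ⟨a - b - ord w (γ : L), by linarith⟩
end half
end Sch

namespace Sch
set_option linter.unusedSectionVars false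
section fin
variable {F L M : Type*} [Field F] [NumberField F] [Field L] [NumberField L] [Algebra F L]
  [Field M] [NumberField M] [Algebra F M]
variable {α α₂ : 𝓞 F} {β : 𝓞 L} {β₂ : 𝓞 M}

lemma sym_iff {r : Pl F} (hN : Odd (Ideal.absNorm r.asIdeal)) {a : 𝓞 F} (ha : a ∉ r.asIdeal) :
    2 ∉ r.asIdeal ∧ (quadResSym F r.asIdeal a = 1 ↔ chi r a = 0) := by
  let _ : Field (𝓞 F ⧸ r.asIdeal) := @Ideal.Quotient.field _ _ r.asIdeal r.isMaximal
  have : Finite (𝓞 F ⧸ r.asIdeal) := Ideal.finiteQuotientOfFreeOfNeBot _ r.ne_bot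
  let _ : Fintype (𝓞 F ⧸ r.asIdeal) := Fintype.ofFinite _
  have hcard : Ideal.absNorm r.asIdeal = Fintype.card (𝓞 F ⧸ r.asIdeal) := by
    rw [Ideal.absNorm_apply, Submodule.cardQuot_apply, Nat.card_eq_fintype_card]
  have hc : ringChar (𝓞 F ⧸ r.asIdeal) ≠ 2 := by
    intro h
    rw [FiniteField.even_card_iff_char_two, ← hcard] at h
    obtain ⟨k, hk⟩ := hN
    omega
  constructor
  · intro h
    apply Ring.two_ne_zero hc
    rw [← Ideal.Quotient.eq_zero_iff_mem, map_ofNat] at h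
    exact h
  · have ha' : Ideal.Quotient.mk r.asIdeal a ≠ 0 := by rwa [Ne, Ideal.Quotient.eq_zero_iff_mem]
    rw [chi_zero_iff, res_sq, FiniteField.isSquare_iff hc ha', ← hcard]
    have e : (Ideal.absNorm r.asIdeal - 1) / 2 = Ideal.absNorm r.asIdeal / 2 := by
      obtain ⟨k, hk⟩ := hN
      omega
    unfold quadResSym
    rw [e, ← map_pow, ← map_one (Ideal.Quotient.mk r.asIdeal), Ideal.Quotient.eq]
    split_ifs with h <;> simp [h]

structure PD (p : Pl F) (π : 𝓞 F) : Prop where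
  two : 2 ∉ p.asIdeal
  hu : ∀ e : (𝓞 F)ˣ, chi p (e : 𝓞 F) = 0
  hg : p.asIdeal ^ classNumber F = Ideal.span {π}
  pos : ∀ φ : F →+* ℝ, 0 < φ (π : F)
  four : ∃ ξ c : 𝓞 F, π = ξ ^ 2 - 4 * c

lemma PD.mem {p : Pl F} {π : 𝓞 F} (h : PD p π) (v : Pl F) : π ∈ v.asIdeal ↔ v = p := by
  rw [← ord_int_pos_iff v (gen_ne_zero p h.hg), ord_gen p v h.hg]
  have := classNumber_pos F
  split_ifs with h <;> simp [h, this]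

lemma PD.dat (hodd : Odd (classNumber F)) {p : Pl F} {π : 𝓞 F} (h : PD p π) : Dat ∅ {p} π := by
  obtain ⟨ξ, c, h4⟩ := h.four
  have := datT hodd (S := ∅) (T := {p}) (gen_ne_zero p h.hg) (fun v => by rw [ord_gen p v h.hg]; simp) (by simp) (by simp) 1 (by
    rw [Units.val_one, one_mul]
    exact ⟨⟨ξ, c, h4, by simp⟩, h.pos⟩)
  rwa [Units.val_one, one_mul] at this

lemma PD.om (hodd : Odd (classNumber F)) {p : Pl F} {π : 𝓞 F} (h : PD p π) {q : Pl F} (hq : q ≠ p) :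
    (∃ ξ c, π = ξ ^ 2 - 4 * c ∧ c ∈ q.asIdeal) ↔ chi p (gen q) = 0 := by
  constructor
  · rintro ⟨ξ, c, h1, h2⟩
    exact lemR1 hodd hq h.hg h.pos h1 h2
  · intro h0
    obtain ⟨ξ, c, h4⟩ := h.four
    exact lemR2 hodd hq h.two h.hu h.hg h.pos h4 h0

lemma exists_b (Q : QE F L α β) (P : Pl L) {p p' : Pl F} (hb : below F P = p) (hne : p ≠ p') (h : chi p α = 0) :
    ∃ b : 𝓞 F, algebraMap (𝓞 F) (𝓞 L) b - β ∈ P.asIdeal ∧ b ∉ p'.asIdeal ∧ b ^ 2 - α ∈ p.asIdeal := by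
  obtain ⟨b0, h0⟩ := chi_zero_iff.1 h
  rw [← hb] at h0
  obtain ⟨b', -, h1⟩ := Q.beta_cong P h0
  have hcop : IsCoprime p.asIdeal p'.asIdeal := by
    rw [Ideal.isCoprime_iff_sup_eq]
    refine Ideal.IsMaximal.coprime_of_ne p.isMaximal p'.isMaximal fun h => hne (IsDedekindDomain.HeightOneSpectrum.ext h)
  obtain ⟨u, hu, v, hv, huv⟩ := Ideal.isCoprime_iff_exists.1 hcop
  have hbb : algebraMap (𝓞 F) (𝓞 L) (b' * v + u) - β ∈ P.asIdeal := by
    have h2 : (1 - b') * u ∈ p.asIdeal := Ideal.mul_mem_left _ _ hu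
    rw [← hb, mem_below] at h2
    have h3 := Ideal.sub_mem _ h2 h1
    convert h3 using 1
    have : v = 1 - u := by rw [← huv]; ring
    rw [this]
    simp only [map_add, map_mul, map_sub, map_one]
    ring
  refine ⟨b' * v + u, hbb, ?_, ?_⟩
  · intro h2
    have h3 : (1 : 𝓞 F) ∈ p'.asIdeal := by
      have h4 := Ideal.add_mem _ h2 (Ideal.mul_mem_left _ (1 - b') hv)
      convert h4 using 1
      linear_combination -huv
    exact p'.isPrime.ne_top ((Ideal.eq_top_iff_one _).2 h3)
  · rw [← hb, mem_below, map_sub, map_pow, ← Q.hβ]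
    have h4 := Ideal.mul_mem_left _ (algebraMap (𝓞 F) (𝓞 L) (b' * v + u) + β) hbb
    convert h4 using 1
    ring

lemma symb (Q : QE F L α β) (P : Pl L) {p : Pl F} (hb : below F P = p) (hsurj : ∀ z : 𝓞 L, ∃ x, z - algebraMap (𝓞 F) (𝓞 L) x ∈ P.asIdeal)
    (ε : (𝓞 L)ˣ) {γ : 𝓞 L} {n₁ n₂ s t₁ t₂ : 𝓞 F} (ht1 : algebraMap (𝓞 F) (𝓞 L) t₁ = ε * γ ^ 2 + Q.τ (ε * γ ^ 2))
    (hs : s = n₂ * t₁ + n₁ * t₂) (hγ : γ ∉ P.asIdeal) (hγ' : Q.τ γ ∈ P.asIdeal) (hn1 : n₁ ∈ p.asIdeal) (hn2 : n₂ ∉ p.asIdeal)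
    (hc : chi p n₂ = 0) : s ∉ p.asIdeal ∧ chi p s = chi P (ε : 𝓞 L) := by
  subst hb
  rw [mem_below] at hn1 hn2
  have h1 : algebraMap (𝓞 F) (𝓞 L) s - algebraMap (𝓞 F) (𝓞 L) n₂ * (ε * γ ^ 2) ∈ P.asIdeal := by
    have h2 := Ideal.add_mem _ (Ideal.mul_mem_left _ (algebraMap (𝓞 F) (𝓞 L) n₂ * Q.τ ε * Q.τ γ) hγ')
      (Ideal.mul_mem_left _ (algebraMap (𝓞 F) (𝓞 L) t₂) hn1)
    convert h2 using 1
    rw [hs, map_add, map_mul, map_mul, ht1, map_mul, map_pow]; ring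
  have h3 : (ε : 𝓞 L) * γ ^ 2 ∉ P.asIdeal := fun h => (P.isPrime.mem_or_mem h).elim (unit_notin P ε) (pow_notin hγ 2)
  have h4 : algebraMap (𝓞 F) (𝓞 L) n₂ * (ε * γ ^ 2) ∉ P.asIdeal := fun h => (P.isPrime.mem_or_mem h).elim hn2 h3
  constructor
  · rw [mem_below]
    intro h5
    apply h4
    have := Ideal.sub_mem _ h5 h1
    convert this using 1
    ring
  · rw [← chi_surj P hsurj, chi_congr h1, chi_mul (r := P) hn2 h3, chi_surj P hsurj, hc, zero_add,
      chi_mul (r := P) (unit_notin P ε) (pow_notin hγ 2), chi_sq, add_zero]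

lemma unit_mul_eq (Q : QE F L α β) (ε : (𝓞 L)ˣ) : ∃ e : (𝓞 F)ˣ, algebraMap (𝓞 F) (𝓞 L) e = ε * Q.τ ε := by
  obtain ⟨x, hx⟩ := Q.τ_mul (ε : 𝓞 L)
  obtain ⟨y, hy⟩ := Q.τ_mul ((ε⁻¹ : (𝓞 L)ˣ) : 𝓞 L)
  have hxy : x * y = 1 := by
    apply am_inj (F := F) (L := L)
    rw [map_mul, hx, hy, map_one]
    have e1 : (ε : 𝓞 L) * ((ε⁻¹ : (𝓞 L)ˣ) : 𝓞 L) = 1 := by simp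
    have e2 : Q.τ (ε : 𝓞 L) * Q.τ ((ε⁻¹ : (𝓞 L)ˣ) : 𝓞 L) = 1 := by rw [← map_mul, e1, map_one]
    linear_combination Q.τ (ε : 𝓞 L) * Q.τ ((ε⁻¹ : (𝓞 L)ˣ) : 𝓞 L) * e1 + e2
  exact ⟨Units.mkOfMulEqOne x y hxy, hx⟩

/-- properties of the auxiliary element -/
lemma aux_gamma (Q : QE F L α β) (P : Pl L) {p p' : Pl F} (hb : below F P = p) (hne : p ≠ p') (D : PD p' α) (h2 : 2 ∉ p.asIdeal)
    (h : chi p α = 0) : ∃ (b n : 𝓞 F) (γ : 𝓞 L), n = b ^ 2 - α ∧ algebraMap (𝓞 F) (𝓞 L) n = γ * Q.τ γ ∧ γ ∉ P.asIdeal ∧ Q.τ γ ∈ P.asIdeal ∧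
      n ∈ p.asIdeal ∧ n ∉ p'.asIdeal ∧ chi p' n = 0 := by
  obtain ⟨b, h1, h3, h4⟩ := exists_b Q P hb hne h
  have hτ : Q.τ (algebraMap (𝓞 F) (𝓞 L) b + β) = algebraMap (𝓞 F) (𝓞 L) b - β := by
    rw [map_add, Q.τ_am, Q.τβ]; ring
  have hα : α ∈ p'.asIdeal := (D.mem p').2 rfl
  refine ⟨b, b ^ 2 - α, algebraMap (𝓞 F) (𝓞 L) b + β, rfl, ?_, ?_, ?_, h4, ?_, ?_⟩
  · rw [hτ, map_sub, map_pow, ← Q.hβ]; ring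
  · intro h5
    have h6 := Ideal.sub_mem _ h5 h1
    have h7 : 2 * β ∈ P.asIdeal := by convert h6 using 1; ring
    rcases P.isPrime.mem_or_mem h7 with h8 | h8
    · apply h2
      rw [← hb, mem_below, map_ofNat]; exact h8
    · rw [Q.mem_β, hb, D.mem] at h8
      exact hne h8
  · rw [hτ]; exact h1
  · intro h5
    apply pow_notin h3 2
    have := Ideal.add_mem _ h5 hα
    simpa using this
  · rw [chi_congr (b := b ^ 2) (by
      have : b ^ 2 - α - b ^ 2 = -α := by ring
      rw [this]; exact Ideal.neg_mem_iff _ |>.2 hα)]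
    exact chi_sq p' b

lemma surj_of (Q : QE F L α β) (P : Pl L) {p p' : Pl F} (hb : below F P = p) (hne : p ≠ p') (D : PD p' α) (h2 : 2 ∉ p.asIdeal)
    (h : chi p α = 0) (z : 𝓞 L) : ∃ x, z - algebraMap (𝓞 F) (𝓞 L) x ∈ P.asIdeal := by
  obtain ⟨b, hb'⟩ := chi_zero_iff.1 h
  refine Q.res_surj P (b := b) (by rw [hb]; exact hb') ?_ z
  rw [hb]
  intro hm
  rcases p.isPrime.mem_or_mem hm with h | h
  · exact h2 h
  · exact hne ((D.mem p).1 h)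

theorem oneway (hodd : Odd (classNumber F)) {p₁ p₂ : Pl F} (hne : p₁ ≠ p₂) (D₁ : PD p₁ α) (D₂ : PD p₂ α₂)
    (h12 : chi p₂ α = 0) (h21 : chi p₁ α₂ = 0) (Q : QE F L α β) (Q₂ : QE F M α₂ β₂) (P₂ : Pl L) (hP2 : below F P₂ = p₂)
    (P₁ : Pl M) (hP1 : below F P₁ = p₁) (ε : (𝓞 L)ˣ) (hε : chi P₂ (ε : 𝓞 L) = 1) : ∃ ε₂ : (𝓞 M)ˣ, chi P₁ (ε₂ : 𝓞 M) = 1 := by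
  obtain ⟨e, he⟩ := unit_mul_eq Q ε
  obtain ⟨ε₂, he2⟩ := Q₂.unit_norm hodd (D₂.dat hodd) e
  obtain ⟨b, n₁, γ, b1, b2, b3, b4, b5, b6, b7⟩ := aux_gamma Q P₂ hP2 hne.symm D₁ D₂.two h12
  obtain ⟨d, n₂, δ, d1, d2, d3, d4, d5, d6, d7⟩ := aux_gamma Q₂ P₁ hP1 hne D₂ D₁.two h21
  obtain ⟨t₁, ht1⟩ := Q.τ_add (ε * γ ^ 2)
  obtain ⟨t₂, ht2⟩ := Q₂.τ_add (ε₂ * δ ^ 2)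
  set s := n₂ * t₁ + n₁ * t₂ with hs
  obtain ⟨s2, c2⟩ := symb Q P₂ hP2 (surj_of Q P₂ hP2 hne.symm D₁ D₂.two h12) ε ht1 hs b3 b4 b5 d6 d7
  obtain ⟨s1, c1⟩ := symb Q₂ P₁ hP1 (surj_of Q₂ P₁ hP1 hne D₂ D₁.two h21) ε₂ ht2 (hs.trans (add_comm _ _)) d3 d4 d5 b6 b7
  have hs0 : s ≠ 0 := fun h => s1 (h ▸ Ideal.zero_mem _)
  have hγ0 : γ ≠ 0 := fun h => b3 (h ▸ Ideal.zero_mem _)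
  have hδ0 : δ ≠ 0 := fun h => d3 (h ▸ Ideal.zero_mem _)
  have hn1 : n₁ ≠ 0 := fun h => b6 (h ▸ Ideal.zero_mem _)
  have hn2 : n₂ ≠ 0 := fun h => d6 (h ▸ Ideal.zero_mem _)
  obtain ⟨ξ₁, x₁, f1⟩ := D₁.four
  obtain ⟨ξ₂, x₂, f2⟩ := D₂.four
  have key : chi p₁ s = chi p₂ s := by
    rw [chi_fact hodd p₁ D₁.hu s1 hs0, chi_fact hodd p₂ D₂.hu s2 hs0]
    refine Finset.sum_congr rfl fun v hv => ?_
    have hsv : s ∈ v.asIdeal := by simpa using hv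
    have hv1 : v ≠ p₁ := by rintro rfl; exact s1 hsv
    have hv2 : v ≠ p₂ := by rintro rfl; exact s2 hsv
    have ev : Even (ord v (s : F)) → ((ord v (s : F)).toNat : ZMod 2) = 0 := by
      intro h
      rw [ZMod.natCast_eq_zero_iff]
      have h0 := ord_int_nonneg v s
      obtain ⟨k, hk⟩ := h
      have hk' : ord v (s : F) = k + k := hk
      exact ⟨k.toNat, by omega⟩
    have o1 := D₁.om hodd hv1
    have o2 := D₂.om hodd hv2
    have m1 : α ∉ v.asIdeal := fun h => hv1 ((D₁.mem v).1 h)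
    have m2 : α₂ ∉ v.asIdeal := fun h => hv2 ((D₂.mem v).1 h)
    rcases zmod2 (chi p₁ (gen v)) with k1 | k1 <;> rcases zmod2 (chi p₂ (gen v)) with k2 | k2
    · rw [k1, k2]
    · obtain ⟨ξ, c, g1, g2⟩ := o1.2 k1
      have : ¬ ∃ ξ c, α₂ = ξ ^ 2 - 4 * c ∧ c ∈ v.asIdeal := by rw [o2, k2]; exact one_ne_zero
      rw [ev (half Q Q₂ ε ε₂ b2 d2 d1 he he2.symm ht1 ht2 hs hs0 hγ0 hn2 v g1 m1 g2 f2 this), zero_mul, zero_mul]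
    · obtain ⟨ξ, c, g1, g2⟩ := o2.2 k2
      have : ¬ ∃ ξ c, α = ξ ^ 2 - 4 * c ∧ c ∈ v.asIdeal := by rw [o1, k1]; exact one_ne_zero
      rw [ev (half Q₂ Q ε₂ ε d2 b2 b1 he2.symm he ht2 ht1 (hs.trans (add_comm _ _)) hs0 hδ0 hn1 v g1 m2 g2 f1 this), zero_mul, zero_mul]
    · rw [k1, k2]
  exact ⟨ε₂, by rw [← c1, key, c2, hε]⟩

lemma below_eq {p : Pl F} {P : Pl L} (h : Ideal.map (algebraMap (𝓞 F) (𝓞 L)) p.asIdeal ≤ P.asIdeal) : below F P = p := by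
  apply IsDedekindDomain.HeightOneSpectrum.ext
  exact (p.isMaximal.eq_of_le (below F P).isPrime.ne_top (Ideal.map_le_iff_le_comap.1 h)).symm

lemma mkQE {p : Pl F} {π : 𝓞 F} (hodd : Odd (classNumber F)) (D : PD p π) (hdeg : Module.finrank F L = 2) {b : L}
    (hb : b ^ 2 = algebraMap F L (algebraMap (𝓞 F) F π)) : ∃ β : 𝓞 L, QE F L π β := by
  obtain ⟨β, hβ⟩ := IsIntegrallyClosed.exists_algebraMap_eq_of_isIntegral_pow (R := 𝓞 L) (K := L) (x := b) (n := 2) (by norm_num) (by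
    rw [hb]
    exact isIntegral_algebraMap (R := 𝓞 L) (x := algebraMap (𝓞 F) (𝓞 L) π))
  refine ⟨β, hdeg, ?_, (D.dat hodd).ns⟩
  apply RingOfIntegers.ext
  have h1 : algebraMap (𝓞 L) L (β ^ 2) = b ^ 2 := by rw [map_pow, hβ]
  exact h1.trans hb

lemma mkPD {p : Pl F} {π : 𝓞 F} (hN : Odd (Ideal.absNorm p.asIdeal)) (hp : IsPrimaryIdeal F p.asIdeal) (hπ : IsPrimaryElem F π)
    (hg : p.asIdeal ^ classNumber F = Ideal.span {π}) : PD p π := by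
  obtain ⟨h1, ξ, c, h2⟩ := hπ
  refine ⟨(sym_iff hN (unit_notin p 1)).1, fun e => (sym_iff hN (unit_notin p e)).2.1 (hp e), hg, h1, ξ, -c, ?_⟩
  linear_combination h2

theorem main (hodd : Odd (classNumber F)) {p₁ p₂ : Pl F} (hne : p₁ ≠ p₂)
    (hN1 : Odd (Ideal.absNorm p₁.asIdeal)) (hN2 : Odd (Ideal.absNorm p₂.asIdeal)) (D₁ : PD p₁ α) (D₂ : PD p₂ α₂)
    (h12 : quadResSym F p₂.asIdeal α = 1) (h21 : quadResSym F p₁.asIdeal α₂ = 1) (Q : QE F L α β) (Q₂ : QE F M α₂ β₂)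
    (P₂ : Pl L) (hP2 : below F P₂ = p₂) (P₁ : Pl M) (hP1 : below F P₁ = p₁) :
    (∀ ε : (𝓞 L)ˣ, quadResSym L P₂.asIdeal (ε : 𝓞 L) = 1) ↔ (∀ ε : (𝓞 M)ˣ, quadResSym M P₁.asIdeal (ε : 𝓞 M) = 1) := by
  have c12 : chi p₂ α = 0 := (sym_iff hN2 (fun h => hne ((D₁.mem p₂).1 h).symm)).2.1 h12
  have c21 : chi p₁ α₂ = 0 := (sym_iff hN1 (fun h => hne ((D₂.mem p₁).1 h))).2.1 h21
  have n2 : Odd (Ideal.absNorm P₂.asIdeal) := by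
    rw [norm_eq_of_surj P₂ (surj_of Q P₂ hP2 hne.symm D₁ D₂.two c12), hP2]; exact hN2
  have n1 : Odd (Ideal.absNorm P₁.asIdeal) := by
    rw [norm_eq_of_surj P₁ (surj_of Q₂ P₁ hP1 hne D₂ D₁.two c21), hP1]; exact hN1
  have e1 : ∀ ε : (𝓞 L)ˣ, quadResSym L P₂.asIdeal (ε : 𝓞 L) = 1 ↔ chi P₂ (ε : 𝓞 L) = 0 := fun ε => (sym_iff n2 (unit_notin P₂ ε)).2
  have e2 : ∀ ε : (𝓞 M)ˣ, quadResSym M P₁.asIdeal (ε : 𝓞 M) = 1 ↔ chi P₁ (ε : 𝓞 M) = 0 := fun ε => (sym_iff n1 (unit_notin P₁ ε)).2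
  simp only [e1, e2]
  constructor
  · intro h ε
    refine (zmod2 _).resolve_right fun hε => ?_
    obtain ⟨ε', h'⟩ := oneway hodd hne.symm D₂ D₁ c21 c12 Q₂ Q P₁ hP1 P₂ hP2 ε hε
    rw [h ε'] at h'
    exact zero_ne_one h'
  · intro h ε
    refine (zmod2 _).resolve_right fun hε => ?_
    obtain ⟨ε', h'⟩ := oneway hodd hne D₁ D₂ c12 c21 Q Q₂ P₂ hP2 P₁ hP1 ε hε
    rw [h ε'] at h'
    exact zero_ne_one h'
end fin
end Sch

/-- Scholz reciprocity `(E₁/𝔭₂) = (E₂/𝔭₁)` in the two-ramified-primes situation with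
`𝔭₁, 𝔭₂` primary and `(𝔭₁/𝔭₂) = (𝔭₂/𝔭₁) = +1`. -/
theorem scholz_reciprocity_general
    (F : Type*) [Field F] [NumberField F]
    (hoddF : Odd (NumberField.classNumber F))
    (k : Type*) [Field k] [NumberField k] [Algebra F k]
    (hdeg : Module.finrank F k = 2)
    (𝔭₁ 𝔭₂ : Ideal (𝓞 F)) (hp1 : 𝔭₁.IsPrime) (hp2 : 𝔭₂.IsPrime) (hne : 𝔭₁ ≠ 𝔭₂)
    (hN1 : Odd (Ideal.absNorm 𝔭₁)) (hN2 : Odd (Ideal.absNorm 𝔭₂))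
    (hram : ∀ 𝔭 : Ideal (𝓞 F), 𝔭.IsPrime → 𝔭 ≠ ⊥ →
      (IsRamifiedIn F k 𝔭 ↔ 𝔭 = 𝔭₁ ∨ 𝔭 = 𝔭₂))
    (hinf : UnramifiedAtInfinitePlaces F k)
    (hprim1 : IsPrimaryIdeal F 𝔭₁) (hprim2 : IsPrimaryIdeal F 𝔭₂)
    (π₁ π₂ : 𝓞 F) (hπ₁ : IsPrimaryElem F π₁) (hπ₂ : IsPrimaryElem F π₂)
    (hgen1 : 𝔭₁ ^ NumberField.classNumber F = Ideal.span {π₁})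
    (hgen2 : 𝔭₂ ^ NumberField.classNumber F = Ideal.span {π₂})
    (hsym1 : quadResSym F 𝔭₂ π₁ = 1)   -- `(𝔭₁/𝔭₂) = +1`
    (hsym2 : quadResSym F 𝔭₁ π₂ = 1)   -- `(𝔭₂/𝔭₁) = +1`
    (k₁ : Type*) [Field k₁] [NumberField k₁] [Algebra F k₁]
    (hdeg1 : Module.finrank F k₁ = 2)
    (β₁ : k₁) (hβ₁ : β₁ ^ 2 = algebraMap F k₁ (algebraMap (𝓞 F) F π₁))  -- `k₁ = F(√π₁)`
    (k₂ : Type*) [Field k₂] [NumberField k₂] [Algebra F k₂]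
    (hdeg2 : Module.finrank F k₂ = 2)
    (β₂ : k₂) (hβ₂ : β₂ ^ 2 = algebraMap F k₂ (algebraMap (𝓞 F) F π₂))  -- `k₂ = F(√π₂)`
    (𝔓₂ : Ideal (𝓞 k₁)) (hP2 : 𝔓₂.IsPrime) (hP2ne : 𝔓₂ ≠ ⊥)
    (hP2above : Ideal.map (algebraMap (𝓞 F) (𝓞 k₁)) 𝔭₂ ≤ 𝔓₂)  -- `𝔓₂` lies above `𝔭₂`
    (𝔓₁ : Ideal (𝓞 k₂)) (hP1 : 𝔓₁.IsPrime) (hP1ne : 𝔓₁ ≠ ⊥)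
    (hP1above : Ideal.map (algebraMap (𝓞 F) (𝓞 k₂)) 𝔭₁ ≤ 𝔓₁)  -- `𝔓₁` lies above `𝔭₁`
    : ((∀ ε : (𝓞 k₁)ˣ, quadResSym k₁ 𝔓₂ (ε : 𝓞 k₁) = 1) ↔
       (∀ ε : (𝓞 k₂)ˣ, quadResSym k₂ 𝔓₁ (ε : 𝓞 k₂) = 1)) := by
  have b1 : 𝔭₁ ≠ ⊥ := by rintro rfl; simp at hN1
  have b2 : 𝔭₂ ≠ ⊥ := by rintro rfl; simp at hN2
  let p₁ : Sch.Pl F := ⟨𝔭₁, hp1, b1⟩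
  let p₂ : Sch.Pl F := ⟨𝔭₂, hp2, b2⟩
  have D₁ : Sch.PD p₁ π₁ := Sch.mkPD hN1 hprim1 hπ₁ hgen1
  have D₂ : Sch.PD p₂ π₂ := Sch.mkPD hN2 hprim2 hπ₂ hgen2
  obtain ⟨c₁, Q₁⟩ := Sch.mkQE hoddF D₁ hdeg1 hβ₁
  obtain ⟨c₂, Q₂⟩ := Sch.mkQE hoddF D₂ hdeg2 hβ₂
  let P₂ : Sch.Pl k₁ := ⟨𝔓₂, hP2, hP2ne⟩
  let P₁ : Sch.Pl k₂ := ⟨𝔓₁, hP1, hP1ne⟩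
  exact Sch.main hoddF (p₁ := p₁) (p₂ := p₂) (fun h => hne (congrArg (fun v => v.asIdeal) h)) hN1 hN2 D₁ D₂ hsym1 hsym2 Q₁ Q₂
    P₂ (Sch.below_eq (p := p₂) (P := P₂) hP2above) P₁ (Sch.below_eq (p := p₁) (P := P₁) hP1above)
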